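/- arXiv:2206.15414 — 3 statements merged into one kernel-verified Lean document; each statement's English description precedes it below -/
import Mathlib

section
/- There is a constant γ > 0 such that for every integer n ≥ 2 there exists a bipartite simple graph G on n vertices with the property that every convex obstacle representation of G uses at least γ·n obstacles; that is, the maximum convex obstacle number of n-vertex (bipartite) graphs is Ω(n). -/
open scoped Classical

noncomputable section

/-- A simple polygon in the plane, given by `k ≥ 3` pairwise distinct vertices
`p₀, …, p_{k-1}` (indexed cyclically by `ZMod k`): consecutive boundary segments
meet exactly in their shared endpoint, and non-consecutive ones are disjoint. -/
structure SimplePolygon where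
  k : ℕ
  three_le : 3 ≤ k
  verts : ZMod k → ℝ × ℝ
  inj : Function.Injective verts
  consec : ∀ i : ZMod k,
    segment ℝ (verts i) (verts (i + 1)) ∩ segment ℝ (verts (i + 1)) (verts (i + 2)) =
      {verts (i + 1)}
  nonconsec : ∀ i j : ZMod k, j ≠ i → j ≠ i + 1 → i ≠ j + 1 →
    Disjoint (segment ℝ (verts i) (verts (i + 1))) (segment ℝ (verts j) (verts (j + 1)))

/-- The union `C` of the boundary segments of a simple polygon. -/
def SimplePolygon.boundary (P : SimplePolygon) : Set (ℝ × ℝ) :=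
  ⋃ i : ZMod P.k, segment ℝ (P.verts i) (P.verts (i + 1))

/-- The simple polygon as a set: the boundary `C` together with the union `B` of all
bounded connected components of the complement of `C`. -/
def SimplePolygon.toSet (P : SimplePolygon) : Set (ℝ × ℝ) :=
  P.boundary ∪ {x | x ∉ P.boundary ∧ Bornology.IsBounded (connectedComponentIn P.boundaryᶜ x)}

/-- An obstacle representation of a simple graph `G`: an injective placement of the
vertices in general position together with finitely many pairwise disjoint simple
polygons (obstacles) such that edges are unobstructed segments and non-edges are
blocked by some obstacle. -/
structure ObstacleRep {V : Type*} (G : SimpleGraph V) where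
  pos : V → ℝ × ℝ
  posInj : Function.Injective pos
  genPos : ∀ u v w : V, u ≠ v → u ≠ w → v ≠ w →
    ¬ Collinear ℝ ({pos u, pos v, pos w} : Set (ℝ × ℝ))
  numObs : ℕ
  obs : Fin numObs → SimplePolygon
  disj : ∀ i j : Fin numObs, i ≠ j → Disjoint (obs i).toSet (obs j).toSet
  edges_clear : ∀ u v : V, G.Adj u v → ∀ i,
    Disjoint (segment ℝ (pos u) (pos v)) (obs i).toSet
  nonedges_blocked : ∀ u v : V, u ≠ v → ¬ G.Adj u v →
    ∃ i, (segment ℝ (pos u) (pos v) ∩ (obs i).toSet).Nonempty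

/-- A convex polygon: the convex hull of a finite set of at least three points
that are not all collinear. -/
def IsConvexPolygon (S : Set (ℝ × ℝ)) : Prop :=
  ∃ F : Finset (ℝ × ℝ), 3 ≤ F.card ∧ ¬ Collinear ℝ (F : Set (ℝ × ℝ)) ∧
    S = convexHull ℝ (F : Set (ℝ × ℝ))

/-- A convex obstacle representation: an obstacle representation all of whose
obstacles are convex polygons. -/
structure ConvexObstacleRep {V : Type*} (G : SimpleGraph V) where
  pos : V → ℝ × ℝ
  posInj : Function.Injective pos
  genPos : ∀ u v w : V, u ≠ v → u ≠ w → v ≠ w →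
    ¬ Collinear ℝ ({pos u, pos v, pos w} : Set (ℝ × ℝ))
  numObs : ℕ
  obs : Fin numObs → Set (ℝ × ℝ)
  convexPoly : ∀ i, IsConvexPolygon (obs i)
  disj : ∀ i j : Fin numObs, i ≠ j → Disjoint (obs i) (obs j)
  edges_clear : ∀ u v : V, G.Adj u v → ∀ i,
    Disjoint (segment ℝ (pos u) (pos v)) (obs i)
  nonedges_blocked : ∀ u v : V, u ≠ v → ¬ G.Adj u v →
    ∃ i, (segment ℝ (pos u) (pos v) ∩ (obs i)).Nonempty

open MvPolynomial in
theorem hasDerivAt_eval_update {σ : Type*} [DecidableEq σ] (p : MvPolynomial σ ℝ) (x : σ → ℝ)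
    (j : σ) (r : ℝ) :
    HasDerivAt (fun s => eval (Function.update x j s) p)
      (eval (Function.update x j r) (pderiv j p)) r := by
  induction p using MvPolynomial.induction_on with
  | C c => simpa using hasDerivAt_const r c
  | add p q hp hq =>
    simp only [map_add]
    exact hp.add hq
  | mul_X p i hp =>
    have hX : HasDerivAt (fun s => Function.update x j s i)
        (eval (Function.update x j r) (pderiv j (X i : MvPolynomial σ ℝ))) r := by
      by_cases h : i = j
      · subst h
        simp only [Function.update_self, pderiv_X_self, map_one]
        exact hasDerivAt_id r
      · simpa [h, pderiv_X_of_ne h] using hasDerivAt_const r (x i)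
    have h := hp.mul hX
    simp only [eval_mul, eval_X, Derivation.leibniz, smul_eq_mul, map_add] at h ⊢
    rw [mul_comm (Function.update x j r i), add_comm]
    exact h

open MvPolynomial in
theorem totalDegree_pderiv_le {σ : Type*} (p : MvPolynomial σ ℝ) (j : σ) :
    (pderiv j p).totalDegree ≤ p.totalDegree := by
  have h : pderiv j p = ∑ s ∈ p.support, pderiv j (monomial s (coeff s p)) := by
    conv_lhs => rw [p.as_sum]
    rw [map_sum]
  rw [h]
  refine totalDegree_finsetSum_le fun s hs => ?_
  rw [pderiv_monomial]
  refine (totalDegree_monomial_le _ _).trans (le_trans ?_ (le_totalDegree hs))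
  exact Finsupp.degree_mono tsub_le_self

open MvPolynomial in
/-- In `N` variables, `N + 1` polynomials are algebraically dependent, with a bound on the degree
of the relation in the distinguished polynomial `ℓ`. -/
theorem exists_algebraic_relation {N D A : ℕ} (hD : 1 ≤ D) (ℓ : MvPolynomial (Fin N) ℝ)
    (G : Fin N → MvPolynomial (Fin N) ℝ) (hℓ : ℓ.totalDegree ≤ D)
    (hG : ∀ j, (G j).totalDegree ≤ D) (hA : (D * (N + 1)) ^ N ≤ A) :
    ∃ q : Fin (A + 1) → MvPolynomial (Fin N) ℝ, q ≠ 0 ∧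
      ∑ a, aeval G (q a) * ℓ ^ (a : ℕ) = 0 := by
  set L := A * (D * (N + 1)) with hL
  let toExp (K : ℕ) (b : Fin N → Fin K) : Fin N →₀ ℕ :=
    Finsupp.equivFunOnFinite.symm fun j => (b j : ℕ)
  have toExp_inj (K : ℕ) : Function.Injective (toExp K) := by
    intro b b' h
    have h' := Finsupp.equivFunOnFinite.symm.injective h
    funext j
    exact Fin.ext (congrFun h' j)
  let Q : (Fin (A + 1) → (Fin N → Fin (A + 1)) → ℝ) → Fin (A + 1) → MvPolynomial (Fin N) ℝ :=
    fun w a => ∑ b, monomial (toExp (A + 1) b) (w a b)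
  let S : (Fin (A + 1) → (Fin N → Fin (A + 1)) → ℝ) →ₗ[ℝ] MvPolynomial (Fin N) ℝ :=
    { toFun := fun w => ∑ a, aeval G (Q w a) * ℓ ^ (a : ℕ)
      map_add' := by
        intro w w'
        simp [Q, add_mul, Finset.sum_add_distrib]
      map_smul' := by
        intro r w
        simp only [Q, Pi.smul_apply, smul_eq_mul, map_sum, RingHom.id_apply, Finset.smul_sum]
        refine Finset.sum_congr rfl fun a _ => ?_
        rw [← smul_mul_assoc, Finset.smul_sum]
        congr 1
        refine Finset.sum_congr rfl fun b _ => ?_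
        rw [← map_smul, smul_monomial, smul_eq_mul] }
  let Φ : (Fin (A + 1) → (Fin N → Fin (A + 1)) → ℝ) →ₗ[ℝ] ((Fin N → Fin (L + 1)) → ℝ) :=
    LinearMap.pi fun m => (lcoeff ℝ (toExp (L + 1) m)).comp S
  have hrank : Module.finrank ℝ ((Fin N → Fin (L + 1)) → ℝ) <
      Module.finrank ℝ (Fin (A + 1) → (Fin N → Fin (A + 1)) → ℝ) := by
    rw [Module.finrank_pi, Module.finrank_pi_fintype]
    simp only [Module.finrank_pi, Fintype.card_pi, Fintype.card_fin, Finset.prod_const,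
      Finset.card_univ, Finset.sum_const, smul_eq_mul]
    have h1 : L + 1 ≤ (A + 1) * (D * (N + 1)) := by
      have : 1 ≤ D * (N + 1) := Nat.one_le_iff_ne_zero.2 (by positivity)
      rw [hL]; nlinarith
    calc (L + 1) ^ N ≤ ((A + 1) * (D * (N + 1))) ^ N := Nat.pow_le_pow_left h1 N
      _ = (A + 1) ^ N * (D * (N + 1)) ^ N := mul_pow _ _ _
      _ < (A + 1) ^ N * (A + 1) := by
        apply Nat.mul_lt_mul_of_pos_left (Nat.lt_succ_of_le hA) (by positivity)
      _ = _ := mul_comm _ _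
  obtain ⟨w, hw, hw0⟩ := (Submodule.ne_bot_iff _).1
    (LinearMap.ker_ne_bot_of_finrank_lt (f := Φ) hrank)
  have hdeg : (S w).totalDegree ≤ L := by
    refine totalDegree_finsetSum_le fun a _ => ?_
    refine (totalDegree_mul _ _).trans ?_
    have ha : (ℓ ^ (a : ℕ)).totalDegree ≤ A * D :=
      (totalDegree_pow _ _).trans (Nat.mul_le_mul (Nat.lt_succ_iff.1 a.2) hℓ)
    have hq : (aeval G (Q w a)).totalDegree ≤ N * (A * D) := by
      simp only [Q, map_sum]
      refine totalDegree_finsetSum_le fun b _ => ?_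
      rw [aeval_monomial]
      refine (totalDegree_mul _ _).trans ?_
      rw [algebraMap_eq, totalDegree_C, zero_add, Finsupp.prod_fintype _ _ (by simp)]
      refine (totalDegree_finsetProd _ _).trans ?_
      refine (Finset.sum_le_card_nsmul _ _ (A * D) fun j _ => ?_).trans (by simp)
      exact (totalDegree_pow _ _).trans (Nat.mul_le_mul (Nat.lt_succ_iff.1 (b j).2) (hG j))
    calc _ ≤ N * (A * D) + A * D := Nat.add_le_add hq ha
      _ = L := by rw [hL]; ring
  refine ⟨Q w, fun h0 => hw0 ?_, ?_⟩
  · funext a b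
    have h1 := congrArg (coeff (toExp (A + 1) b)) (congrFun h0 a)
    simp only [Q, coeff_sum, coeff_monomial, Pi.zero_apply, coeff_zero] at h1
    rw [Finset.sum_eq_single b] at h1
    · simpa using h1
    · intro b' _ hb
      rw [if_neg fun h => hb (toExp_inj _ h)]
    · simp
  · change S w = 0
    ext m
    rw [coeff_zero]
    by_contra hm
    have hms : m ∈ (S w).support := mem_support_iff.2 hm
    have hle (j) : m j < L + 1 := by
      have h1 : m j ≤ m.degree := Finsupp.le_degree j m
      have h2 : m.degree ≤ (S w).totalDegree := le_totalDegree hms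
      omega
    have h3 := congrFun (LinearMap.mem_ker.1 hw) fun j => ⟨m j, hle j⟩
    apply hm
    have h4 : toExp (L + 1) (fun j => ⟨m j, hle j⟩) = m := by ext j; simp [toExp]
    simpa [Φ, h4] using h3

open MvPolynomial in
/-- A polynomial that vanishes on the relative boundary of an open region but not at some interior
point has every small vector as a gradient inside the region. -/
theorem exists_small_gradients_of_pos {N : ℕ} (F : MvPolynomial (Fin N) ℝ)
    {U K : Set (Fin N → ℝ)} (hU : IsOpen U) (hK : IsCompact K) (hUK : U ⊆ K)
    (hF : ∀ x ∈ K, x ∉ U → eval x F = 0) {x₀ : Fin N → ℝ} (hx₀ : x₀ ∈ U)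
    (hpos : 0 < eval x₀ F) :
    ∃ δ : ℝ, 0 < δ ∧ ∀ c : Fin N → ℝ, (∀ j, |c j| < δ) →
      ∃ x ∈ U, ∀ j, eval x (pderiv j F) = c j := by
  obtain ⟨B, hB⟩ := hK.isBounded.exists_norm_le
  have hB0 : 0 ≤ B := (norm_nonneg _).trans (hB x₀ (hUK hx₀))
  refine ⟨eval x₀ F / (2 * N * B + 1), by positivity, fun c hc => ?_⟩
  have hlin (x) (hx : x ∈ K) : |∑ j, c j * x j| ≤ N * (eval x₀ F / (2 * N * B + 1)) * B := by
    calc |∑ j, c j * x j| ≤ ∑ j : Fin N, |c j * x j| := Finset.abs_sum_le_sum_abs _ _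
      _ ≤ ∑ _j : Fin N, (eval x₀ F / (2 * N * B + 1)) * B := by
        refine Finset.sum_le_sum fun j _ => ?_
        rw [abs_mul]
        exact mul_le_mul (hc j).le ((norm_le_pi_norm x j).trans (hB x hx)) (abs_nonneg _)
          (by positivity)
      _ = _ := by simp [mul_assoc]
  set P : MvPolynomial (Fin N) ℝ := F - ∑ j, C (c j) * X j with hP
  have hPe (x) : eval x P = eval x F - ∑ j, c j * x j := by simp [hP]
  obtain ⟨x, hxK, hmax⟩ := hK.exists_isMaxOn ⟨x₀, hUK hx₀⟩
    (MvPolynomial.continuous_eval P).continuousOn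
  have hxU : x ∈ U := by
    by_contra hxU
    have h1 : eval x₀ P ≤ eval x P := hmax (hUK hx₀)
    rw [hPe, hPe, hF x hxK hxU] at h1
    have h2 := abs_le.1 (hlin x hxK)
    have h3 := abs_le.1 (hlin x₀ (hUK hx₀))
    have h4 : eval x₀ F = eval x₀ F / (2 * N * B + 1) * (2 * N * B + 1) := by
      field_simp
    have h5 : 0 < eval x₀ F / (2 * N * B + 1) := by positivity
    linarith
  refine ⟨x, hxU, fun j => ?_⟩
  have hupd : Function.update x j (x j) = x := Function.update_eq_self j x
  have hcont : Continuous fun s => Function.update x j s := continuous_const.update j continuous_id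
  have hloc : IsLocalMax (fun s => eval (Function.update x j s) P) (x j) := by
    have hmem : ∀ᶠ s in nhds (x j), Function.update x j s ∈ U :=
      hcont.continuousAt.eventually_mem (by rw [hupd]; exact hU.mem_nhds hxU)
    filter_upwards [hmem] with s hs
    rw [hupd]
    exact hmax (hUK hs)
  have hder := hloc.hasDerivAt_eq_zero (hasDerivAt_eval_update P x j (x j))
  rw [hupd] at hder
  have hpd : pderiv j P = pderiv j F - C (c j) := by
    simp only [hP, map_sub, map_sum, pderiv_C_mul, pderiv_X]
    rw [Finset.sum_eq_single j]
    · simp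
    · intro i _ hi
      simp [hi]
    · simp
  rw [hpd, map_sub, eval_C] at hder
  linarith

open MvPolynomial in
theorem exists_small_gradients {N : ℕ} (F : MvPolynomial (Fin N) ℝ)
    {U K : Set (Fin N → ℝ)} (hU : IsOpen U) (hK : IsCompact K) (hUK : U ⊆ K)
    (hF : ∀ x ∈ K, x ∉ U → eval x F = 0) {x₀ : Fin N → ℝ} (hx₀ : x₀ ∈ U)
    (hne : eval x₀ F ≠ 0) :
    ∃ δ : ℝ, 0 < δ ∧ ∀ c : Fin N → ℝ, (∀ j, |c j| < δ) →
      ∃ x ∈ U, ∀ j, eval x (pderiv j F) = c j := by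
  rcases hne.lt_or_gt with h | h
  · obtain ⟨δ, hδ, hc⟩ := exists_small_gradients_of_pos (-F) hU hK hUK
      (fun x hx hxU => by simp [hF x hx hxU]) hx₀ (by simpa using h)
    refine ⟨δ, hδ, fun c hcδ => ?_⟩
    obtain ⟨x, hx, hg⟩ := hc (-c) (by simpa using hcδ)
    exact ⟨x, hx, fun j => by simpa using hg j⟩
  · exact exists_small_gradients_of_pos F hU hK hUK hF hx₀ h

open MvPolynomial in
/-- Finitely many disjoint regions in each of which the gradient of `F` takes all small values are
at most as numerous as the Bézout-type bound allows. -/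
theorem card_le_of_small_gradients {N D M : ℕ} (hD : 1 ≤ D) (F : MvPolynomial (Fin N) ℝ)
    (hdeg : F.totalDegree ≤ D) (U : Fin M → Set (Fin N → ℝ))
    (hdisj : ∀ s s', s ≠ s' → Disjoint (U s) (U s')) {δ : ℝ} (hδ : 0 < δ)
    (hgrad : ∀ c : Fin N → ℝ, (∀ j, |c j| < δ) →
      ∀ s, ∃ x ∈ U s, ∀ j, eval x (pderiv j F) = c j) :
    M ≤ (D * (N + 1)) ^ N := by
  set A := (D * (N + 1)) ^ N with hA
  let ℓ : ℕ → MvPolynomial (Fin N) ℝ := fun t => ∑ j : Fin N, C ((t : ℝ) ^ (j : ℕ)) * X j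
  have hℓ (t) : (ℓ t).totalDegree ≤ D := by
    refine (totalDegree_finsetSum_le fun j _ => ?_ : _ ≤ 1).trans hD
    exact (totalDegree_mul _ _).trans (by rw [totalDegree_C, totalDegree_X])
  have hrel (t : ℕ) := exists_algebraic_relation hD (ℓ t) (fun j => pderiv j F) (hℓ t)
    (fun j => (totalDegree_pderiv_le F j).trans hdeg) hA.ge
  choose q hq0 hq using hrel
  have hq1 (t : ℕ) : ∃ a, q t a ≠ 0 := Function.ne_iff.1 (hq0 t)
  choose a ha using hq1
  have hprod : ∏ t ∈ Finset.range (M * M * N + 1), q t (a t) ≠ 0 :=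
    Finset.prod_ne_zero_iff.2 fun t _ => ha t
  obtain ⟨c, hc, hcq⟩ : ∃ c : Fin N → ℝ, (∀ j, |c j| < δ) ∧
      eval c (∏ t ∈ Finset.range (M * M * N + 1), q t (a t)) ≠ 0 := by
    by_contra! hcon
    refine hprod (funext_set (fun _ => Set.Ioo (-δ) δ) (fun _ => Set.Ioo_infinite (by linarith))
      fun c hc => ?_)
    rw [map_zero]
    exact hcon c fun j => abs_lt.2 (hc j (Set.mem_univ j))
  choose x hxU hx using hgrad c hc
  have hxinj : Function.Injective x := by
    intro s s' h
    by_contra hss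
    exact Set.disjoint_left.1 (hdisj s s' hss) (hxU s) (h ▸ hxU s')
  obtain ⟨t, ht, hinj⟩ : ∃ t ∈ Finset.range (M * M * N + 1),
      Function.Injective fun s => eval (x s) (ℓ t) := by
    let R : Fin M × Fin M → Polynomial ℝ := fun p =>
      ∑ j : Fin N, Polynomial.C (x p.1 j - x p.2 j) * Polynomial.X ^ (j : ℕ)
    have hRne (p : Fin M × Fin M) (hp : p.1 ≠ p.2) : R p ≠ 0 := by
      intro h0
      refine hp (hxinj (funext fun j => ?_))
      have := congrArg (fun P => Polynomial.coeff P (j : ℕ)) h0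
      simp only [R, Polynomial.finsetSum_coeff, Polynomial.coeff_C_mul_X_pow,
        Polynomial.coeff_zero] at this
      rw [Finset.sum_eq_single j] at this
      · simpa [sub_eq_zero] using this
      · intro i _ hi
        rw [if_neg fun h => hi (Fin.ext h.symm)]
      · simp
    have hRdeg (p) : (R p).natDegree ≤ N := by
      refine Polynomial.natDegree_sum_le_of_forall_le _ _ fun j _ => ?_
      exact (Polynomial.natDegree_C_mul_X_pow_le _ _).trans j.2.le
    let bad : Finset ℝ := Finset.univ.biUnion fun p : Fin M × Fin M => (R p).roots.toFinset
    have hbad : bad.card ≤ M * M * N := by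
      refine Finset.card_biUnion_le.trans ?_
      refine (Finset.sum_le_card_nsmul _ _ N fun p _ => ?_).trans (by simp)
      exact (Multiset.toFinset_card_le _).trans ((Polynomial.card_roots' _).trans (hRdeg p))
    obtain ⟨r, hr, hrbad⟩ : ∃ r ∈ (Finset.range (M * M * N + 1)).image (fun t : ℕ => (t : ℝ)),
        r ∉ bad := by
      apply Finset.exists_mem_notMem_of_card_lt_card
      rw [Finset.card_image_of_injective _ Nat.cast_injective, Finset.card_range]
      omega
    obtain ⟨t, ht, rfl⟩ := Finset.mem_image.1 hr
    refine ⟨t, ht, fun s s' h => ?_⟩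
    by_contra hss
    refine hrbad (Finset.mem_biUnion.2 ⟨(s, s'), Finset.mem_univ _, ?_⟩)
    rw [Multiset.mem_toFinset, Polynomial.mem_roots (hRne (s, s') hss), Polynomial.IsRoot]
    simp only [ℓ, map_sum, map_mul, eval_C, eval_X] at h
    simp only [R, Polynomial.eval_finsetSum, Polynomial.eval_mul, Polynomial.eval_C,
      Polynomial.eval_pow, Polynomial.eval_X]
    rw [← sub_eq_zero, ← Finset.sum_sub_distrib] at h
    rw [← h]
    exact Finset.sum_congr rfl fun j _ => by ring
  let P : Polynomial ℝ := ∑ b : Fin (A + 1),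
    Polynomial.C (eval c (q t b)) * Polynomial.X ^ (b : ℕ)
  have hP0 : P ≠ 0 := by
    intro h0
    have := congrArg (fun P => Polynomial.coeff P (a t : ℕ)) h0
    simp only [P, Polynomial.finsetSum_coeff, Polynomial.coeff_C_mul_X_pow,
      Polynomial.coeff_zero] at this
    rw [Finset.sum_eq_single (a t)] at this
    · rw [map_prod] at hcq
      exact Finset.prod_ne_zero_iff.1 hcq t ht (by simpa using this)
    · intro i _ hi
      rw [if_neg fun h => hi (Fin.ext h.symm)]
    · simp
  have hPdeg : P.natDegree ≤ A := by
    refine Polynomial.natDegree_sum_le_of_forall_le _ _ fun j _ => ?_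
    exact (Polynomial.natDegree_C_mul_X_pow_le _ _).trans (Nat.lt_succ_iff.1 j.2)
  have hroot (s) : eval (x s) (ℓ t) ∈ P.roots.toFinset := by
    rw [Multiset.mem_toFinset, Polynomial.mem_roots hP0, Polynomial.IsRoot]
    have h1 := congrArg (eval (x s)) (hq t)
    have h2 : (fun j => eval (x s) (pderiv j F)) = c := funext (hx s)
    have h3 (p : MvPolynomial (Fin N) ℝ) :
        eval (x s) (aeval (fun j => pderiv j F) p) = eval c p := by
      rw [← h2, aeval_def, ← coe_eval₂Hom, ← RingHom.comp_apply]
      congr 1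
      ext <;> simp
    simp only [map_sum, map_mul, map_pow, h3, map_zero] at h1
    simpa [P, Polynomial.eval_finsetSum] using h1
  calc M = (Finset.univ.image fun s => eval (x s) (ℓ t)).card := by
        rw [Finset.card_image_of_injective _ hinj]; simp
    _ ≤ P.roots.toFinset.card := Finset.card_le_card fun r hr => by
        obtain ⟨s, _, rfl⟩ := Finset.mem_image.1 hr
        exact hroot s
    _ ≤ A := (Multiset.toFinset_card_le _).trans ((Polynomial.card_roots' _).trans hPdeg)

open MvPolynomial in
/-- A Warren-type bound for the number of positivity patterns of finitely many polynomials. -/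
theorem ncard_range_pos_pattern_le {ι : Type*} [Fintype ι] {N d : ℕ}
    (f : ι → MvPolynomial (Fin N) ℝ) (hd : ∀ i, (f i).totalDegree ≤ d) :
    (Set.range fun (x : Fin N → ℝ) (i : ι) => 0 < eval x (f i)).ncard ≤
      ((2 + Fintype.card ι * d) * (N + 1)) ^ N := by
  set S := Set.range fun (x : Fin N → ℝ) (i : ι) => 0 < eval x (f i) with hS
  let e := Finite.equivFin S
  have hX (s : Fin (Nat.card S)) : ∃ x : Fin N → ℝ, (fun i => 0 < eval x (f i)) = (e.symm s).1 :=
    (e.symm s).2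
  choose X hX using hX
  obtain ⟨ε, hε, hε0⟩ : ∃ ε : ℝ, (∀ s i, 0 < eval (X s) (f i) → ε < eval (X s) (f i)) ∧ 0 < ε := by
    have h1 : ∀ᶠ ε : ℝ in nhdsWithin 0 (Set.Ioi 0),
        ∀ s i, 0 < eval (X s) (f i) → ε < eval (X s) (f i) := by
      simp only [Filter.eventually_all]
      intro s i h
      exact nhdsWithin_le_nhds (Iio_mem_nhds h)
    exact (h1.and self_mem_nhdsWithin).exists
  let g : ι → MvPolynomial (Fin N) ℝ := fun i => f i - C ε
  have hg (i x) : eval x (g i) = eval x (f i) - ε := by simp [g]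
  have hgX (s i) : eval (X s) (g i) ≠ 0 := by
    rw [hg]
    by_cases h : 0 < eval (X s) (f i)
    · exact (sub_pos.2 (hε s i h)).ne'
    · exact (by linarith : eval (X s) (f i) - ε < 0).ne
  have hsign (s i) : 0 < eval (X s) (g i) ↔ 0 < eval (X s) (f i) := by
    rw [hg]
    exact ⟨fun h => by linarith, fun h => sub_pos.2 (hε s i h)⟩
  let R : ℝ := ∑ s, ∑ j, X s j ^ 2 + 1
  have hR (s) : ∑ j, X s j ^ 2 < R := by
    have : ∑ j, X s j ^ 2 ≤ ∑ s, ∑ j, X s j ^ 2 :=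
      Finset.single_le_sum (f := fun s => ∑ j, X s j ^ 2)
        (fun s _ => Finset.sum_nonneg fun j _ => sq_nonneg _) (Finset.mem_univ s)
    simp only [R]
    linarith
  let b : MvPolynomial (Fin N) ℝ := C R - ∑ j, MvPolynomial.X j ^ 2
  have hb (x) : eval x b = R - ∑ j, x j ^ 2 := by simp [b]
  let F : MvPolynomial (Fin N) ℝ := b * ∏ i, g i
  have hFe (x) : eval x F = (R - ∑ j, x j ^ 2) * ∏ i, eval x (g i) := by
    simp only [F, map_mul, hb, map_prod]
  have hFdeg : F.totalDegree ≤ 2 + Fintype.card ι * d := by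
    refine (totalDegree_mul _ _).trans (Nat.add_le_add ?_ ?_)
    · refine (totalDegree_sub _ _).trans (max_le (by rw [totalDegree_C]; omega) ?_)
      refine totalDegree_finsetSum_le fun j _ => ?_
      exact (totalDegree_pow _ _).trans (by rw [totalDegree_X])
    · refine (totalDegree_finsetProd _ _).trans ?_
      refine (Finset.sum_le_card_nsmul _ _ d fun i _ => ?_).trans (by simp)
      exact (totalDegree_sub _ _).trans (max_le (hd i) (by rw [totalDegree_C]; omega))
  let U : Fin (Nat.card S) → Set (Fin N → ℝ) := fun s =>
    {x | ∑ j, x j ^ 2 < R ∧ ∀ i, 0 < eval x (g i) * eval (X s) (g i)}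
  let K : Fin (Nat.card S) → Set (Fin N → ℝ) := fun s =>
    {x | ∑ j, x j ^ 2 ≤ R ∧ ∀ i, 0 ≤ eval x (g i) * eval (X s) (g i)}
  have hsq : Continuous fun x : Fin N → ℝ => ∑ j, x j ^ 2 := by fun_prop
  have hgc (s i) : Continuous fun x : Fin N → ℝ => eval x (g i) * eval (X s) (g i) :=
    (MvPolynomial.continuous_eval _).mul continuous_const
  have hUo (s) : IsOpen (U s) := by
    have h : U s = {x | ∑ j, x j ^ 2 < R} ∩ ⋂ i, {x | 0 < eval x (g i) * eval (X s) (g i)} := by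
      ext; simp [U]
    rw [h]
    refine (isOpen_lt hsq continuous_const).inter ?_
    exact isOpen_iInter_of_finite fun i => isOpen_lt continuous_const (hgc s i)
  have hKc (s) : IsCompact (K s) := by
    refine Metric.isCompact_of_isClosed_isBounded ?_ ?_
    · have h : K s = {x | ∑ j, x j ^ 2 ≤ R} ∩
          ⋂ i, {x | 0 ≤ eval x (g i) * eval (X s) (g i)} := by
        ext; simp [K]
      rw [h]
      refine (isClosed_le hsq continuous_const).inter ?_
      exact isClosed_iInter fun i => isClosed_le continuous_const (hgc s i)
    · refine (Metric.isBounded_closedBall (x := (0 : Fin N → ℝ)) (r := R + 1)).subset fun x hx => ?_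
      rw [mem_closedBall_zero_iff]
      have hR0 : 0 ≤ R := (Finset.sum_nonneg fun j _ => sq_nonneg (x j)).trans hx.1
      refine (pi_norm_le_iff_of_nonneg (by linarith)).2 fun j => ?_
      have h1 : x j ^ 2 ≤ ∑ j, x j ^ 2 :=
        Finset.single_le_sum (f := fun j => x j ^ 2) (fun j _ => sq_nonneg _) (Finset.mem_univ j)
      rw [Real.norm_eq_abs]
      refine abs_le_of_sq_le_sq (by nlinarith [hx.1]) (by linarith)
  have hgrad (s) : ∃ δ : ℝ, 0 < δ ∧ ∀ c : Fin N → ℝ, (∀ j, |c j| < δ) →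
      ∃ x ∈ U s, ∀ j, eval x (pderiv j F) = c j := by
    refine exists_small_gradients F (hUo s) (hKc s) (fun x hx => ⟨hx.1.le, fun i => (hx.2 i).le⟩)
      (fun x hx hxU => ?_) (x₀ := X s) ⟨hR s, fun i => mul_self_pos.2 (hgX s i)⟩ ?_
    · rw [hFe]
      by_cases h : ∑ j, x j ^ 2 = R
      · rw [h, sub_self, zero_mul]
      · have hlt := lt_of_le_of_ne hx.1 h
        obtain ⟨i, hi⟩ : ∃ i, eval x (g i) * eval (X s) (g i) = 0 := by
          by_contra! hcon
          exact hxU ⟨hlt, fun i => lt_of_le_of_ne (hx.2 i) (hcon i).symm⟩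
        rw [Finset.prod_eq_zero (Finset.mem_univ i)
          ((mul_eq_zero.1 hi).resolve_right (hgX s i)), mul_zero]
    · rw [hFe]
      exact mul_ne_zero (sub_pos.2 (hR s)).ne' (Finset.prod_ne_zero_iff.2 fun i _ => hgX s i)
  choose δ hδ hδg using hgrad
  have hdisj (s s') (hss : s ≠ s') : Disjoint (U s) (U s') := by
    rw [Set.disjoint_left]
    intro x hx hx'
    apply hss
    apply e.symm.injective
    apply Subtype.ext
    rw [← hX s, ← hX s']
    funext i
    rw [← hsign, ← hsign, eq_iff_iff]
    have h1 := hx.2 i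
    have h2 := hx'.2 i
    constructor
    · intro h
      exact pos_of_mul_pos_right h2 (pos_of_mul_pos_left h1 h.le).le
    · intro h
      exact pos_of_mul_pos_right h1 (pos_of_mul_pos_left h2 h.le).le
  obtain ⟨δ₀, hδ₀, hδ₀pos⟩ : ∃ δ₀ : ℝ, (∀ s, δ₀ < δ s) ∧ 0 < δ₀ := by
    have h1 : ∀ᶠ t : ℝ in nhdsWithin 0 (Set.Ioi 0), ∀ s, t < δ s := by
      rw [Filter.eventually_all]
      exact fun s => nhdsWithin_le_nhds (Iio_mem_nhds (hδ s))
    exact (h1.and self_mem_nhdsWithin).exists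
  exact card_le_of_small_gradients (by omega) F hFdeg U hdisj hδ₀pos
    fun c hc s => hδg s c fun j => (hc j).trans (hδ₀ s)

section Peeling

variable {V : Type*}

/-- The line `t ↦ c u + a u * t` is above the line of `v` immediately after time `t`. -/
def IsAbove (a c : V → ℝ) (t : ℝ) (u v : V) : Prop :=
  c v + a v * t < c u + a u * t ∨ (c v + a v * t = c u + a u * t ∧ a v < a u)

/-- The list enumerates lines in an order in which they can be removed, at nondecreasing times
starting from `t`, so that each removed line is above all the remaining ones. -/
def Peels (a c : V → ℝ) : ℝ → List V → Prop
  | _, [] => True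
  | t, u :: l => ∃ s, t ≤ s ∧ (∀ v ∈ l, IsAbove a c s u v) ∧ Peels a c s l

/-- The peeling orders of all subfamilies of the given lines. -/
def peelings (a c : V → ℝ) : Set (List V) := {l | ∃ t, Peels a c t l}

theorem IsAbove.irrefl {a c : V → ℝ} {t : ℝ} {u : V} : ¬ IsAbove a c t u u := by
  rintro (h | h)
  · exact lt_irrefl _ h
  · exact lt_irrefl _ h.2

theorem Peels.mono {a c : V → ℝ} {t t' : ℝ} (h : t' ≤ t) {l : List V} (hl : Peels a c t l) :
    Peels a c t' l := by
  cases l with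
  | nil => trivial
  | cons u l =>
    obtain ⟨s, hs, h1, h2⟩ := hl
    exact ⟨s, h.trans hs, h1, h2⟩

theorem Peels.nodup {a c : V → ℝ} {t : ℝ} {l : List V} (hl : Peels a c t l) : l.Nodup := by
  induction l generalizing t with
  | nil => exact List.nodup_nil
  | cons u l ih =>
    obtain ⟨s, -, h1, h2⟩ := hl
    exact List.nodup_cons.2 ⟨fun hu => IsAbove.irrefl (h1 u hu), ih h2⟩

theorem finite_peelings [Fintype V] (a c : V → ℝ) : (peelings a c).Finite := by
  refine (List.finite_length_le V (Fintype.card V)).subset ?_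
  rintro l ⟨t, hl⟩
  exact hl.nodup.length_le_card

theorem exists_top (a c : V → ℝ) (t : ℝ) {D : Finset V} (hD : D.Nonempty) :
    ∃ u ∈ D, ∀ d ∈ D, ¬ IsAbove a c t d u := by
  obtain ⟨u, hu, hmax⟩ := D.exists_max_image (fun u => toLex (c u + a u * t, a u)) hD
  refine ⟨u, hu, fun d hd h => ?_⟩
  have := hmax d hd
  rw [Prod.Lex.toLex_le_toLex] at this
  rcases h with h | ⟨h, h'⟩ <;> rcases this with h1 | ⟨h1, h2⟩ <;> simp only at * <;> linarith

/-- The state of the count: `D` is the set of remaining lines and `E` the set of lines that have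
already been overtaken while being on top; `b = 0` signals that no line of `E` is on top. -/
theorem encard_peels_le (a c : V → ℝ) (k : ℕ) (D E : Finset V) (t : ℝ) (b : ℕ)
    (hE : ∀ f ∈ E, ∀ d ∈ D, a d < a f → c d + a d * t ≤ c f + a f * t)
    (hb : b = 0 → ∀ u ∈ D, (∀ d ∈ D, ¬ IsAbove a c t d u) → u ∉ E)
    (hk : 2 * D.card + (D \ E).card + b ≤ k) :
    {l : List V | l.toFinset = D ∧ Peels a c t l}.encard ≤ 2 ^ k := by
  induction k generalizing D E t b with
  | zero =>
    have hD : D = ∅ := Finset.card_eq_zero.1 (by omega)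
    subst hD
    refine (Set.encard_le_encard (t := {[]}) fun l hl => ?_).trans (by simp)
    simpa using hl.1
  | succ k ih =>
    rcases D.eq_empty_or_nonempty with rfl | hD
    · refine (Set.encard_le_encard (t := {[]}) fun l hl => ?_).trans ?_
      · simpa using hl.1
      · rw [Set.encard_singleton]
        exact one_le_pow₀ (by norm_num)
    obtain ⟨u, hu, htop⟩ := exists_top a c t hD
    have hcard : (D.erase u).card + 1 = D.card := Finset.card_erase_add_one hu
    have hremove : {l : List V | l.toFinset = D.erase u ∧ Peels a c t l}.encard ≤ 2 ^ k := by
      refine ih (D.erase u) E t 1 (fun f hf d hd => hE f hf d (Finset.mem_of_mem_erase hd))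
        (by omega) ?_
      have := Finset.card_le_card (Finset.sdiff_subset_sdiff (Finset.erase_subset u D) subset_rfl :
        D.erase u \ E ⊆ D \ E)
      omega
    have hcross (v : V) (hv : v ∈ D) {s : ℝ} (hs : t ≤ s) (h : IsAbove a c s v u) :
        a u < a v ∧ (c u - c v) / (a v - a u) ≤ s := by
      have h1 := htop v hv
      have h2 : c u + a u * s ≤ c v + a v * s := by
        rcases h with h | h
        · exact h.le
        · exact h.1.le
      have h3 : c v + a v * t ≤ c u + a u * t := not_lt.1 fun h' => h1 (Or.inl h')
      have h4 : a u < a v := by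
        by_contra h4
        rcases h with h | h
        · nlinarith
        · exact h4 h.2
      refine ⟨h4, ?_⟩
      rw [div_le_iff₀ (sub_pos.2 h4)]
      linarith
    have hrest : {l : List V | l.toFinset = D ∧ Peels a c t l ∧ l.head? ≠ some u}.encard
        ≤ 2 ^ k := by
      rcases (D.filter fun d => a u < a d).eq_empty_or_nonempty with h0 | h0
      · refine (Set.encard_le_encard (t := ∅) fun l hl => ?_).trans (by simp)
        obtain ⟨h1, h2, h3⟩ := hl
        cases l with
        | nil => simp [← h1] at hD
        | cons v l =>
          obtain ⟨s, hs, h4, h5⟩ := h2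
          have hvu : v ≠ u := fun h => h3 (by simp [h])
          have hv : v ∈ D := by simp [← h1]
          have hul : u ∈ l := by
            rw [← h1] at hu
            simpa [hvu.symm] using hu
          have : v ∈ D.filter fun d => a u < a d :=
            Finset.mem_filter.2 ⟨hv, (hcross v hv hs (h4 u hul)).1⟩
          simp [h0] at this
      · obtain ⟨w, hw, hmin⟩ := Finset.exists_min_image _
          (fun d => (c u - c d) / (a d - a u)) h0
        obtain ⟨hwD, hwu⟩ := Finset.mem_filter.1 hw
        set t' := (c u - c w) / (a w - a u) with ht'
        have hwt' : c w + a w * t' = c u + a u * t' := by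
          have : a w - a u ≠ 0 := (sub_pos.2 hwu).ne'
          rw [ht']
          field_simp
          ring
        have htt' : t ≤ t' := by
          by_contra hlt
          have h3 : c w + a w * t ≤ c u + a u * t := not_lt.1 fun h' => htop w hwD (Or.inl h')
          nlinarith
        refine (Set.encard_le_encard fun l hl => ?_).trans (ih D (insert u E) t' 0 ?_ ?_ ?_)
        · obtain ⟨h1, h2, h3⟩ := hl
          refine ⟨h1, ?_⟩
          cases l with
          | nil => trivial
          | cons v l =>
            obtain ⟨s, hs, h4, h5⟩ := h2
            have hvu : v ≠ u := fun h => h3 (by simp [h])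
            have hv : v ∈ D := by simp [← h1]
            have hul : u ∈ l := by
              rw [← h1] at hu
              simpa [hvu.symm] using hu
            obtain ⟨h6, h7⟩ := hcross v hv hs (h4 u hul)
            exact ⟨s, (hmin v (Finset.mem_filter.2 ⟨hv, h6⟩)).trans h7, h4, h5⟩
        · intro f hf d hd hdf
          have h1 : c d + a d * t ≤ c f + a f * t := by
            rcases Finset.mem_insert.1 hf with rfl | hf
            · exact not_lt.1 fun h' => htop d hd (Or.inl h')
            · exact hE f hf d hd hdf
          nlinarith
        · intro _ v hv hvtop hvE
          have hvu : v ≠ u := by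
            rintro rfl
            exact hvtop w hwD (Or.inr ⟨hwt'.symm, hwu⟩)
          have hvE' : v ∈ E := Finset.mem_of_mem_insert_of_ne hvE hvu
          have h1 : c v + a v * t ≤ c u + a u * t := not_lt.1 fun h' => htop v hv (Or.inl h')
          have h2 : c w + a w * t' ≤ c v + a v * t' := not_lt.1 fun h' => hvtop w hwD (Or.inl h')
          have huv : a u < a v := by
            by_contra huv
            have h3 : c v + a v * t' = c u + a u * t' := by nlinarith
            exact hvtop w hwD (Or.inr ⟨by linarith, by linarith⟩)
          have h3 := hE v hvE' u hu huv
          exact htop v hv (Or.inr ⟨by linarith, huv⟩)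
        · by_cases huE : u ∈ E
          · have : b ≠ 0 := fun h => hb h u hu htop huE
            rw [Finset.insert_eq_of_mem huE]
            omega
          · have h1 : D \ insert u E ⊂ D \ E := by
              refine Finset.ssubset_iff_subset_ne.2
                ⟨Finset.sdiff_subset_sdiff subset_rfl (Finset.subset_insert u E), fun h => ?_⟩
              have : u ∈ D \ insert u E := h ▸ Finset.mem_sdiff.2 ⟨hu, huE⟩
              simp at this
            have := Finset.card_lt_card h1
            omega
    have hsub : {l : List V | l.toFinset = D ∧ Peels a c t l} ⊆
        (List.cons u '' {l : List V | l.toFinset = D.erase u ∧ Peels a c t l}) ∪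
          {l : List V | l.toFinset = D ∧ Peels a c t l ∧ l.head? ≠ some u} := by
      rintro l ⟨h1, h2⟩
      by_cases h : l.head? = some u
      · left
        obtain ⟨l', rfl⟩ := List.head?_eq_some_iff.1 h
        have hnd := List.nodup_cons.1 h2.nodup
        obtain ⟨s, hs, h3, h4⟩ := h2
        refine ⟨l', ⟨?_, h4.mono hs⟩, rfl⟩
        rw [← h1, List.toFinset_cons, Finset.erase_insert (by simpa using hnd.1)]
      · exact Or.inr ⟨h1, h2, h⟩
    calc _ ≤ _ := Set.encard_le_encard hsub
      _ ≤ _ := Set.encard_union_le _ _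
      _ ≤ 2 ^ k + 2 ^ k := by
        refine add_le_add ?_ hrest
        rw [(List.cons_injective).encard_image]
        exact hremove
      _ = 2 ^ (k + 1) := by rw [pow_succ, mul_two]

/-- Lines have at most exponentially many peeling orders. -/
theorem ncard_peelings_le [Fintype V] (a c : V → ℝ) :
    (peelings a c).ncard ≤ 2 ^ (4 * Fintype.card V + 1) := by
  obtain ⟨t, ht⟩ : ∃ t, ∀ l ∈ peelings a c, Peels a c t l := by
    have h : ∀ l : List V, ∃ t, l ∈ peelings a c → Peels a c t l := fun l => by
      by_cases hl : l ∈ peelings a c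
      · exact hl.imp fun t ht _ => ht
      · exact ⟨0, fun h => absurd h hl⟩
    choose τ hτ using h
    obtain ⟨t, ht⟩ := ((finite_peelings a c).image τ).bddBelow
    exact ⟨t, fun l hl => (hτ l hl).mono (ht ⟨l, hl, rfl⟩)⟩
  have hfib (D : Finset V) : ((finite_peelings a c).toFinset.filter fun l => l.toFinset = D).card ≤
      2 ^ (3 * Fintype.card V + 1) := by
    have h1 := encard_peels_le a c (3 * Fintype.card V + 1) D ∅ t 1 (by simp) (by simp) (by
      have := Finset.card_le_univ D
      simp only [Finset.sdiff_empty]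
      omega)
    have h2 : (((finite_peelings a c).toFinset.filter fun l => l.toFinset = D : Finset (List V)) :
        Set (List V)).encard ≤ 2 ^ (3 * Fintype.card V + 1) := by
      refine (Set.encard_le_encard fun l hl => ?_).trans h1
      simp only [Finset.coe_filter, Set.Finite.mem_toFinset, Set.mem_ofPred_eq] at hl
      exact ⟨hl.2, ht l hl.1⟩
    rw [Set.encard_coe_eq_coe_finsetCard] at h2
    exact_mod_cast h2
  rw [Set.ncard_eq_toFinset_card _ (finite_peelings a c)]
  refine (Finset.card_le_mul_card_image_of_maps_to (t := Finset.univ) (f := List.toFinset)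
    (fun _ _ => Finset.mem_univ _) _ fun D _ => hfib D).trans ?_
  rw [Finset.card_univ, Fintype.card_finset, ← pow_add]
  exact Nat.pow_le_pow_right (by norm_num) (by omega)


/-- Two families of lines have the same orders of slopes, of intercepts, and of crossings. -/
structure SameType (a c a' c' : V → ℝ) : Prop where
  slope : ∀ u v, a u < a v ↔ a' u < a' v
  intercept : ∀ u v, c u < c v ↔ c' u < c' v
  crossing : ∀ u v w z, (c u - c v) * (a z - a w) < (c w - c z) * (a v - a u) ↔
    (c' u - c' v) * (a' z - a' w) < (c' w - c' z) * (a' v - a' u)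

namespace SameType

variable {a c a' c' : V → ℝ}

theorem symm (h : SameType a c a' c') : SameType a' c' a c :=
  ⟨fun u v => (h.slope u v).symm, fun u v => (h.intercept u v).symm,
    fun u v w z => (h.crossing u v w z).symm⟩

theorem neg_left (h : SameType a c a' c') : SameType (-a) c (-a') c' := by
  refine ⟨fun u v => ?_, h.intercept, fun u v w z => ?_⟩
  · simpa using h.slope v u
  · have := h.crossing w z u v
    simp only [Pi.neg_apply]
    convert this using 1 <;> constructor <;> intro h <;> linarith

theorem neg_right (h : SameType a c a' c') : SameType a (-c) a' (-c') := by
  refine ⟨h.slope, fun u v => ?_, fun u v w z => ?_⟩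
  · simpa using h.intercept v u
  · have := h.crossing w z u v
    simp only [Pi.neg_apply]
    convert this using 1 <;> constructor <;> intro h <;> linarith

/-- The same pairs of lines have crossed by time `t`, respectively `t'`. -/
def SameTime (a c a' c' : V → ℝ) (t t' : ℝ) : Prop :=
  ∀ u v, a u < a v → (c u - c v ≤ t * (a v - a u) ↔ c' u - c' v ≤ t' * (a' v - a' u))

theorem exists_sameTime [Finite V] (h : SameType a c a' c') (t : ℝ) :
    ∃ t', SameTime a c a' c' t t' := by
  let S : Set (V × V) := {p | a p.1 < a p.2 ∧ c p.1 - c p.2 ≤ t * (a p.2 - a p.1)}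
  rcases S.eq_empty_or_nonempty with hS | hS
  · obtain ⟨t', ht'⟩ := (Set.finite_range fun p : V × V =>
      (c' p.1 - c' p.2) / (a' p.2 - a' p.1)).bddBelow
    refine ⟨t' - 1, fun u v huv => ?_⟩
    have h1 : ¬ (c u - c v ≤ t * (a v - a u)) := fun h1 =>
      (Set.eq_empty_iff_forall_notMem.1 hS (u, v)) ⟨huv, h1⟩
    have h2 := ht' ⟨(u, v), rfl⟩
    have h3 := sub_pos.2 ((h.slope u v).1 huv)
    rw [← div_le_iff₀ h3]
    simp only [h1, false_iff, not_le]
    simp only at h2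
    linarith
  · obtain ⟨⟨u, v⟩, ⟨huv, ht⟩, hmax⟩ := Set.exists_max_image S
      (fun p => (c p.1 - c p.2) / (a p.2 - a p.1)) S.toFinite hS
    simp only at huv ht
    have h1 := sub_pos.2 huv
    have h1' := sub_pos.2 ((h.slope u v).1 huv)
    refine ⟨(c' u - c' v) / (a' v - a' u), fun w z hwz => ?_⟩
    have h2 := sub_pos.2 hwz
    have h2' := sub_pos.2 ((h.slope w z).1 hwz)
    have h3 : c w - c z ≤ t * (a z - a w) ↔
        (c w - c z) / (a z - a w) ≤ (c u - c v) / (a v - a u) := by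
      refine ⟨fun h3 => hmax (w, z) ⟨hwz, h3⟩, fun h3 => ?_⟩
      rw [← div_le_iff₀ h2]
      exact h3.trans ((div_le_iff₀ h1).2 ht)
    rw [h3, ← div_le_iff₀ h2', div_le_div_iff₀ h2 h1, div_le_div_iff₀ h2' h1', ← not_lt,
      h.crossing, not_lt]

theorem isAbove_iff (h : SameType a c a' c') {t t' : ℝ} (ht : SameTime a c a' c' t t') (u v : V) :
    IsAbove a c t u v ↔ IsAbove a' c' t' u v := by
  have key (a c : V → ℝ) (t : ℝ) (u v : V) : IsAbove a c t u v ↔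
      (a v < a u ∧ c v - c u ≤ t * (a u - a v)) ∨
      (a u < a v ∧ ¬ (c u - c v ≤ t * (a v - a u))) ∨
      (¬ a v < a u ∧ ¬ a u < a v ∧ c v < c u) := by
    unfold IsAbove
    rcases lt_trichotomy (a u) (a v) with h | h | h
    · simp only [h, not_lt_of_gt h, false_and, and_false, or_false, false_or, true_and, not_true,
        not_le]
      constructor <;> intro h <;> linarith
    · simp [h]
    · simp only [h, not_lt_of_gt h, false_and, or_false, true_and, not_true, and_true]
      rw [← le_iff_lt_or_eq]
      constructor <;> intro h <;> linarith
  rw [key, key, h.slope, h.slope, h.intercept]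
  have h1 := ht u v
  have h2 := ht v u
  rw [h.slope] at h1 h2
  tauto

theorem peels (h : SameType a c a' c') [Finite V] {l : List V} {t t' : ℝ}
    (ht : SameTime a c a' c' t t') (hl : Peels a c t l) : Peels a' c' t' l := by
  induction l generalizing t t' with
  | nil => trivial
  | cons u l ih =>
    obtain ⟨s, hs, h1, h2⟩ := hl
    obtain ⟨s', hs'⟩ := h.exists_sameTime s
    have h3 : SameTime a c a' c' s (max t' s') := by
      intro v w hvw
      have h4 := sub_pos.2 hvw
      have h4' := sub_pos.2 ((h.slope v w).1 hvw)
      rw [hs' v w hvw]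
      refine ⟨fun h5 => h5.trans (mul_le_mul_of_nonneg_right (le_max_right _ _) h4'.le),
        fun h5 => ?_⟩
      rcases max_choice t' s' with h6 | h6
      · rw [h6, ← ht v w hvw] at h5
        exact (hs' v w hvw).1 (h5.trans (mul_le_mul_of_nonneg_right hs h4.le))
      · rwa [h6] at h5
    exact ⟨max t' s', le_max_left _ _, fun v hv => (h.isAbove_iff h3 u v).1 (h1 v hv), ih h3 h2⟩

theorem peelings_eq (h : SameType a c a' c') [Finite V] : peelings a c = peelings a' c' := by
  have key {a c a' c' : V → ℝ} (h : SameType a c a' c') : peelings a c ⊆ peelings a' c' := by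
    rintro l ⟨t, hl⟩
    obtain ⟨t', ht'⟩ := h.exists_sameTime t
    exact ⟨t', h.peels ht' hl⟩
  exact (key h).antisymm (key h.symm)

end SameType

theorem card_orderHom_fin_le (m k : ℕ) : Nat.card (Fin m →o Fin k) ≤ 2 ^ (m + k) := by
  let f (e : Fin m →o Fin k) (i : Fin m) : Fin (m + k) := ⟨i + e i, by omega⟩
  have hf (e) : StrictMono (f e) := fun i j hij => by
    have := e.monotone hij.le
    simp only [f, Fin.lt_def, Fin.le_def] at *
    omega
  have hinj : Function.Injective fun e => Set.range (f e) := fun e e' h => by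
    have h1 := ((hf e).range_inj (hf e')).1 h
    ext i
    have := congrFun h1 i
    simp only [f, Fin.mk.injEq] at this
    omega
  refine (Nat.card_le_card_of_injective _ hinj).trans ?_
  simp

/-- The relation encoded by two lists and a merging pattern of them. -/
def mergeRel {k : ℕ} (p : (List V × List V) × (Fin k →o Fin k)) (u v : V) : Prop :=
  u ∈ p.1.1 ∧ v ∈ p.1.1 ∧
    (∀ i : Fin k, i.1 = p.1.1.idxOf u → p.2 i + p.1.2.idxOf v < p.1.2.length) ∧
    (∀ i : Fin k, i.1 = p.1.1.idxOf v → p.2 i + p.1.2.idxOf u < p.1.2.length)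

/-- The relations that arise from two peeling orders, one in each direction of time. -/
def peelingRels [Fintype V] (a c : V → ℝ) : Set (V → V → Prop) :=
  mergeRel '' ((peelings a c ×ˢ peelings (-a) c) ×ˢ
    (Set.univ : Set (Fin (Fintype.card V + 1) →o Fin (Fintype.card V + 1))))

theorem SameType.peelingRels_eq [Fintype V] {a c a' c' : V → ℝ} (h : SameType a c a' c') :
    peelingRels a c = peelingRels a' c' := by
  rw [peelingRels, peelingRels, h.peelings_eq, h.neg_left.peelings_eq]

theorem ncard_peelingRels_le [Fintype V] (a c : V → ℝ) :
    (peelingRels a c).ncard ≤ 2 ^ (10 * Fintype.card V + 4) := by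
  have : Finite (Fin (Fintype.card V + 1) →o Fin (Fintype.card V + 1)) :=
    Finite.of_injective _ DFunLike.coe_injective
  refine (Set.ncard_image_le (((finite_peelings _ _).prod (finite_peelings _ _)).prod
    Set.finite_univ)).trans ?_
  rw [Set.ncard_prod, Set.ncard_prod, Set.ncard_univ]
  refine (Nat.mul_le_mul (Nat.mul_le_mul (ncard_peelings_le a c) (ncard_peelings_le (-a) c))
    (card_orderHom_fin_le _ _)).trans ?_
  rw [← pow_add, ← pow_add]
  exact Nat.pow_le_pow_right (by norm_num) (by omega)

theorem idxOf_lt_countP {l : List V} (hl : l.Nodup) {p : V → Prop} [DecidablePred p]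
    (hp : l.Pairwise fun x y => p y → p x) {v : V} (hv : v ∈ l) :
    l.idxOf v < l.countP (fun x => decide (p x)) ↔ p v := by
  induction l with
  | nil => simp at hv
  | cons x l ih =>
    rw [List.nodup_cons] at hl
    rw [List.pairwise_cons] at hp
    rw [List.countP_cons]
    by_cases hx : p x
    · by_cases hvx : v = x
      · subst hvx
        simp [hx]
      · have hvl : v ∈ l := by simpa [hvx] using hv
        rw [List.idxOf_cons_ne _ (Ne.symm hvx)]
        simp [hx, ih hl.2 hp.2 hvl]
    · have h0 : l.countP (fun x => decide (p x)) = 0 := by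
        rw [List.countP_eq_zero]
        intro y hy
        simpa using fun h => hx (hp.1 y hy h)
      simp only [h0, hx, decide_false]
      simp only [Bool.false_eq_true, if_false, add_zero, Nat.not_lt_zero, false_iff]
      rcases List.mem_cons.1 hv with rfl | hv
      · exact hx
      · exact fun h => hx (hp.1 v hv h)

/-- Lines whose removal times are compatible with the family can be peeled in that order. -/
theorem exists_peels {a c : V → ℝ} (hinj : Function.Injective fun u => (a u, c u)) (key : V → ℝ)
    (D : Finset V) (hkey : ∀ u ∈ D, ∀ v ∈ D, key u < key v → IsAbove a c (key u) u v) (t : ℝ)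
    (ht : ∀ u ∈ D, t ≤ key u) :
    ∃ l : List V, (∀ v, v ∈ l ↔ v ∈ D) ∧ Peels a c t l ∧
      l.Pairwise fun u v => key u ≤ key v := by
  induction hn : D.card generalizing D t with
  | zero =>
    obtain rfl := Finset.card_eq_zero.1 hn
    exact ⟨[], by simp, trivial, List.Pairwise.nil⟩
  | succ k ih =>
    have hD : D.Nonempty := Finset.card_pos.1 (by omega)
    obtain ⟨m, hm, hmin⟩ := D.exists_min_image key hD
    obtain ⟨u, hu, htop⟩ := exists_top a c (key m) (D := D.filter fun v => key v ≤ key m)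
      ⟨m, by simp [hm]⟩
    obtain ⟨huD, hum⟩ := Finset.mem_filter.1 hu
    have humk : key u = key m := le_antisymm hum (hmin u huD)
    obtain ⟨l, h1, h2, h3⟩ := ih (D.erase u)
      (fun v hv w hw => hkey v (Finset.mem_of_mem_erase hv) w (Finset.mem_of_mem_erase hw)) (key u)
      (fun v hv => humk ▸ hmin v (Finset.mem_of_mem_erase hv))
      (by rw [Finset.card_erase_of_mem huD]; omega)
    refine ⟨u :: l, fun v => ?_, ⟨key u, ht u huD, fun v hv => ?_, h2⟩, ?_⟩
    · rw [List.mem_cons, h1, Finset.mem_erase]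
      by_cases hvu : v = u <;> simp [hvu, huD]
    · obtain ⟨hvu, hvD⟩ := Finset.mem_erase.1 ((h1 v).1 hv)
      rcases (hmin v hvD).lt_or_eq with hlt | heq
      · exact hkey u huD v hvD (humk ▸ hlt)
      · have h4 := htop v (Finset.mem_filter.2 ⟨hvD, heq.ge⟩)
        rw [humk]
        unfold IsAbove at h4 ⊢
        push Not at h4
        rcases h4.1.lt_or_eq with h5 | h5
        · exact Or.inl h5
        · refine Or.inr ⟨h5, lt_of_le_of_ne (h4.2 h5.symm) fun h6 => hvu (hinj ?_)⟩
          simp only [h6] at h5 ⊢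
          simpa using h5
    · refine List.pairwise_cons.2 ⟨fun v hv => ?_, h3⟩
      exact humk ▸ hmin v (Finset.mem_of_mem_erase ((h1 v).1 hv))

/-- Among a finite family of lines, the relation of being simultaneously above the upper envelope
of another finite family is determined by peeling orders. -/
theorem overlap_mem_peelingRels [Fintype V] {a c : V → ℝ}
    (hinj : Function.Injective fun u => (a u, c u)) (F : Finset (ℝ × ℝ)) :
    (fun u v => ∃ t, (∀ q ∈ F, q.2 + q.1 * t < c u + a u * t) ∧
      ∀ q ∈ F, q.2 + q.1 * t < c v + a v * t) ∈ peelingRels a c := by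
  let I (u : V) : Set ℝ := {t | ∀ q ∈ F, q.2 + q.1 * t < c u + a u * t}
  have hI (u : V) {x y z : ℝ} (hx : x ∈ I u) (hz : z ∈ I u) (hxy : x ≤ y) (hyz : y ≤ z) :
      y ∈ I u := fun q hq => by
    have h1 := hx q hq
    have h2 := hz q hq
    rcases le_total q.1 (a u) with h | h <;> nlinarith
  have habove {u v : V} {t : ℝ} (hu : t ∈ I u) (hv : t ∉ I v) : c v + a v * t < c u + a u * t := by
    have : ∃ q ∈ F, c v + a v * t ≤ q.2 + q.1 * t := by
      by_contra! h
      exact hv h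
    obtain ⟨q, hq, h⟩ := this
    exact h.trans_lt (hu q hq)
  have hτ : ∀ p : V × V, ∃ t, (I p.1 ∩ I p.2).Nonempty → t ∈ I p.1 ∩ I p.2 := fun p => by
    by_cases h : (I p.1 ∩ I p.2).Nonempty
    · exact h.imp fun t ht _ => ht
    · exact ⟨0, fun h' => absurd h' h⟩
  choose τ hτ using hτ
  let M : Finset ℝ := Finset.univ.image τ
  let D : Finset V := Finset.univ.filter fun u => (I u).Nonempty
  have hM (u : V) (hu : u ∈ D) : (M.filter fun t => t ∈ I u).Nonempty := by
    have hu : (I u).Nonempty := by simpa [D] using hu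
    exact ⟨τ (u, u), Finset.mem_filter.2 ⟨Finset.mem_image_of_mem _ (Finset.mem_univ _),
      (hτ (u, u) (by simpa using hu)).1⟩⟩
  have hL : ∀ u, ∃ x, u ∈ D → x ∈ M ∧ x ∈ I u ∧ ∀ y ∈ M, y ∈ I u → x ≤ y := fun u => by
    by_cases hu : u ∈ D
    · obtain ⟨x, hx, hmin⟩ := Finset.exists_min_image _ id (hM u hu)
      obtain ⟨h1, h2⟩ := Finset.mem_filter.1 hx
      exact ⟨x, fun _ => ⟨h1, h2, fun y hy hy' => hmin y (Finset.mem_filter.2 ⟨hy, hy'⟩)⟩⟩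
    · exact ⟨0, fun h => absurd h hu⟩
  have hR : ∀ u, ∃ x, u ∈ D → x ∈ M ∧ x ∈ I u ∧ ∀ y ∈ M, y ∈ I u → y ≤ x := fun u => by
    by_cases hu : u ∈ D
    · obtain ⟨x, hx, hmax⟩ := Finset.exists_max_image _ id (hM u hu)
      obtain ⟨h1, h2⟩ := Finset.mem_filter.1 hx
      exact ⟨x, fun _ => ⟨h1, h2, fun y hy hy' => hmax y (Finset.mem_filter.2 ⟨hy, hy'⟩)⟩⟩
    · exact ⟨0, fun h => absurd h hu⟩
  choose L hL using hL
  choose R hR using hR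
  have hO (u v : V) : (I u ∩ I v).Nonempty ↔ u ∈ D ∧ v ∈ D ∧ L u ≤ R v ∧ L v ≤ R u := by
    constructor
    · intro h
      have hu : u ∈ D := Finset.mem_filter.2 ⟨Finset.mem_univ _, h.mono Set.inter_subset_left⟩
      have hv : v ∈ D := Finset.mem_filter.2 ⟨Finset.mem_univ _, h.mono Set.inter_subset_right⟩
      have h1 : τ (u, v) ∈ M := Finset.mem_image_of_mem _ (Finset.mem_univ _)
      have h2 := hτ (u, v) h
      exact ⟨hu, hv, ((hL u hu).2.2 _ h1 h2.1).trans ((hR v hv).2.2 _ h1 h2.2),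
        ((hL v hv).2.2 _ h1 h2.2).trans ((hR u hu).2.2 _ h1 h2.1)⟩
    · rintro ⟨hu, hv, h1, h2⟩
      have hLR (w : V) (hw : w ∈ D) : L w ≤ R w := (hL w hw).2.2 _ (hR w hw).1 (hR w hw).2.1
      exact ⟨max (L u) (L v), hI u (hL u hu).2.1 (hR u hu).2.1 (le_max_left _ _)
        (max_le (hLR u hu) h2), hI v (hL v hv).2.1 (hR v hv).2.1 (le_max_right _ _)
        (max_le h1 (hLR v hv))⟩
  obtain ⟨t₁, ht₁⟩ := (Set.finite_range L).bddBelow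
  obtain ⟨l₁, hl₁, hp₁, hs₁⟩ := exists_peels hinj L D (fun u hu v hv huv =>
    Or.inl (habove (hL u hu).2.1 fun h => huv.not_ge ((hL v hv).2.2 _ (hL u hu).1 h))) t₁
    (fun u _ => ht₁ ⟨u, rfl⟩)
  have hinj' : Function.Injective fun u => ((-a) u, c u) := fun u v h => hinj (by simpa using h)
  obtain ⟨t₂, ht₂⟩ := (Set.finite_range (-R)).bddBelow
  obtain ⟨l₂, hl₂, hp₂, hs₂⟩ := exists_peels hinj' (-R) D (fun u hu v hv huv => Or.inl (by
    have h1 : R v < R u := by simpa using huv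
    simpa using habove (hR u hu).2.1 fun h => h1.not_ge ((hR v hv).2.2 _ (hR u hu).1 h))) t₂
    (fun u _ => ht₂ ⟨u, rfl⟩)
  let p (i : ℕ) (v : V) : Prop := ∃ w ∈ l₁, l₁.idxOf w ≤ i ∧ R v < L w
  let e : Fin (Fintype.card V + 1) →o Fin (Fintype.card V + 1) :=
    { toFun := fun i => ⟨l₂.countP (fun v => decide (p i v)),
        Nat.lt_succ_of_le (List.countP_le_length.trans hp₂.nodup.length_le_card)⟩
      monotone' := fun i j hij => by
        refine List.countP_mono_left fun v _ h => ?_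
        simp only [decide_eq_true_eq] at h ⊢
        obtain ⟨w, hw, h1, h2⟩ := h
        exact ⟨w, hw, h1.trans hij, h2⟩ }
  have hsort {w u : V} (hw : w ∈ l₁) (hu : u ∈ l₁) (h : l₁.idxOf w ≤ l₁.idxOf u) : L w ≤ L u := by
    rcases h.lt_or_eq with h | h
    · have := List.pairwise_iff_getElem.1 hs₁ _ _ (List.idxOf_lt_length_of_mem hw)
        (List.idxOf_lt_length_of_mem hu) h
      simpa using this
    · rw [(List.idxOf_inj hw).1 h]
  have hP (u v : V) (hu : u ∈ l₁) (hv : v ∈ l₂) : (∀ i : Fin (Fintype.card V + 1),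
      i.1 = l₁.idxOf u → e i + l₂.idxOf v < l₂.length) ↔ L u ≤ R v := by
    have h1 (i : Fin (Fintype.card V + 1)) :
        e i + l₂.idxOf v < l₂.length ↔ ¬ p i v := by
      rw [← idxOf_lt_countP (p := fun v => ¬ p i v) hp₂.nodup _ hv]
      · have h2 : l₂.length = l₂.countP (fun v => decide (p i v)) +
            l₂.countP (fun v => decide (¬ p i v)) := by
          rw [List.length_eq_countP_add_countP (fun v => decide (p i v))]
          simp only [decide_eq_true_eq]
        have h3 : (e i : ℕ) = l₂.countP (fun v => decide (p i v)) := rfl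
        omega
      · refine hs₂.imp fun {x y} hxy hy hx => hy ?_
        obtain ⟨w, hw, h2, h3⟩ := hx
        have hxy : R y ≤ R x := by simpa using hxy
        exact ⟨w, hw, h2, hxy.trans_lt h3⟩
    have h2 : ¬ p (l₁.idxOf u) v ↔ L u ≤ R v := by
      constructor
      · intro h
        by_contra! h'
        exact h ⟨u, hu, le_rfl, h'⟩
      · rintro h ⟨w, hw, h3, h4⟩
        exact absurd ((hsort hw hu h3).trans h) h4.not_ge
    constructor
    · intro h
      have hlt : l₁.idxOf u < Fintype.card V + 1 := Nat.lt_succ_of_lt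
        ((List.idxOf_lt_length_of_mem hu).trans_le hp₁.nodup.length_le_card)
      exact h2.1 ((h1 ⟨_, hlt⟩).1 (h ⟨_, hlt⟩ rfl))
    · intro h i hi
      rw [h1, hi, h2]
      exact h
  refine ⟨((l₁, l₂), e), ⟨⟨⟨t₁, hp₁⟩, ⟨t₂, hp₂⟩⟩, Set.mem_univ _⟩, ?_⟩
  funext u v
  refine propext (Iff.trans ?_ (hO u v).symm)
  unfold mergeRel
  simp only [hl₁]
  refine and_congr_right fun hu => and_congr_right fun hv => ?_
  rw [hP u v ((hl₁ u).2 hu) ((hl₂ v).2 hv), hP v u ((hl₁ v).2 hv) ((hl₂ u).2 hu)]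

end Peeling

section Separation

open Filter Topology

theorem disjoint_segment_convexHull_of_lt (g : ℝ × ℝ →ₗ[ℝ] ℝ) {p q : ℝ × ℝ} {S : Set (ℝ × ℝ)}
    (hp : ∀ x ∈ S, g x < g p) (hq : ∀ x ∈ S, g x < g q) :
    Disjoint (segment ℝ p q) (convexHull ℝ S) := by
  have h1 : convexHull ℝ S ⊆ {x | g x < min (g p) (g q)} :=
    convexHull_min (fun x hx => lt_min (hp x hx) (hq x hx)) (convex_halfSpace_lt g.isLinear _)
  have h2 : segment ℝ p q ⊆ {x | min (g p) (g q) ≤ g x} :=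
    (convex_halfSpace_ge g.isLinear _).segment_subset (min_le_left (g p) (g q))
      (min_le_right (g p) (g q))
  exact Set.disjoint_left.2 fun x hx hxS =>
    not_lt.2 (show min (g p) (g q) ≤ g x from h2 hx) (h1 hxS)

/-- A segment misses a convex polygon exactly when some non-vertical direction separates them. -/
theorem disjoint_segment_convexHull_iff (p q : ℝ × ℝ) (F : Finset (ℝ × ℝ)) :
    Disjoint (segment ℝ p q) (convexHull ℝ (F : Set (ℝ × ℝ))) ↔
      (∃ t : ℝ, (∀ x ∈ F, x.2 - x.1 * t < p.2 - p.1 * t) ∧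
        ∀ x ∈ F, x.2 - x.1 * t < q.2 - q.1 * t) ∨
      (∃ t : ℝ, (∀ x ∈ F, p.2 - p.1 * t < x.2 - x.1 * t) ∧
        ∀ x ∈ F, q.2 - q.1 * t < x.2 - x.1 * t) := by
  constructor
  · intro h
    obtain ⟨f, u, v, hu, huv, hv⟩ := geometric_hahn_banach_compact_closed (convex_segment p q)
      (by rw [← convexHull_pair]; exact (Set.toFinite _).isCompact_convexHull ℝ)
      (convex_convexHull ℝ (F : Set (ℝ × ℝ))) (F.finite_toSet.isCompact_convexHull ℝ).isClosed h
    have hf (x : ℝ × ℝ) : f x = f (1, 0) * x.1 + f (0, 1) * x.2 := by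
      have : x = x.1 • ((1 : ℝ), (0 : ℝ)) + x.2 • ((0 : ℝ), (1 : ℝ)) := by ext <;> simp
      conv_lhs => rw [this, map_add, map_smul, map_smul]
      simp [mul_comm]
    have hlt : ∀ y ∈ ({p, q} : Set (ℝ × ℝ)), ∀ x ∈ F, f y < f x := fun y hy x hx => by
      refine (hu y ?_).trans (huv.trans (hv x (subset_convexHull ℝ _ hx)))
      rcases hy with rfl | rfl
      · exact left_mem_segment ℝ _ _
      · exact right_mem_segment ℝ _ _
    obtain ⟨β, hβ, hsep⟩ : ∃ β : ℝ, β ≠ 0 ∧ ∀ y ∈ ({p, q} : Set (ℝ × ℝ)), ∀ x ∈ F,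
        f (1, 0) * y.1 + β * y.2 < f (1, 0) * x.1 + β * x.2 := by
      have hev : ∀ᶠ β in 𝓝 (f (0, 1)), ∀ y ∈ ({p, q} : Set (ℝ × ℝ)), ∀ x ∈ F,
          f (1, 0) * y.1 + β * y.2 < f (1, 0) * x.1 + β * x.2 := by
        rw [(Set.toFinite ({p, q} : Set (ℝ × ℝ))).eventually_all]
        intro y hy
        rw [F.eventually_all]
        intro x hx
        refine Tendsto.eventually_lt (f := fun β => f (1, 0) * y.1 + β * y.2)
          (g := fun β => f (1, 0) * x.1 + β * x.2)
          (Continuous.tendsto (by fun_prop) _) (Continuous.tendsto (by fun_prop) _) ?_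
        rw [← hf, ← hf]
        exact hlt y hy x hx
      rcases ne_or_eq (f (0, 1)) 0 with h0 | h0
      · exact ⟨_, h0, hev.self_of_nhds⟩
      · rw [h0] at hev
        obtain ⟨β, h1, h2⟩ := ((eventually_nhdsWithin_of_eventually_nhds (s := {0}ᶜ) hev).and
          self_mem_nhdsWithin).exists
        exact ⟨β, h2, h1⟩
    have hscale (y : ℝ × ℝ) : f (1, 0) * y.1 + β * y.2 = β * (y.2 - y.1 * (-f (1, 0) / β)) := by
      field_simp
      ring
    simp only [hscale] at hsep
    rcases hβ.lt_or_gt with hneg | hpos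
    · left
      exact ⟨_, fun x hx => (mul_lt_mul_left_of_neg hneg).1 (hsep p (by simp) x hx),
        fun x hx => (mul_lt_mul_left_of_neg hneg).1 (hsep q (by simp) x hx)⟩
    · right
      exact ⟨_, fun x hx => (mul_lt_mul_iff_right₀ hpos).1 (hsep p (by simp) x hx),
        fun x hx => (mul_lt_mul_iff_right₀ hpos).1 (hsep q (by simp) x hx)⟩
  · rintro (⟨t, hp, hq⟩ | ⟨t, hp, hq⟩)
    · refine disjoint_segment_convexHull_of_lt
        (LinearMap.snd ℝ ℝ ℝ - t • LinearMap.fst ℝ ℝ ℝ) (fun x hx => ?_) fun x hx => ?_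
      · simpa [mul_comm t] using hp x hx
      · simpa [mul_comm t] using hq x hx
    · refine disjoint_segment_convexHull_of_lt
        (-(LinearMap.snd ℝ ℝ ℝ - t • LinearMap.fst ℝ ℝ ℝ)) (fun x hx => ?_) fun x hx => ?_
      · have := hp x hx
        simp
        linarith
      · have := hq x hx
        simp
        linarith

end Separation

section Visibility

variable {V : Type*} [Fintype V]

/-- The visibility relations that a single convex polygon can induce on the points
`(-a u, c u)`. -/
def visibilityRels (a c : V → ℝ) : Set (V → V → Prop) :=
  (fun p : (V → V → Prop) × (V → V → Prop) => p.1 ⊔ p.2) ''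
    (peelingRels a c ×ˢ peelingRels (-a) (-c))

theorem SameType.visibilityRels_eq {a c a' c' : V → ℝ} (h : SameType a c a' c') :
    visibilityRels a c = visibilityRels a' c' := by
  rw [visibilityRels, visibilityRels, h.peelingRels_eq, h.neg_left.neg_right.peelingRels_eq]

theorem ncard_visibilityRels_le (a c : V → ℝ) :
    (visibilityRels a c).ncard ≤ 2 ^ (20 * Fintype.card V + 8) := by
  refine (Set.ncard_image_le (Set.toFinite _)).trans ?_
  rw [Set.ncard_prod]
  refine (Nat.mul_le_mul (ncard_peelingRels_le a c) (ncard_peelingRels_le (-a) (-c))).trans ?_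
  rw [← pow_add]
  exact Nat.pow_le_pow_right (by norm_num) (by omega)

theorem disjoint_mem_visibilityRels {pos : V → ℝ × ℝ} (hpos : Function.Injective pos)
    (F : Finset (ℝ × ℝ)) :
    (fun u v => Disjoint (segment ℝ (pos u) (pos v)) (convexHull ℝ (F : Set (ℝ × ℝ)))) ∈
      visibilityRels (fun u => -(pos u).1) fun u => (pos u).2 := by
  refine ⟨(_, _), ⟨overlap_mem_peelingRels ?_ (F.image fun x => (-x.1, x.2)),
    overlap_mem_peelingRels ?_ (F.image fun x => (x.1, -x.2))⟩, ?_⟩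
  · intro u v h
    exact hpos (Prod.ext (by simpa using congrArg Prod.fst h) (by simpa using congrArg Prod.snd h))
  · intro u v h
    exact hpos (Prod.ext (by simpa using congrArg Prod.fst h) (by simpa using congrArg Prod.snd h))
  · funext u v
    rw [disjoint_segment_convexHull_iff]
    simp only [Pi.sup_apply, sup_Prop_eq, Finset.forall_mem_image, Pi.neg_apply, eq_iff_iff]
    refine or_congr (exists_congr fun t => ?_) (exists_congr fun t => ?_)
    · simp only [neg_mul, ← sub_eq_add_neg]
    · refine and_congr (forall₂_congr fun x _ => ?_) (forall₂_congr fun x _ => ?_) <;>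
        constructor <;> intro h <;> linarith

end Visibility

section Counting

open MvPolynomial

variable {n : ℕ}

/-- Polynomials whose signs at `Fin.append a c` determine the type of the lines
`t ↦ c u + a u * t`. -/
def typePoly (n : ℕ) :
    (Fin n × Fin n) ⊕ (Fin n × Fin n) ⊕ ((Fin n × Fin n) × (Fin n × Fin n)) →
      MvPolynomial (Fin (n + n)) ℝ
  | .inl p => X (Fin.castAdd n p.2) - X (Fin.castAdd n p.1)
  | .inr (.inl p) => X (Fin.natAdd n p.2) - X (Fin.natAdd n p.1)
  | .inr (.inr p) =>
      (X (Fin.natAdd n p.2.1) - X (Fin.natAdd n p.2.2)) *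
        (X (Fin.castAdd n p.1.2) - X (Fin.castAdd n p.1.1)) -
      (X (Fin.natAdd n p.1.1) - X (Fin.natAdd n p.1.2)) *
        (X (Fin.castAdd n p.2.2) - X (Fin.castAdd n p.2.1))

theorem totalDegree_typePoly_le (i) : (typePoly n i).totalDegree ≤ 2 := by
  have h1 (x y : Fin (n + n)) : (X x - X y : MvPolynomial (Fin (n + n)) ℝ).totalDegree ≤ 1 :=
    (totalDegree_sub _ _).trans (by simp)
  have h2 (x y z w : Fin (n + n)) :
      ((X x - X y) * (X z - X w) : MvPolynomial (Fin (n + n)) ℝ).totalDegree ≤ 2 :=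
    (totalDegree_mul _ _).trans (add_le_add (h1 _ _) (h1 _ _))
  rcases i with p | p | p
  · exact (h1 _ _).trans one_le_two
  · exact (h1 _ _).trans one_le_two
  · exact (totalDegree_sub _ _).trans (max_le (h2 _ _ _ _) (h2 _ _ _ _))

theorem sameType_of_typePoly {a c a' c' : Fin n → ℝ}
    (h : (fun i => 0 < eval (Fin.append a c) (typePoly n i)) =
      fun i => 0 < eval (Fin.append a' c') (typePoly n i)) : SameType a c a' c' := by
  refine ⟨fun u v => ?_, fun u v => ?_, fun u v w z => ?_⟩
  · simpa [typePoly] using congrFun h (.inl (u, v))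
  · simpa [typePoly, -Fin.natAdd_eq_addNat] using congrFun h (.inr (.inl (u, v)))
  · simpa [typePoly, -Fin.natAdd_eq_addNat] using congrFun h (.inr (.inr ((u, v), (w, z))))

/-- The graphs obtained from `H` visibility relations on points with the given coordinates. -/
def visibilityGraphs (H : ℕ) (a c : Fin n → ℝ) : Set (SimpleGraph (Fin n)) :=
  Set.range fun r : Fin H → visibilityRels a c =>
    SimpleGraph.fromRel fun u v => ∀ i, (r i : Fin n → Fin n → Prop) u v

theorem ncard_visibilityGraphs_le (H : ℕ) (a c : Fin n → ℝ) :
    (visibilityGraphs H a c).ncard ≤ 2 ^ ((20 * n + 8) * H) := by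
  rw [visibilityGraphs, ← Set.image_univ]
  refine (Set.ncard_image_le (Set.toFinite _)).trans ?_
  rw [Set.ncard_univ, Nat.card_fun, Nat.card_fin, pow_mul]
  refine Nat.pow_le_pow_left ?_ H
  rw [Nat.card_coe_set_eq]
  simpa only [Fintype.card_fin] using ncard_visibilityRels_le a c

theorem ncard_iUnion_visibilityGraphs_le (n H : ℕ) :
    (⋃ a : Fin n → ℝ, ⋃ c, visibilityGraphs H a c).ncard ≤
      ((2 + (n * n + (n * n + n * n * (n * n))) * 2) * (n + n + 1)) ^ (n + n) *
        2 ^ ((20 * n + 8) * H) := by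
  let pat (x : Fin (n + n) → ℝ) (i) : Prop := 0 < eval x (typePoly n i)
  have hW : (Set.range pat).ncard ≤ _ :=
    ncard_range_pos_pattern_le (typePoly n) totalDegree_typePoly_le
  simp only [Fintype.card_sum, Fintype.card_prod, Fintype.card_fin] at hW
  have hsurj (x : Fin (n + n) → ℝ) :
      Fin.append (fun i => x (Fin.castAdd n i)) (fun i => x (Fin.natAdd n i)) = x :=
    Fin.append_castAdd_natAdd
  choose x hx using fun T : Set.range pat => T.2
  have hsub : (⋃ a : Fin n → ℝ, ⋃ c, visibilityGraphs H a c) ⊆ ⋃ T : Set.range pat,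
      visibilityGraphs H (fun i => x T (Fin.castAdd n i)) (fun i => x T (Fin.natAdd n i)) := by
    refine Set.iUnion₂_subset fun a c => ?_
    refine (Eq.subset ?_).trans (Set.subset_iUnion _ ⟨pat (Fin.append a c), _, rfl⟩)
    unfold visibilityGraphs
    rw [SameType.visibilityRels_eq (sameType_of_typePoly _)]
    rw [hsurj]
    exact (hx ⟨pat (Fin.append a c), _, rfl⟩).symm
  have : Fintype (Set.range pat) := Fintype.ofFinite _
  refine (Set.ncard_le_ncard hsub (Set.toFinite _)).trans ((Set.ncard_iUnion_le_of_fintype _).trans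
    ((Finset.sum_le_card_nsmul _ _ _ fun T _ => ncard_visibilityGraphs_le H _ _).trans ?_))
  rw [smul_eq_mul, Finset.card_univ, ← Nat.card_eq_fintype_card]
  exact Nat.mul_le_mul_right _ hW

theorem ConvexObstacleRep.mem_visibilityGraphs {G : SimpleGraph (Fin n)} (R : ConvexObstacleRep G)
    {H : ℕ} (hH : R.numObs ≤ H) :
    G ∈ visibilityGraphs H (fun u => -(R.pos u).1) fun u => (R.pos u).2 := by
  choose F _ _ hF using R.convexPoly
  let K (i : Fin H) : Finset (ℝ × ℝ) := if h : i.1 < R.numObs then F ⟨i, h⟩ else ∅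
  refine ⟨fun i => ⟨_, disjoint_mem_visibilityRels R.posInj (K i)⟩, ?_⟩
  have hAdj (u v : Fin n) : (u ≠ v ∧ ∀ i, Disjoint (segment ℝ (R.pos u) (R.pos v))
      (convexHull ℝ (K i : Set (ℝ × ℝ)))) ↔ G.Adj u v := by
    constructor
    · rintro ⟨huv, h⟩
      by_contra hG
      obtain ⟨i, hi⟩ := R.nonedges_blocked u v huv hG
      have := h ⟨i, i.2.trans_le hH⟩
      simp only [K, i.2, dite_true, Fin.eta, ← hF] at this
      exact Set.not_disjoint_iff_nonempty_inter.2 hi this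
    · refine fun h => ⟨h.ne, fun i => ?_⟩
      by_cases hi : i.1 < R.numObs
      · simp only [K, hi, dite_true, ← hF]
        exact R.edges_clear u v h _
      · simp [K, hi]
  ext u v
  rw [SimpleGraph.fromRel_adj, and_or_left, hAdj, ne_comm, hAdj, G.adj_comm v u, or_self]

/-- The bipartite graph on `Fin n` joining `i` to `k + j` for all `(i, j) ∈ S`. -/
def bipartiteGraph (n : ℕ) {k : ℕ} (S : Set (Fin k × Fin k)) : SimpleGraph (Fin n) :=
  SimpleGraph.fromRel fun u v => ∃ p ∈ S, u.1 = p.1 ∧ v.1 = k + p.2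

theorem bipartiteGraph_colorable {k : ℕ} (S : Set (Fin k × Fin k)) :
    (bipartiteGraph n S).Colorable 2 := by
  refine (SimpleGraph.Coloring.mk (fun u : Fin n => decide (u.1 < k)) ?_ :
    (bipartiteGraph n S).Coloring Bool).colorable
  intro u v h
  rw [bipartiteGraph, SimpleGraph.fromRel_adj] at h
  simp only [ne_eq, decide_eq_decide]
  rcases h.2 with ⟨p, -, h1, h2⟩ | ⟨p, -, h1, h2⟩ <;> omega

theorem bipartiteGraph_injective {k : ℕ} (hk : 2 * k ≤ n) :
    Function.Injective fun S : Set (Fin k × Fin k) => bipartiteGraph n S := by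
  have key (S : Set (Fin k × Fin k)) (i j : Fin k) :
      (bipartiteGraph n S).Adj ⟨i, by omega⟩ ⟨k + j, by omega⟩ ↔ (i, j) ∈ S := by
    rw [bipartiteGraph, SimpleGraph.fromRel_adj]
    constructor
    · rintro ⟨-, ⟨⟨i', j'⟩, hp, h1, h2⟩ | ⟨⟨i', j'⟩, hp, h1, h2⟩⟩ <;> simp only at h1 h2
      · obtain rfl : i = i' := by omega
        obtain rfl : j = j' := by omega
        exact hp
      · omega
    · refine fun h => ⟨?_, Or.inl ⟨(i, j), h, rfl, rfl⟩⟩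
      simp only [ne_eq, Fin.mk.injEq]
      omega
  intro S T h
  ext ⟨i, j⟩
  simp only at h
  rw [← key S, h, key]

theorem two_pow_sq_le_of_reps {H k : ℕ} (hk : 2 * k ≤ n)
    (h : ∀ S : Set (Fin k × Fin k), ∃ R : ConvexObstacleRep (bipartiteGraph n S), R.numObs ≤ H) :
    2 ^ (k * k) ≤ ((2 + (n * n + (n * n + n * n * (n * n))) * 2) * (n + n + 1)) ^ (n + n) *
        2 ^ ((20 * n + 8) * H) := by
  refine le_trans ?_ (ncard_iUnion_visibilityGraphs_le n H)
  have h1 : (Set.range fun S : Set (Fin k × Fin k) => bipartiteGraph n S) ⊆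
      ⋃ a : Fin n → ℝ, ⋃ c, visibilityGraphs H a c := by
    rintro _ ⟨S, rfl⟩
    obtain ⟨R, hR⟩ := h S
    exact Set.mem_iUnion₂.2 ⟨_, _, R.mem_visibilityGraphs hR⟩
  refine le_trans (Eq.le ?_) (Set.ncard_le_ncard h1 (Set.toFinite _))
  rw [← Set.image_univ, Set.ncard_image_of_injective _ (bipartiteGraph_injective hk),
    Set.ncard_univ]
  simp

set_option exponentiation.threshold 1000 in
theorem eventually_typeCount_pow_le : ∃ N : ℕ, ∀ n ≥ N, (24 * n ^ 5) ^ 200 ≤ 2 ^ n := by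
  have h := tendsto_pow_const_div_const_pow_of_one_lt 1000 (one_lt_two : (1 : ℝ) < 2)
  have hpos : (0 : ℝ) < (24 ^ 200)⁻¹ := by positivity
  obtain ⟨N, hN⟩ := Filter.eventually_atTop.1 (h.eventually (ge_mem_nhds hpos))
  refine ⟨N, fun n hn => ?_⟩
  have h1 := hN n hn
  rw [div_le_iff₀ (by positivity), inv_mul_eq_div, le_div_iff₀ (by positivity)] at h1
  rw [mul_pow, ← pow_mul, mul_comm]
  exact_mod_cast h1

theorem exists_bipartiteGraph_many_obstacles : ∃ N : ℕ, ∀ n ≥ N, ∃ G : SimpleGraph (Fin n),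
    G.Colorable 2 ∧ ∀ R : ConvexObstacleRep G, n ≤ 400 * R.numObs := by
  obtain ⟨N, hN⟩ := eventually_typeCount_pow_le
  refine ⟨N + 2, fun n hn => ?_⟩
  by_contra! hcon
  obtain ⟨k, hk, hk', hk0⟩ : ∃ k, 2 * k ≤ n ∧ n ≤ 2 * k + 1 ∧ 1 ≤ k :=
    ⟨n / 2, by omega, by omega, by omega⟩
  have hreps := two_pow_sq_le_of_reps (n := n) (H := n / 400) hk fun S => by
    obtain ⟨R, hR⟩ := hcon (bipartiteGraph n S) (bipartiteGraph_colorable S)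
    exact ⟨R, by omega⟩
  have hbase : (2 + (n * n + (n * n + n * n * (n * n))) * 2) * (n + n + 1) ≤ 24 * n ^ 5 := by
    have h1 : 1 ≤ n := by omega
    have h2 : n * n ≤ n * n * (n * n) := Nat.le_mul_of_pos_right _ (by positivity)
    have h3 : 0 < n * n * (n * n) := by positivity
    calc _ ≤ (8 * (n * n * (n * n))) * (3 * n) := Nat.mul_le_mul (by omega) (by omega)
      _ = _ := by ring
  have hpow : (2 ^ (k * k)) ^ 100 ≤ 2 ^ (8 * (n * n)) := by
    calc (2 ^ (k * k)) ^ 100 ≤ ((24 * n ^ 5) ^ (n + n) * 2 ^ ((20 * n + 8) * (n / 400))) ^ 100 := by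
          gcongr
          exact hreps.trans (by gcongr)
      _ = ((24 * n ^ 5) ^ 200) ^ n * 2 ^ ((20 * n + 8) * (n / 400) * 100) := by
          rw [mul_pow, ← pow_mul, ← pow_mul, ← pow_mul]
          congr 2
          ring
      _ ≤ (2 ^ n) ^ n * 2 ^ (7 * (n * n)) := by
          refine Nat.mul_le_mul (Nat.pow_le_pow_left (hN n (by omega)) n)
            (Nat.pow_le_pow_right (by norm_num) ?_)
          have h1 : 20 * n + 8 ≤ 28 * n := by omega
          have h2 : n / 400 * 400 ≤ n := Nat.div_mul_le_self n 400
          nlinarith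
      _ = _ := by
          rw [← pow_mul, ← pow_add]
          congr 1
          ring
  rw [← pow_mul, Nat.pow_le_pow_iff_right (by norm_num)] at hpow
  nlinarith

end Counting

/-- There is a constant `γ > 0` such that every `n ≥ 2` admits a bipartite `n`-vertex
graph whose every convex obstacle representation uses at least `γ·n` obstacles. -/
theorem convex_obstacle_number_lower_bound :
    ∃ γ : ℝ, 0 < γ ∧ ∀ n : ℕ, 2 ≤ n →
      ∃ G : SimpleGraph (Fin n), G.Colorable 2 ∧
        ∀ R : ConvexObstacleRep G, γ * (n : ℝ) ≤ (R.numObs : ℝ) := by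
  obtain ⟨N, hN⟩ := exists_bipartiteGraph_many_obstacles
  refine ⟨(400 + N : ℝ)⁻¹, by positivity, fun n hn => ?_⟩
  have hpos : (0 : ℝ) < 400 + N := by positivity
  simp only [inv_mul_le_iff₀ hpos]
  rcases le_or_gt N n with h | h
  · obtain ⟨G, hG, hR⟩ := hN n h
    refine ⟨G, hG, fun R => ?_⟩
    have : (n : ℝ) ≤ 400 * R.numObs := by exact_mod_cast hR R
    have : 0 ≤ (N : ℝ) * R.numObs := by positivity
    linarith
  · refine ⟨⊥, SimpleGraph.Coloring.colorable (α := Fin 2) (SimpleGraph.Coloring.mk 0 (by simp)),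
      fun R => ?_⟩
    obtain ⟨i, -⟩ := R.nonedges_blocked ⟨0, by omega⟩ ⟨1, by omega⟩ (by simp) (by simp)
    have h1 : (1 : ℝ) ≤ R.numObs := by exact_mod_cast i.pos
    have h2 : (n : ℝ) ≤ N := by exact_mod_cast h.le
    nlinarith
end
end

section
/- There is a constant c > 0 such that for all integers h ≥ 1 and n ≥ 2, the number of simple graphs on the vertex set {0,…,n−1} that admit a convex obstacle representation with at most h obstacles is at most 2^{c·n·(h + log n)}. -/
open scoped Classical

noncomputable section

namespace MvPolynomial

variable {σ : Type*}

theorem hasDerivAt_eval_update (F : MvPolynomial σ ℝ) (y : σ → ℝ) (i : σ) :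
    HasDerivAt (fun t => eval (Function.update y i t) F) (eval y (pderiv i F)) (y i) := by
  induction F using MvPolynomial.induction_on with
  | C a => simpa using hasDerivAt_const (y i) a
  | add p q hp hq => simpa [Pi.add_def] using hp.add hq
  | mul_X p j hp =>
    have hX : HasDerivAt (fun t => Function.update y i t j) (eval y (pderiv i (X j))) (y i) := by
      by_cases hj : j = i
      · subst hj
        simpa using hasDerivAt_id' (y j)
      · simpa [Function.update_of_ne hj, pderiv_X_of_ne hj] using hasDerivAt_const (y i) (y j)
    have := hp.mul hX
    simp only [Function.update_eq_self] at this
    simp only [eval_mul, eval_X, Derivation.leibniz, eval_add, smul_eq_mul]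
    refine this.congr_deriv ?_
    ring

theorem totalDegree_pderiv_le (F : MvPolynomial σ ℝ) (i : σ) :
    (pderiv i F).totalDegree ≤ F.totalDegree := by
  apply Finset.sup_le
  intro m hm
  rw [mem_support_iff, coeff_pderiv] at hm
  have h1 : m + Finsupp.single i 1 ∈ F.support :=
    mem_support_iff.2 fun h => hm (by rw [h, zero_mul])
  refine le_trans ?_ (le_totalDegree h1)
  change m.degree ≤ (m + Finsupp.single i 1).degree
  simp

variable [Fintype σ]

/-- Any `card σ` polynomials of degree at most `D` together with a linear form satisfy a
polynomial relation of degree at most `(card σ * D + 1) ^ card σ` in the linear form. -/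
theorem exists_relation_of_totalDegree_le (g : σ → MvPolynomial σ ℝ) (D : ℕ)
    (hg : ∀ i, (g i).totalDegree ≤ D) (ℓ : MvPolynomial σ ℝ) (hℓ : ℓ.totalDegree ≤ 1)
    (A B : ℕ) (hB : B = (Fintype.card σ * D + 1) ^ Fintype.card σ + 1) (hA : A = B + 1) :
    ∃ q : (σ → Fin A) × Fin B → ℝ, q ≠ 0 ∧ ∀ x : σ → ℝ,
      ∑ m, q m * ((∏ i, eval x (g i) ^ (m.1 i : ℕ)) * eval x ℓ ^ (m.2 : ℕ)) = 0 := by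
  set N := Fintype.card σ with hN
  let mon : (σ → Fin A) × Fin B → MvPolynomial σ ℝ :=
    fun m => (∏ i, g i ^ (m.1 i : ℕ)) * ℓ ^ (m.2 : ℕ)
  set M := N * (A * D) + B with hM
  have hmon : ∀ m, (mon m).totalDegree ≤ M := by
    intro m
    refine (totalDegree_mul _ _).trans (add_le_add ?_ ?_)
    · refine (totalDegree_finsetProd _ _).trans ?_
      refine (Finset.sum_le_card_nsmul _ _ (A * D) ?_).trans (by simp [hN])
      intro i _
      exact (totalDegree_pow _ _).trans (Nat.mul_le_mul (m.1 i).2.le (hg i))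
    · refine (totalDegree_pow _ _).trans ?_
      calc (m.2 : ℕ) * ℓ.totalDegree ≤ B * 1 := Nat.mul_le_mul m.2.2.le hℓ
        _ = B := mul_one B
  let comb : ((σ → Fin A) × Fin B → ℝ) →ₗ[ℝ] MvPolynomial σ ℝ := Fintype.linearCombination ℝ mon
  let Φ : ((σ → Fin A) × Fin B → ℝ) →ₗ[ℝ] ((σ → Fin (M + 1)) → ℝ) :=
    LinearMap.pi fun e =>
      (lcoeff ℝ (Finsupp.equivFunOnFinite.symm fun i => (e i : ℕ))) ∘ₗ comb
  have hdim : Module.finrank ℝ ((σ → Fin (M + 1)) → ℝ) <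
      Module.finrank ℝ ((σ → Fin A) × Fin B → ℝ) := by
    simp only [Module.finrank_fintype_fun_eq_card, Fintype.card_prod, Fintype.card_fun,
      Fintype.card_fin, ← hN]
    have h1 : M + 1 = A * (N * D + 1) := by rw [hM, hA]; ring
    rw [h1, mul_pow]
    apply Nat.mul_lt_mul_of_pos_left
    · omega
    · apply Nat.pow_pos; omega
  obtain ⟨q, hq, hq0⟩ :=
    (Submodule.ne_bot_iff _).1 (LinearMap.ker_ne_bot_of_finrank_lt (f := Φ) hdim)
  refine ⟨q, hq0, fun x => ?_⟩
  have hcomb : comb q = 0 := by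
    ext e
    rw [coeff_zero]
    by_cases he : ∀ i, e i < M + 1
    · have := congrFun (LinearMap.mem_ker.1 hq) (fun i => ⟨e i, he i⟩)
      simpa [Φ, lcoeff_apply] using this
    · push Not at he
      obtain ⟨i, hi⟩ := he
      apply coeff_eq_zero_of_totalDegree_lt
      have hdeg : (comb q).totalDegree ≤ M := by
        simp only [comb, Fintype.linearCombination_apply]
        apply totalDegree_finsetSum_le
        intro m _
        exact (totalDegree_smul_le _ _).trans (hmon m)
      refine hdeg.trans_lt (lt_of_lt_of_le hi ?_)
      exact Finsupp.le_degree i e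
  have := congrArg (eval x) hcomb
  simpa [comb, mon, Fintype.linearCombination_apply, smul_eval, map_sum, map_prod] using this


/-- Finitely many distinct points are separated by one of boundedly many fixed linear forms. -/
theorem exists_separating_linear_form (e : σ ≃ Fin (Fintype.card σ)) {K : ℕ}
    (p : Fin K → σ → ℝ) (hp : Function.Injective p) :
    ∃ t : Fin (K * K * Fintype.card σ + 1),
      Function.Injective fun k => ∑ i, (t : ℝ) ^ (e i : ℕ) * p k i := by
  let P : Fin K × Fin K → Polynomial ℝ := fun kk =>
    ∑ i, Polynomial.monomial (e i : ℕ) (p kk.1 i - p kk.2 i)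
  have hPne : ∀ kk ∈ (Finset.univ : Finset (Fin K)).offDiag, P kk ≠ 0 := by
    rintro ⟨k, k'⟩ hkk h0
    have hne : k ≠ k' := by simpa using hkk
    apply hne
    apply hp
    funext i
    have := congrArg (fun Q => Polynomial.coeff Q (e i : ℕ)) h0
    simp only [P, Polynomial.finsetSum_coeff, Polynomial.coeff_monomial,
      Polynomial.coeff_zero] at this
    rw [Finset.sum_eq_single i] at this
    · simpa [sub_eq_zero] using this
    · intro j _ hj
      rw [if_neg]
      intro h
      exact hj (e.injective (Fin.ext h))
    · simp
  have hPdeg : ∀ kk, (P kk).natDegree ≤ Fintype.card σ := by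
    intro kk
    apply Polynomial.natDegree_sum_le_of_forall_le
    intro i _
    exact (Polynomial.natDegree_monomial_le _).trans (e i).2.le
  by_contra! hcon
  have hzero : ∏ kk ∈ (Finset.univ : Finset (Fin K)).offDiag, P kk = 0 := by
    apply Polynomial.eq_zero_of_natDegree_lt_card_of_eval_eq_zero _
      (f := fun t : Fin (K * K * Fintype.card σ + 1) => (t : ℝ))
    · intro a b hab
      exact Fin.ext (Nat.cast_injective (R := ℝ) hab)
    · intro t
      obtain ⟨k, k', hkk, hne⟩ : ∃ k k', (∑ i, (t : ℝ) ^ (e i : ℕ) * p k i) =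
          (∑ i, (t : ℝ) ^ (e i : ℕ) * p k' i) ∧ k ≠ k' := by
        simpa [Function.Injective] using hcon t
      rw [Polynomial.eval_prod]
      apply Finset.prod_eq_zero (i := (k, k')) (by simpa using hne)
      simp only [P, Polynomial.eval_finsetSum, Polynomial.eval_monomial]
      rw [← sub_eq_zero, ← Finset.sum_sub_distrib] at hkk
      rw [← hkk]
      exact Finset.sum_congr rfl fun i _ => by ring
    · rw [Fintype.card_fin]
      refine (Nat.lt_succ_of_le ?_)
      refine (Polynomial.natDegree_prod_le _ _).trans ?_
      refine (Finset.sum_le_card_nsmul _ _ _ fun kk _ => hPdeg kk).trans ?_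
      rw [smul_eq_mul]
      apply Nat.mul_le_mul_right
      simp [Finset.offDiag_card]
  exact Finset.prod_ne_zero_iff.2 hPne hzero

/-- A weak form of Bézout's theorem: if a square system of polynomial equations of degree at most
`D` has at least `K` solutions for all small right-hand sides, then
`K ≤ (card σ * D + 1) ^ card σ`. -/
theorem card_solutions_le (g : σ → MvPolynomial σ ℝ) (D : ℕ)
    (hg : ∀ i, (g i).totalDegree ≤ D) (K : ℕ) (δ : ℝ) (hδ : 0 < δ)
    (h : ∀ c : σ → ℝ, (∀ i, c i ∈ Set.Ioo (-δ) δ) →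
      ∃ p : Fin K → σ → ℝ, Function.Injective p ∧ ∀ k i, eval (p k) (g i) = c i) :
    K ≤ (Fintype.card σ * D + 1) ^ Fintype.card σ := by
  let e := Fintype.equivFin σ
  obtain ⟨B, hB⟩ : ∃ B, B = (Fintype.card σ * D + 1) ^ Fintype.card σ + 1 := ⟨_, rfl⟩
  obtain ⟨A, hA⟩ : ∃ A, A = B + 1 := ⟨_, rfl⟩
  let ℓ : Fin (K * K * Fintype.card σ + 1) → MvPolynomial σ ℝ :=
    fun t => ∑ i, C ((t : ℝ) ^ (e i : ℕ)) * X i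
  have hℓ : ∀ t, (ℓ t).totalDegree ≤ 1 := by
    intro t
    apply totalDegree_finsetSum_le
    intro i _
    refine (totalDegree_mul _ _).trans ?_
    rw [totalDegree_C, totalDegree_X]
  choose q hq0 hq using fun t => exists_relation_of_totalDegree_le g D hg (ℓ t) (hℓ t) A B hB hA
  have hex : ∀ t, ∃ m, q t m ≠ 0 := fun t => Function.ne_iff.1 (hq0 t)
  choose m hm using hex
  let Q : Fin (K * K * Fintype.card σ + 1) → MvPolynomial σ ℝ := fun t =>
    ∑ a : σ → Fin A, monomial (Finsupp.equivFunOnFinite.symm fun i => (a i : ℕ)) (q t (a, (m t).2))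
  have hQ0 : ∀ t, Q t ≠ 0 := by
    intro t h0
    apply hm t
    have := congrArg (coeff (Finsupp.equivFunOnFinite.symm fun i => ((m t).1 i : ℕ))) h0
    simp only [Q, coeff_sum, coeff_monomial, coeff_zero] at this
    rw [Finset.sum_eq_single (m t).1] at this
    · simpa using this
    · intro a _ ha
      rw [if_neg]
      intro hh
      apply ha
      funext i
      exact Fin.ext (congrFun (Finsupp.equivFunOnFinite.symm.injective hh) i)
    · simp
  have hprod : ∏ t, Q t ≠ 0 := Finset.prod_ne_zero_iff.2 fun t _ => hQ0 t
  obtain ⟨c, hc, hcQ⟩ : ∃ c : σ → ℝ, (∀ i, c i ∈ Set.Ioo (-δ) δ) ∧ eval c (∏ t, Q t) ≠ 0 := by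
    by_contra! hcon
    apply hprod
    apply funext_set (fun _ => Set.Ioo (-δ) δ) (fun _ => Set.Ioo_infinite (by linarith))
    intro x hx
    rw [hcon x (fun i => hx i (Set.mem_univ i)), map_zero]
  obtain ⟨p, hpinj, hp⟩ := h c hc
  obtain ⟨t, ht⟩ := exists_separating_linear_form e p hpinj
  have hQt : eval c (Q t) ≠ 0 := by
    rw [map_prod] at hcQ
    exact Finset.prod_ne_zero_iff.1 hcQ t (Finset.mem_univ t)
  let u : Polynomial ℝ := ∑ b : Fin B, Polynomial.monomial (b : ℕ)
    (∑ a : σ → Fin A, q t (a, b) * ∏ i, c i ^ (a i : ℕ))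
  have hu0 : u ≠ 0 := by
    intro h0
    apply hQt
    have := congrArg (fun r => Polynomial.coeff r ((m t).2 : ℕ)) h0
    simp only [u, Polynomial.finsetSum_coeff, Polynomial.coeff_monomial,
      Polynomial.coeff_zero] at this
    rw [Finset.sum_eq_single (m t).2] at this
    · rw [if_pos rfl] at this
      rw [← this]
      simp only [Q, map_sum, eval_monomial]
      refine Finset.sum_congr rfl fun a _ => ?_
      rw [Finsupp.prod_fintype _ _ (by simp)]
      rfl
    · intro b _ hb
      rw [if_neg]
      exact fun hh => hb (Fin.ext hh)
    · simp
  have hudeg : u.natDegree ≤ B - 1 := by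
    apply Polynomial.natDegree_sum_le_of_forall_le
    intro b _
    have := b.2
    exact (Polynomial.natDegree_monomial_le _).trans (by omega)
  by_contra! hK
  apply hu0
  apply Polynomial.eq_zero_of_natDegree_lt_card_of_eval_eq_zero _ ht
  · intro k
    rw [← hq t (p k), Fintype.sum_prod_type_right]
    simp only [u, Polynomial.eval_finsetSum, Polynomial.eval_monomial]
    refine Finset.sum_congr rfl fun b _ => ?_
    rw [Finset.sum_mul]
    refine Finset.sum_congr rfl fun a _ => ?_
    simp [ℓ, hp, mul_assoc]
  · rw [Fintype.card_fin]
    omega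

/-- For every small linear perturbation of `F = (∏ f j) * (R - ∑ X i ^ 2)`, each sign class of the
family `f` meeting the ball of squared radius `R` contains a critical point. -/
theorem exists_critical_point_of_signs {ι : Type*} [Fintype ι] (f : ι → MvPolynomial σ ℝ) (R : ℝ)
    (F : MvPolynomial σ ℝ) (hF : F = (∏ j, f j) * (C R - ∑ i, X i ^ 2))
    (x : σ → ℝ) (hx : ∀ j, eval x (f j) ≠ 0) (hxR : ∑ i, x i ^ 2 < R)
    (δ : ℝ) (hδ : 2 * (Fintype.card σ * (δ * (R + 1))) < |eval x F|)
    (c : σ → ℝ) (hc : ∀ i, c i ∈ Set.Ioo (-δ) δ) :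
    ∃ y : σ → ℝ, (∀ j, 0 < eval x (f j) * eval y (f j)) ∧ ∀ i, eval y (pderiv i F) = c i := by
  have hFe : ∀ y, eval y F = (∏ j, eval y (f j)) * (R - ∑ i, y i ^ 2) := by
    intro y
    simp [hF, map_prod, map_sum]
  let S : Set (σ → ℝ) := {y | ∑ i, y i ^ 2 ≤ R ∧ ∀ j, 0 ≤ eval x (f j) * eval y (f j)}
  have hRpos : 0 < R := (Finset.sum_nonneg fun i _ => sq_nonneg (x i)).trans_lt hxR
  have habs : ∀ y ∈ S, ∀ i, |y i| ≤ R + 1 := by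
    intro y hy i
    have h1 : y i ^ 2 ≤ R :=
      (Finset.single_le_sum (f := fun i => y i ^ 2) (fun i _ => sq_nonneg (y i))
        (Finset.mem_univ i)).trans hy.1
    exact abs_le.2 ⟨by nlinarith, by nlinarith⟩
  have hclosed : IsClosed S := by
    have h1 : IsClosed {y : σ → ℝ | ∑ i, y i ^ 2 ≤ R} :=
      isClosed_le (by fun_prop) continuous_const
    have h2 : IsClosed {y : σ → ℝ | ∀ j, 0 ≤ eval x (f j) * eval y (f j)} := by
      simp only [Set.ofPred_forall]
      exact isClosed_iInter fun j =>
        isClosed_le continuous_const (continuous_const.mul (continuous_eval (f j)))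
    exact h1.inter h2
  have hcompact : IsCompact S := by
    refine (isCompact_Icc (a := fun _ : σ => -(R + 1)) (b := fun _ => R + 1)).of_isClosed_subset
      hclosed fun y hy => ?_
    exact ⟨fun i => (abs_le.1 (habs y hy i)).1, fun i => (abs_le.1 (habs y hy i)).2⟩
  have hxS : x ∈ S := ⟨hxR.le, fun j => mul_self_nonneg _⟩
  let G : MvPolynomial σ ℝ := C (eval x F) * (F - ∑ i, C (c i) * X i)
  have hGe : ∀ y, eval y G = eval x F * (eval y F - ∑ i, c i * y i) := by
    intro y
    simp [G, map_sum]
  obtain ⟨y, hyS, hymax⟩ := hcompact.exists_isMaxOn ⟨x, hxS⟩ (continuous_eval G).continuousOn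
  have hlin : ∀ z ∈ S, |∑ i, c i * z i| ≤ Fintype.card σ * (δ * (R + 1)) := by
    intro z hz
    refine (Finset.abs_sum_le_sum_abs _ _).trans ?_
    refine (Finset.sum_le_card_nsmul _ _ (δ * (R + 1)) fun i _ => ?_).trans (by simp)
    rw [abs_mul]
    have h1 : |c i| ≤ δ := abs_le.2 ⟨(hc i).1.le, (hc i).2.le⟩
    exact mul_le_mul h1 (habs z hz i) (abs_nonneg _) ((abs_nonneg _).trans h1)
  have hFy : eval y F ≠ 0 := by
    intro h0
    have h1 : eval x G ≤ eval y G := hymax hxS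
    rw [hGe, hGe, h0] at h1
    have h2 := hlin x hxS
    have h3 := hlin y hyS
    set η := (Fintype.card σ : ℝ) * (δ * (R + 1))
    rw [abs_le] at h2 h3
    rcases abs_cases (eval x F) with ⟨ha, hb⟩ | ⟨ha, hb⟩ <;> rw [ha] at hδ <;> nlinarith
  have hfy : ∀ j, eval y (f j) ≠ 0 := by
    intro j h0
    apply hFy
    rw [hFe, Finset.prod_eq_zero (Finset.mem_univ j) h0, zero_mul]
  have hpos : ∀ j, 0 < eval x (f j) * eval y (f j) := fun j =>
    lt_of_le_of_ne (hyS.2 j) (mul_ne_zero (hx j) (hfy j)).symm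
  have hball : ∑ i, y i ^ 2 < R := by
    refine lt_of_le_of_ne hyS.1 fun h0 => hFy ?_
    rw [hFe, h0, sub_self, mul_zero]
  refine ⟨y, hpos, fun i => ?_⟩
  have hcont : Continuous fun t => Function.update y i t := by fun_prop
  have hev : ∀ᶠ t in nhds (y i), Function.update y i t ∈ S := by
    have h1 : ∀ᶠ z in nhds y, z ∈ S := by
      have h2 : ∀ᶠ z in nhds y, ∑ i, z i ^ 2 < R :=
        (Continuous.tendsto (by fun_prop) y).eventually_lt_const hball
      have h3 : ∀ᶠ z in nhds y, ∀ j, 0 < eval x (f j) * eval z (f j) :=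
        Filter.eventually_all.2 fun j =>
          ((continuous_const.mul (continuous_eval (f j))).tendsto y).eventually_const_lt (hpos j)
      filter_upwards [h2, h3] with z hz2 hz3
      exact ⟨hz2.le, fun j => (hz3 j).le⟩
    have h4 := hcont.tendsto (y i)
    rw [Function.update_eq_self] at h4
    exact h4.eventually h1
  have hmax : IsLocalMax (fun t => eval (Function.update y i t) G) (y i) := by
    filter_upwards [hev] with t ht
    rw [Function.update_eq_self]
    exact hymax ht
  have hder := hmax.hasDerivAt_eq_zero (hasDerivAt_eval_update G y i)
  have hFx : eval x F ≠ 0 := by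
    rw [hFe]
    exact mul_ne_zero (Finset.prod_ne_zero_iff.2 fun j _ => hx j) (sub_pos.2 hxR).ne'
  have hG : eval y (pderiv i G) = eval x F * (eval y (pderiv i F) - c i) := by
    simp [G, map_sum, pderiv_X, Pi.single_apply]
  rw [hG] at hder
  have := (mul_eq_zero.1 hder).resolve_left hFx
  linarith

/-- A Warren-type bound on the number of strict sign patterns of a family of polynomials. -/
theorem card_strict_sign_patterns_le {ι : Type*} [Fintype ι] (f : ι → MvPolynomial σ ℝ) (d : ℕ)
    (hf : ∀ j, (f j).totalDegree ≤ d) (K : ℕ) (x : Fin K → σ → ℝ)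
    (hne : ∀ k j, eval (x k) (f j) ≠ 0)
    (hdiff : ∀ k k', (∀ j, 0 < eval (x k) (f j) * eval (x k') (f j)) → k = k') :
    K ≤ (Fintype.card σ * (Fintype.card ι * d + 2) + 1) ^ Fintype.card σ := by
  let R : ℝ := 1 + ∑ k, ∑ i, x k i ^ 2
  have hR : ∀ k, ∑ i, x k i ^ 2 < R := by
    intro k
    have := Finset.single_le_sum (f := fun k => ∑ i, x k i ^ 2)
      (fun k _ => Finset.sum_nonneg fun i _ => sq_nonneg (x k i)) (Finset.mem_univ k)
    simp only [R]
    linarith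
  have hR0 : 0 < R := by positivity
  obtain ⟨F, hF⟩ : ∃ F : MvPolynomial σ ℝ, F = (∏ j, f j) * (C R - ∑ i, X i ^ 2) := ⟨_, rfl⟩
  have hdeg : F.totalDegree ≤ Fintype.card ι * d + 2 := by
    rw [hF]
    refine (totalDegree_mul _ _).trans (add_le_add ?_ ?_)
    · refine (totalDegree_finsetProd _ _).trans ?_
      exact (Finset.sum_le_card_nsmul _ _ d fun j _ => hf j).trans (by simp)
    · refine (totalDegree_sub _ _).trans (max_le (by simp) ?_)
      apply totalDegree_finsetSum_le
      intro i _
      exact (totalDegree_pow _ _).trans (by simp)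
  have hFx : ∀ k, 0 < |eval (x k) F| := by
    intro k
    have h2 : R - ∑ i, x k i ^ 2 ≠ 0 := (sub_pos.2 (hR k)).ne'
    have h3 := Finset.prod_ne_zero_iff.2 fun j (_ : j ∈ Finset.univ) => hne k j
    rw [abs_pos, hF]
    simpa only [map_mul, map_prod, map_sub, eval_C, map_sum, map_pow, eval_X] using
      mul_ne_zero h3 h2
  obtain ⟨δ, hδ, hδx⟩ : ∃ δ : ℝ, 0 < δ ∧
      ∀ k, 2 * (Fintype.card σ * (δ * (R + 1))) < |eval (x k) F| := by
    have h1 : ∀ᶠ δ in nhdsWithin (0 : ℝ) (Set.Ioi 0),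
        ∀ k, 2 * (Fintype.card σ * (δ * (R + 1))) < |eval (x k) F| := by
      refine Filter.eventually_all.2 fun k => ?_
      have h2 : Filter.Tendsto (fun δ : ℝ => 2 * (Fintype.card σ * (δ * (R + 1)))) (nhds 0)
          (nhds (2 * (Fintype.card σ * (0 * (R + 1))))) := Continuous.tendsto (by fun_prop) 0
      refine (h2.mono_left nhdsWithin_le_nhds).eventually_lt_const ?_
      simpa using hFx k
    obtain ⟨δ, h3, h4⟩ := (h1.and self_mem_nhdsWithin).exists
    exact ⟨δ, h4, h3⟩
  apply card_solutions_le (fun i => pderiv i F) _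
    (fun i => (totalDegree_pderiv_le F i).trans hdeg) K δ hδ
  intro c hc
  choose p hp hpc using fun k =>
    exists_critical_point_of_signs f R F hF (x k) (hne k) (hR k) δ (hδx k) c hc
  refine ⟨p, fun k k' hkk => hdiff k k' fun j => ?_, hpc⟩
  have h1 := hp k j
  have h2 := hp k' j
  rw [hkk] at h1
  have h3 := mul_pos h1 h2
  have h4 : 0 < eval (p k') (f j) * eval (p k') (f j) :=
    mul_self_pos.2 fun h0 => by simp [h0] at h2
  by_contra! hneg
  nlinarith

/-- A Warren-type bound on the number of sign patterns, zeros included. -/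
theorem card_sign_patterns_le {ι : Type*} [Fintype ι] (f : ι → MvPolynomial σ ℝ) (d : ℕ)
    (hf : ∀ j, (f j).totalDegree ≤ d) :
    (Set.range fun (x : σ → ℝ) (j : ι) => SignType.sign (eval x (f j))).ncard ≤
      (Fintype.card σ * (Fintype.card ι * 2 * d + 2) + 1) ^ Fintype.card σ := by
  set S := Set.range fun (x : σ → ℝ) (j : ι) => SignType.sign (eval x (f j)) with hS
  have hSfin : S.Finite := Set.toFinite S
  have : Fintype S := hSfin.fintype
  have hcard : S.ncard = Fintype.card S := by
    rw [Set.ncard_eq_toFinset_card', Set.toFinset_card]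
  rw [hcard]
  let e := Fintype.equivFin S
  choose w hw using fun s : S => s.2
  let x : Fin (Fintype.card S) → σ → ℝ := fun k => w (e.symm k)
  obtain ⟨δ, hδ, hδx⟩ : ∃ δ : ℝ, 0 < δ ∧
      ∀ k j, eval (x k) (f j) ≠ 0 → δ < |eval (x k) (f j)| := by
    have h1 : ∀ᶠ δ in nhdsWithin (0 : ℝ) (Set.Ioi 0),
        ∀ k j, eval (x k) (f j) ≠ 0 → δ < |eval (x k) (f j)| := by
      refine Filter.eventually_all.2 fun k => Filter.eventually_all.2 fun j => ?_
      by_cases h0 : eval (x k) (f j) = 0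
      · simp [h0]
      · have h2 : Filter.Tendsto (fun δ : ℝ => δ) (nhds 0) (nhds 0) := Filter.tendsto_id
        filter_upwards [(h2.mono_left nhdsWithin_le_nhds).eventually_lt_const (abs_pos.2 h0)]
          with δ hδ _
        exact hδ
    obtain ⟨δ, h3, h4⟩ := (h1.and self_mem_nhdsWithin).exists
    exact ⟨δ, h4, h3⟩
  let f' : ι × Bool → MvPolynomial σ ℝ := fun jb => f jb.1 + C (if jb.2 then δ else -δ)
  have hf' : ∀ jb, (f' jb).totalDegree ≤ d := fun jb =>
    (totalDegree_add _ _).trans (max_le (hf jb.1) (by simp))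
  have hval : ∀ k j b, eval (x k) (f' (j, b)) = eval (x k) (f j) + if b then δ else -δ := by
    intro k j b
    simp [f']
  have key := card_strict_sign_patterns_le f' d hf' (Fintype.card S) x ?_ ?_
  · simpa using key
  · rintro k ⟨j, b⟩
    rw [hval]
    intro h0
    by_cases hz : eval (x k) (f j) = 0
    · rw [hz] at h0
      cases b <;> simp at h0 <;> linarith
    · have h1 := hδx k j hz
      have h2 : |eval (x k) (f j)| = δ := by
        cases b
        · have : eval (x k) (f j) = δ := by simp at h0; linarith
          rw [this, abs_of_pos hδ]
        · have : eval (x k) (f j) = -δ := by simp at h0; linarith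
          rw [this, abs_neg, abs_of_pos hδ]
      linarith
  · intro k k' hkk
    apply e.symm.injective
    apply Subtype.ext
    rw [← hw (e.symm k), ← hw (e.symm k')]
    funext j
    have h1 := hkk (j, true)
    have h2 := hkk (j, false)
    rw [hval, hval] at h1 h2
    simp only [if_true, Bool.false_eq_true, if_false] at h1 h2
    change SignType.sign (eval (x k) (f j)) = SignType.sign (eval (x k') (f j))
    have a1 := hδx k j
    have a2 := hδx k' j
    generalize eval (x k) (f j) = a at *
    generalize eval (x k') (f j) = b at *
    rcases lt_trichotomy a 0 with ha | ha | ha <;> rcases lt_trichotomy b 0 with hb | hb | hb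
    · rw [sign_neg ha, sign_neg hb]
    · have := a1 ha.ne
      rw [abs_of_neg ha] at this
      subst hb
      nlinarith
    · have := a1 ha.ne
      rw [abs_of_neg ha] at this
      nlinarith
    · have := a2 hb.ne
      rw [abs_of_neg hb] at this
      subst ha
      nlinarith
    · rw [ha, hb]
    · have := a2 hb.ne'
      rw [abs_of_pos hb] at this
      subst ha
      nlinarith
    · have := a2 hb.ne
      rw [abs_of_neg hb] at this
      nlinarith
    · have := a1 ha.ne'
      rw [abs_of_pos ha] at this
      subst hb
      nlinarith
    · rw [sign_pos ha, sign_pos hb]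

end MvPolynomial

namespace LineArrangement

variable {V : Type*}

/-- The height at abscissa `x` of the line dual to the point `p`. -/
def height (p : ℝ × ℝ) (x : ℝ) : ℝ := p.1 * x + p.2

/-- The quantities whose signs describe an arrangement of lines: differences of slopes, differences
of intercepts, and comparisons of crossing points along a line. -/
def quantity (q : V → ℝ × ℝ) : V × V × V × Fin 3 → ℝ
  | (_, w, v, 0) => (q w).1 - (q v).1
  | (_, w, v, 1) => (q w).2 - (q v).2
  | (c, w, v, 2) =>
    ((q w).2 - (q c).2) * ((q c).1 - (q v).1) - ((q v).2 - (q c).2) * ((q c).1 - (q w).1)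

/-- The signs of the quantities describing an arrangement of lines. -/
def signs (q : V → ℝ × ℝ) (j : V × V × V × Fin 3) : SignType :=
  SignType.sign (quantity q j)

/-- The effect on the sign data of multiplying slopes by `s` and intercepts by `t`. -/
def twist (s t : SignType) (P : V × V × V × Fin 3 → SignType) : V × V × V × Fin 3 → SignType
  | (c, w, v, 0) => s * P (c, w, v, 0)
  | (c, w, v, 1) => t * P (c, w, v, 1)
  | (c, w, v, 2) => s * t * P (c, w, v, 2)

theorem signs_smul (q : V → ℝ × ℝ) (s t : ℝ) :
    signs (fun v => (s * (q v).1, t * (q v).2)) =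
      twist (SignType.sign s) (SignType.sign t) (signs q) := by
  funext ⟨c, w, v, i⟩
  fin_cases i <;> simp only [signs, quantity, twist] <;>
    simp only [← sign_mul] <;> congr 1 <;> ring

/-- Decode the relation `l u < r v` from the ranks `L` and `R` and a set `T` of positions. -/
def decodeLt (n : ℕ) (R L : V → ℕ) (T : Finset (Fin (2 * n + 1))) (u v : V) : Prop :=
  ∃ t ∈ T, (T.filter fun s => t < s).card = R v ∧ L u + n < t + R v

theorem exists_decodeLt_iff [Fintype V] (U : Finset V) (l r : V → ℝ)
    (hr : ∀ v ∈ U, ∀ w ∈ U, r v = r w → v = w) (R L : V → ℕ)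
    (hR : ∀ v ∈ U, R v = (U.filter fun w => r v < r w).card)
    (hL : ∀ u ∈ U, L u = (U.filter fun w => l w < l u).card) :
    ∃ T : Finset (Fin (2 * Fintype.card V + 1)), ∀ u ∈ U, ∀ v ∈ U,
      decodeLt (Fintype.card V) R L T u v ↔ l u < r v := by
  have hle : ∀ p : V → Prop, (U.filter p).card ≤ Fintype.card V := fun p => Finset.card_le_univ _
  let m : V → ℕ := fun v => (U.filter fun w => l w < r v).card
  let τ : V → Fin (2 * Fintype.card V + 1) := fun v =>
    ⟨m v + (Fintype.card V - (U.filter fun w => r v < r w).card), by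
      have := hle fun w => l w < r v
      simp only [m]
      omega⟩
  have hRlt : ∀ v, ∀ w ∈ U, r v < r w →
      (U.filter fun x => r w < r x).card < (U.filter fun x => r v < r x).card := by
    intro v w hw hvw
    apply Finset.card_lt_card
    rw [Finset.ssubset_iff_of_subset fun x hx => by
      simp only [Finset.mem_filter] at hx ⊢
      exact ⟨hx.1, hvw.trans hx.2⟩]
    exact ⟨w, by simp [hw, hvw], by simp⟩
  have hτ : ∀ v, ∀ w ∈ U, r v < r w → τ v < τ w := by
    intro v w hw hvw
    have h1 := hRlt v w hw hvw
    have h2 : m v ≤ m w := Finset.card_le_card fun x hx => by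
      simp only [Finset.mem_filter] at hx ⊢
      exact ⟨hx.1, hx.2.trans hvw⟩
    have h3 := hle fun x => r v < r x
    rw [Fin.lt_def]
    simp only [τ]
    omega
  have hτiff : ∀ v ∈ U, ∀ w ∈ U, τ v < τ w ↔ r v < r w := by
    intro v hv w hw
    refine ⟨fun h => ?_, hτ v w hw⟩
    by_contra! hle
    rcases hle.lt_or_eq with h1 | h1
    · exact lt_asymm h (hτ w v hv h1)
    · rw [hr w hw v hv h1] at h
      exact lt_irrefl _ h
  have hτinj : Set.InjOn τ U := by
    intro v hv w hw h
    apply hr v hv w hw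
    apply le_antisymm
    · exact not_lt.1 fun h1 => (h ▸ hτ w v hv h1).false
    · exact not_lt.1 fun h1 => (h ▸ hτ v w hw h1).false
  have hcount : ∀ v ∈ U, ((U.image τ).filter fun s => τ v < s).card =
      (U.filter fun w => r v < r w).card := by
    intro v hv
    have : (U.image τ).filter (fun s => τ v < s) = (U.filter fun w => r v < r w).image τ := by
      rw [Finset.filter_image]
      congr 1
      exact Finset.filter_congr fun w hw => hτiff v hv w hw
    rw [this, Finset.card_image_of_injOn]
    exact hτinj.mono fun x hx => (Finset.mem_filter.1 hx).1
  have hm : ∀ u ∈ U, ∀ v, L u < m v ↔ l u < r v := by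
    intro u hu v
    rw [hL u hu]
    constructor
    · intro h
      by_contra! hle
      refine absurd h (not_lt.2 (Finset.card_le_card fun x hx => ?_))
      simp only [Finset.mem_filter] at hx ⊢
      exact ⟨hx.1, hx.2.trans_le hle⟩
    · intro h
      apply Finset.card_lt_card
      rw [Finset.ssubset_iff_of_subset fun x hx => by
        simp only [Finset.mem_filter] at hx ⊢
        exact ⟨hx.1, hx.2.trans h⟩]
      exact ⟨u, by simp [hu, h], by simp⟩
  refine ⟨U.image τ, fun u hu v hv => ?_⟩
  rw [← hm u hu v]
  have hval : ((τ v : Fin _) : ℕ) + R v = m v + Fintype.card V := by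
    have := hle fun w => r v < r w
    rw [hR v hv]
    simp only [τ]
    omega
  constructor
  · rintro ⟨t, ht, hcard, hlt⟩
    obtain ⟨w, hw, rfl⟩ := Finset.mem_image.1 ht
    rw [hcount w hw, hR v hv] at hcard
    have hwv : w = v := by
      apply hr w hw v hv
      rcases lt_trichotomy (r w) (r v) with h | h | h
      · exact absurd hcard (hRlt w v hv h).ne'
      · exact h
      · exact absurd hcard (hRlt v w hw h).ne
    rw [hwv] at hlt
    omega
  · intro h
    exact ⟨τ v, Finset.mem_image_of_mem τ hv, by rw [hcount v hv, hR v hv], by omega⟩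

variable [Nonempty V]

/-- The line following the given one (or, initially, the line at the far right) on the upper
envelope of the lines in `U`, traversed from right to left. -/
def succLine (P : V × V × V × Fin 3 → SignType) : Option V → Finset V → V
  | none, U => Classical.epsilon fun w => w ∈ U ∧
      ∀ v ∈ U, P (v, v, w, 0) = -1 ∨ (P (v, v, w, 0) = 0 ∧ P (v, v, w, 1) ≠ 1)
  | some c, U => Classical.epsilon fun w => (w ∈ U ∧ P (c, w, c, 0) = -1) ∧
      ∀ v ∈ U, P (c, v, c, 0) = -1 → P (c, w, v, 2) ≠ -1

/-- Decode a word of push and pop instructions into the order in which lines get removed from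
the upper envelope of `U`; the list holds the current envelope. -/
def decodeRank (P : V × V × V × Fin 3 → SignType) : List Bool → List V → Finset V → V → ℕ
  | [], _, _, _ => 0
  | true :: bits, s, U, v => decodeRank P bits (succLine P s.head? U :: s) U v
  | false :: _, [], _, _ => 0
  | false :: bits, c :: s, U, v => if v = c then 0 else decodeRank P bits s (U.erase c) v + 1

theorem exists_top_at_infinity (q : V → ℝ × ℝ) (r : V → ℝ) (U : Finset V) (hU : U.Nonempty) :
    succLine (signs q) none U ∈ U ∧ ∃ x, (∀ v ∈ U, r v ≤ x) ∧
      ∀ v ∈ U, height (q v) x ≤ height (q (succLine (signs q) none U)) x := by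
  have hex : ∃ w, w ∈ U ∧ ∀ v ∈ U, signs q (v, v, w, 0) = -1 ∨
      (signs q (v, v, w, 0) = 0 ∧ signs q (v, v, w, 1) ≠ 1) := by
    obtain ⟨w, hw, hmax⟩ := U.exists_max_image (fun v => toLex (q v)) hU
    refine ⟨w, hw, fun v hv => ?_⟩
    simp only [signs, quantity, sign_eq_neg_one_iff, sign_eq_zero_iff, ne_eq, sign_eq_one_iff]
    have := Prod.Lex.toLex_le_toLex.1 (hmax v hv)
    rcases this with h | ⟨h1, h2⟩
    · left
      linarith
    · right
      exact ⟨by linarith, by linarith⟩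
  obtain ⟨hw, hmax⟩ := Classical.epsilon_spec hex
  change succLine (signs q) none U ∈ U at hw
  refine ⟨hw, ?_⟩
  set w := succLine (signs q) none U
  have hmax' : ∀ v ∈ U, signs q (v, v, w, 0) = -1 ∨
      (signs q (v, v, w, 0) = 0 ∧ signs q (v, v, w, 1) ≠ 1) := hmax
  have h1 : ∀ᶠ x : ℝ in Filter.atTop, ∀ v ∈ U, r v ≤ x :=
    (Filter.eventually_all_finset U).2 fun v _ => Filter.eventually_ge_atTop (r v)
  have h2 : ∀ᶠ x : ℝ in Filter.atTop, ∀ v ∈ U, height (q v) x ≤ height (q w) x := by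
    refine (Filter.eventually_all_finset U).2 fun v hv => ?_
    have h3 := hmax' v hv
    simp only [signs, quantity, sign_eq_neg_one_iff, sign_eq_zero_iff, ne_eq, sign_eq_one_iff] at h3
    rcases h3 with h | ⟨h4, h5⟩
    · filter_upwards [Filter.eventually_ge_atTop (((q v).2 - (q w).2) / ((q w).1 - (q v).1))]
        with x hx
      rw [div_le_iff₀ (by linarith)] at hx
      simp only [height]
      linarith
    · refine Filter.Eventually.of_forall fun x => ?_
      have : (q v).1 = (q w).1 := by linarith
      simp only [height, this]
      linarith
  exact (h1.and h2).exists

theorem exists_top_after (q : V → ℝ × ℝ) (r : V → ℝ) (U : Finset V) (c z : V)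
    (hz : z ∈ U) (hzmax : ∀ v ∈ U, r v ≤ r z)
    (hcz : height (q c) (r z) < height (q z) (r z))
    (hc : ∃ x, (∀ v ∈ U, r v ≤ x) ∧ ∀ v ∈ U, height (q v) x ≤ height (q c) x) :
    succLine (signs q) (some c) U ∈ U ∧ (q (succLine (signs q) (some c) U)).1 < (q c).1 ∧
      ∃ x, (∀ v ∈ U, r v ≤ x) ∧
        ∀ v ∈ U, height (q v) x ≤ height (q (succLine (signs q) (some c) U)) x := by
  obtain ⟨x, hrx, hx⟩ := hc
  have hslope : (q z).1 < (q c).1 := by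
    have h1 := hx z hz
    have h2 := hrx z hz
    simp only [height] at *
    nlinarith
  have hex : ∃ w, (w ∈ U ∧ signs q (c, w, c, 0) = -1) ∧
      ∀ v ∈ U, signs q (c, v, c, 0) = -1 → signs q (c, w, v, 2) ≠ -1 := by
    obtain ⟨w, hw, hmax⟩ := (U.filter fun v => (q v).1 < (q c).1).exists_max_image
      (fun v => ((q v).2 - (q c).2) / ((q c).1 - (q v).1)) ⟨z, by simp [hz, hslope]⟩
    rw [Finset.mem_filter] at hw
    simp only [signs, quantity, sign_eq_neg_one_iff, ne_eq]
    refine ⟨w, ⟨hw.1, by linarith [hw.2]⟩, fun v hv hvc => ?_⟩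
    have := hmax v (by simp only [Finset.mem_filter]; exact ⟨hv, by linarith⟩)
    rw [div_le_div_iff₀ (by linarith) (by linarith [hw.2])] at this
    linarith
  obtain ⟨⟨hw, hws⟩, hmax⟩ := Classical.epsilon_spec hex
  change succLine (signs q) (some c) U ∈ U at hw
  change signs q (c, succLine (signs q) (some c) U, c, 0) = -1 at hws
  have hmax' : ∀ v ∈ U, signs q (c, v, c, 0) = -1 →
    signs q (c, succLine (signs q) (some c) U, v, 2) ≠ -1 := hmax
  clear hmax
  set w := succLine (signs q) (some c) U
  simp only [signs, quantity, sign_eq_neg_one_iff, ne_eq] at hws hmax'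
  have hwc : (q w).1 < (q c).1 := by linarith
  refine ⟨hw, hwc, ((q w).2 - (q c).2) / ((q c).1 - (q w).1), ?_, ?_⟩
  · intro v hv
    refine (hzmax v hv).trans ?_
    rw [le_div_iff₀ (by linarith)]
    have h1 := hmax' z hz (by linarith)
    simp only [height] at hcz
    have h2 : r z * ((q c).1 - (q z).1) < (q z).2 - (q c).2 := by linarith
    have h3 := mul_lt_mul_of_pos_right h2 (by linarith : 0 < (q c).1 - (q w).1)
    by_contra! h4
    have h5 := mul_lt_mul_of_pos_right h4 (by linarith : 0 < (q c).1 - (q z).1)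
    nlinarith
  · obtain ⟨X, hX⟩ : ∃ X, X = ((q w).2 - (q c).2) / ((q c).1 - (q w).1) := ⟨_, rfl⟩
    rw [← hX]
    rw [eq_div_iff (by linarith)] at hX
    intro v hv
    have hXw : height (q w) X = height (q c) X := by
      simp only [height]
      linarith
    rw [hXw]
    by_cases hvc : (q v).1 < (q c).1
    · have h1 := hmax' v hv (by linarith)
      rw [← hX] at h1
      simp only [height]
      by_contra! h2
      have h3 : 0 < ((q v).2 - (q c).2) - X * ((q c).1 - (q v).1) := by linarith
      have h4 := mul_pos h3 (by linarith : 0 < (q c).1 - (q w).1)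
      nlinarith
    · push Not at hvc
      have h1 := hx v hv
      have h2 := hx w hw
      simp only [height] at *
      have h3 : X ≤ x := by
        by_contra! h4
        nlinarith
      nlinarith

/-- If every line `w` of `U` lies strictly above all lines `v` with `r v ≤ r w` at abscissa `r w`,
then the order of the `r v` can be decoded from a short word. -/
theorem exists_decodeRank_eq (q : V → ℝ × ℝ) (r : V → ℝ) (k : ℕ) :
    ∀ (s : List V) (U : Finset V), 2 * U.card ≤ k + s.length →
      (∀ v ∈ U, ∀ w ∈ U, v ≠ w → r v ≤ r w → height (q v) (r w) < height (q w) (r w)) →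
      s.Pairwise (fun c d => (q c).1 < (q d).1) → (∀ c ∈ s, c ∈ U) →
      (∀ c ∈ s, ∃ x, (∀ v ∈ U, r v ≤ x) ∧ ∀ v ∈ U, height (q v) x ≤ height (q c) x) →
      ∃ bits : List Bool, bits.length = k ∧
        ∀ v ∈ U, decodeRank (signs q) bits s U v = (U.filter fun w => r v < r w).card := by
  induction k with
  | zero =>
    intro s U hcard _ hs hsU _
    have hnd : s.Nodup := hs.imp fun h h' => by rw [h'] at h; exact lt_irrefl _ h
    have h1 : s.length ≤ U.card := by
      rw [← List.toFinset_card_of_nodup hnd]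
      exact Finset.card_le_card fun c hc => hsU c (List.mem_toFinset.1 hc)
    have h2 : U = ∅ := Finset.card_eq_zero.1 (by omega)
    exact ⟨[], rfl, by simp [h2]⟩
  | succ k ih =>
    intro s U hcard hr hs hsU hinv
    rcases U.eq_empty_or_nonempty with rfl | hU
    · exact ⟨List.replicate (k + 1) true, by simp, by simp⟩
    obtain ⟨z, hz, hzmax⟩ := U.exists_max_image r hU
    by_cases htop : s.head? = some z
    · obtain ⟨s', rfl⟩ : ∃ s', s = z :: s' := by
        cases s with
        | nil => simp at htop
        | cons a s' => exact ⟨s', by simpa using htop⟩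
      have hs' := List.pairwise_cons.1 hs
      have hzs : z ∉ s' := fun h => lt_irrefl _ (hs'.1 z h)
      obtain ⟨bits, hlen, hbits⟩ := ih s' (U.erase z)
        (by rw [Finset.card_erase_of_mem hz]; simp only [List.length_cons] at hcard; omega)
        (fun v hv w hw => hr v (Finset.mem_of_mem_erase hv) w (Finset.mem_of_mem_erase hw))
        hs'.2
        (fun c hc => Finset.mem_erase.2
          ⟨fun h => hzs (h ▸ hc), hsU c (List.mem_cons_of_mem _ hc)⟩)
        (fun c hc => by
          obtain ⟨x, h1, h2⟩ := hinv c (List.mem_cons_of_mem _ hc)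
          exact ⟨x, fun v hv => h1 v (Finset.mem_of_mem_erase hv),
            fun v hv => h2 v (Finset.mem_of_mem_erase hv)⟩)
      refine ⟨false :: bits, by simp [hlen], fun v hv => ?_⟩
      simp only [decodeRank]
      split_ifs with hvz
      · subst hvz
        symm
        rw [Finset.card_eq_zero, Finset.filter_eq_empty_iff]
        exact fun w hw => not_lt.2 (hzmax w hw)
      · rw [hbits v (Finset.mem_erase.2 ⟨hvz, hv⟩), Finset.filter_erase,
          Finset.card_erase_add_one]
        have hlt : r v < r z := by
          refine lt_of_le_of_ne (hzmax v hv) fun heq => ?_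
          have h1 := hr v hv z hz hvz heq.le
          have h2 := hr z hz v hv (Ne.symm hvz) heq.ge
          rw [heq] at h2
          exact lt_asymm h1 h2
        simp [hz, hlt]
    · obtain ⟨hwU, hwx, hws⟩ : succLine (signs q) s.head? U ∈ U ∧
          (∃ x, (∀ v ∈ U, r v ≤ x) ∧
            ∀ v ∈ U, height (q v) x ≤ height (q (succLine (signs q) s.head? U)) x) ∧
          ∀ c ∈ s, (q (succLine (signs q) s.head? U)).1 < (q c).1 := by
        cases s with
        | nil =>
          obtain ⟨h1, h2⟩ := exists_top_at_infinity q r U hU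
          exact ⟨h1, h2, by simp⟩
        | cons c s' =>
          have hcz : c ≠ z := by simpa using htop
          have hcU : c ∈ U := hsU c List.mem_cons_self
          obtain ⟨h1, h2, h3⟩ := exists_top_after q r U c z hz hzmax
            (hr c hcU z hz hcz (hzmax c hcU)) (hinv c List.mem_cons_self)
          refine ⟨h1, h3, fun d hd => ?_⟩
          rcases List.mem_cons.1 hd with rfl | hd
          · exact h2
          · exact h2.trans ((List.pairwise_cons.1 hs).1 d hd)
      obtain ⟨bits, hlen, hbits⟩ := ih (succLine (signs q) s.head? U :: s) U
        (by simp only [List.length_cons]; omega) hr (List.pairwise_cons.2 ⟨hws, hs⟩)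
        (by
          intro c hc
          rcases List.mem_cons.1 hc with rfl | hc
          · exact hwU
          · exact hsU c hc)
        (by
          intro c hc
          rcases List.mem_cons.1 hc with rfl | hc
          · exact hwx
          · exact hinv c hc)
      exact ⟨true :: bits, by simp [hlen], fun v hv => by simpa only [decodeRank] using hbits v hv⟩

/-- The words encoding the pairwise intersections of the intervals on which the lines of an
arrangement lie above a convex function. -/
abbrev IntervalCode (V : Type*) [Fintype V] : Type _ :=
  Finset V × List.Vector Bool (2 * Fintype.card V) × List.Vector Bool (2 * Fintype.card V) ×
    Finset (Fin (2 * Fintype.card V + 1))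

/-- Decode the intersection relation of the intervals on which the lines of an arrangement lie
above a convex function; `P` are the signs of the arrangement. -/
def decodeInter [Fintype V] (P : V × V × V × Fin 3 → SignType) (κ : IntervalCode V) (u v : V) :
    Prop :=
  let R := decodeRank P κ.2.1.toList [] κ.1
  let L := decodeRank (twist (-1) 1 P) κ.2.2.1.toList [] κ.1
  (u ∈ κ.1 ∧ v ∈ κ.1) ∧ decodeLt (Fintype.card V) R L κ.2.2.2 u v ∧
    decodeLt (Fintype.card V) R L κ.2.2.2 v u

theorem sSup_pos_set {f : ℝ → ℝ} (hf : Continuous f) (hne : ∃ x, 0 < f x)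
    (hb : BddAbove {x | 0 < f x}) :
    f (sSup {x | 0 < f x}) = 0 ∧ ∀ x, sSup {x | 0 < f x} ≤ x → f x ≤ 0 := by
  have hgt : ∀ x ∈ Set.Ioi (sSup {x | 0 < f x}), f x ≤ 0 := fun x hx =>
    not_lt.1 fun h => (not_lt.2 (le_csSup hb h)) hx
  have hclosed : IsClosed {x | f x ≤ 0} := isClosed_le hf continuous_const
  have hge : ∀ x, sSup {x | 0 < f x} ≤ x → f x ≤ 0 := by
    intro x hx
    have : x ∈ closure (Set.Ioi (sSup {x | 0 < f x})) := by
      rw [closure_Ioi]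
      exact hx
    exact closure_minimal hgt hclosed this
  refine ⟨le_antisymm (hge _ le_rfl) ?_, hge⟩
  have hmem := csSup_mem_closure hne hb
  have hclosed' : IsClosed {x | 0 ≤ f x} := isClosed_le continuous_const hf
  exact closure_minimal (fun x (hx : 0 < f x) => hx.le) hclosed' hmem

theorem continuous_height (p : ℝ × ℝ) : Continuous (height p) := by
  unfold height
  fun_prop

theorem exists_decodeInter_iff_of_generic [Fintype V] (q : V → ℝ × ℝ) (H : ℝ → ℝ)
    (hH : Continuous H)
    (hconv : ∀ v x y z, x ≤ y → y ≤ z → H x < height (q v) x → H z < height (q v) z →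
      H y < height (q v) y)
    (hbdd : ∀ v, BddAbove {x | 0 < height (q v) x - H x})
    (hbdd' : ∀ v, BddAbove {x | 0 < height (q v) (-x) - H (-x)})
    (hgen : ∀ u v x, height (q u) x = H x → height (q v) x = H x → u = v) :
    ∃ κ : IntervalCode V, ∀ u v, decodeInter (signs q) κ u v ↔
      ∃ x, H x < height (q u) x ∧ H x < height (q v) x := by
  let U : Finset V := Finset.univ.filter fun v => ∃ x, 0 < height (q v) x - H x
  let r : V → ℝ := fun v => sSup {x | 0 < height (q v) x - H x}
  let r' : V → ℝ := fun v => sSup {x | 0 < height (q v) (-x) - H (-x)}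
  have hU : ∀ v, v ∈ U ↔ ∃ x, 0 < height (q v) x - H x := by simp [U]
  have hU' : ∀ v ∈ U, ∃ x, 0 < height (q v) (-x) - H (-x) := by
    intro v hv
    obtain ⟨x, hx⟩ := (hU v).1 hv
    exact ⟨-x, by simpa using hx⟩
  have hrv : ∀ v ∈ U, height (q v) (r v) - H (r v) = 0 ∧
      ∀ x, r v ≤ x → height (q v) x - H x ≤ 0 := fun v hv =>
    sSup_pos_set ((continuous_height (q v)).sub hH) ((hU v).1 hv) (hbdd v)
  have hrv' : ∀ v ∈ U, height (q v) (-r' v) - H (-r' v) = 0 ∧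
      ∀ x, r' v ≤ x → height (q v) (-x) - H (-x) ≤ 0 := fun v hv =>
    sSup_pos_set (f := fun x => height (q v) (-x) - H (-x))
      (((continuous_height (q v)).comp continuous_neg).sub (hH.comp continuous_neg))
      (hU' v hv) (hbdd' v)
  have hmirror : ∀ v x, height (-1 * (q v).1, 1 * (q v).2) x = height (q v) (-x) := by
    intro v x
    simp only [height]
    ring
  obtain ⟨bits, hlen, hbits⟩ := exists_decodeRank_eq q r (2 * Fintype.card V) [] U
    (by simpa using Finset.card_le_univ U)
    (by
      intro v hv w hw hne hle
      have h1 := (hrv v hv).2 (r w) hle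
      have h2 := (hrv w hw).1
      refine lt_of_le_of_ne (by linarith) fun h3 => hne (hgen v w (r w) ?_ ?_) <;> linarith)
    List.Pairwise.nil (by simp) (by simp)
  obtain ⟨bits', hlen', hbits'⟩ := exists_decodeRank_eq
    (fun v => (-1 * (q v).1, 1 * (q v).2)) r' (2 * Fintype.card V) [] U
    (by simpa using Finset.card_le_univ U)
    (by
      intro v hv w hw hne hle
      have h1 := (hrv' v hv).2 (r' w) hle
      have h2 := (hrv' w hw).1
      rw [hmirror, hmirror]
      refine lt_of_le_of_ne (by linarith) fun h3 => hne (hgen v w (-r' w) ?_ ?_) <;> linarith)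
    List.Pairwise.nil (by simp) (by simp)
  rw [signs_smul, sign_neg (by norm_num : (-1 : ℝ) < 0), sign_one] at hbits'
  obtain ⟨T, hT⟩ := exists_decodeLt_iff U (fun v => -r' v) r
    (fun v hv w hw h => hgen v w (r v) (by linarith [(hrv v hv).1])
      (by rw [h]; linarith [(hrv w hw).1]))
    (decodeRank (signs q) bits [] U) (decodeRank (twist (-1) 1 (signs q)) bits' [] U) hbits
    (by
      intro u hu
      rw [hbits' u hu]
      simp only [neg_lt_neg_iff])
  refine ⟨(U, ⟨bits, hlen⟩, ⟨bits', hlen'⟩, T), fun u v => ?_⟩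
  simp only [decodeInter, List.Vector.toList_mk]
  have hlr : ∀ v ∈ U, ∀ x, H x < height (q v) x → -r' v < x ∧ x < r v := by
    intro v hv x hx
    constructor
    · by_contra! h
      have := (hrv' v hv).2 (-x) (by linarith)
      rw [neg_neg] at this
      linarith
    · by_contra! h
      have := (hrv v hv).2 x h
      linarith
  have hmem : ∀ v ∈ U, ∀ x, -r' v < x → x < r v → H x < height (q v) x := by
    intro v hv x h1 h2
    obtain ⟨z, hz, hxz⟩ := exists_lt_of_lt_csSup ((hU v).1 hv) h2
    obtain ⟨y, hy, hxy⟩ := exists_lt_of_lt_csSup (hU' v hv) (neg_lt.1 h1)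
    have hz' : 0 < height (q v) z - H z := hz
    have hy' : 0 < height (q v) (-y) - H (-y) := hy
    exact hconv v (-y) x z (by linarith) hxz.le (by linarith) (by linarith)
  constructor
  · rintro ⟨⟨hu, hv⟩, huv, hvu⟩
    rw [hT u hu v hv] at huv
    rw [hT v hv u hu] at hvu
    have hself : ∀ w ∈ U, -r' w < r w := by
      intro w hw
      obtain ⟨x, hx⟩ := (hU w).1 hw
      obtain ⟨h1, h2⟩ := hlr w hw x (by linarith)
      exact h1.trans h2
    obtain ⟨x, hx1, hx2⟩ := exists_between
      (max_lt (lt_min (hself u hu) huv) (lt_min hvu (hself v hv)))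
    rw [max_lt_iff] at hx1
    rw [lt_min_iff] at hx2
    exact ⟨x, hmem u hu x hx1.1 hx2.1, hmem v hv x hx1.2 hx2.2⟩
  · rintro ⟨x, hxu, hxv⟩
    have hu : u ∈ U := (hU u).2 ⟨x, by linarith⟩
    have hv : v ∈ U := (hU v).2 ⟨x, by linarith⟩
    refine ⟨⟨hu, hv⟩, ?_, ?_⟩
    · rw [hT u hu v hv]
      exact (hlr u hu x hxu).1.trans (hlr v hv x hxv).2
    · rw [hT v hv u hu]
      exact (hlr v hv x hxv).1.trans (hlr u hu x hxu).2

theorem bddAbove_parabola_lt (ε A B : ℝ) (hε : 0 < ε) :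
    BddAbove {x : ℝ | ε * (1 + x ^ 2) < A * x + B} := by
  refine ⟨max 1 ((|A| + |B|) / ε), fun x hx => ?_⟩
  by_contra! h
  rw [max_lt_iff, div_lt_iff₀ hε] at h
  simp only [Set.mem_ofPred_eq] at hx
  have h1 := le_abs_self A
  have h2 := le_abs_self B
  have h3 : A * x ≤ |A| * x := mul_le_mul_of_nonneg_right h1 (by linarith)
  have h4 : |B| ≤ |B| * x := le_mul_of_one_le_right (abs_nonneg B) h.1.le
  nlinarith

/-- For an arrangement of distinct lines with given signs, the relation that two lines lie
simultaneously above the upper envelope of a finite set of lines is determined by a short word. -/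
theorem exists_decodeInter_iff [Fintype V] (q : V → ℝ × ℝ) (hq : Function.Injective q)
    (F : Finset (ℝ × ℝ)) (hF : F.Nonempty) :
    ∃ κ : IntervalCode V, ∀ u v, decodeInter (signs q) κ u v ↔
      ∃ x, ∀ o ∈ F, height o x < height (q u) x ∧ height o x < height (q v) x := by
  let E : ℝ → ℝ := fun x => F.sup' hF fun o => height o x
  have hE : Continuous E := Continuous.finset_sup'_apply hF fun o _ => continuous_height o
  have hElt : ∀ x a, E x < a ↔ ∀ o ∈ F, height o x < a := fun x a => Finset.sup'_lt_iff hF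
  obtain ⟨ε, hε, hwit, hgen⟩ : ∃ ε : ℝ, 0 < ε ∧
      (∀ u v, (∃ x, E x < height (q u) x ∧ E x < height (q v) x) →
        ∃ x, E x + ε * (1 + x ^ 2) < height (q u) x ∧ E x + ε * (1 + x ^ 2) < height (q v) x) ∧
      ∀ u v, ¬ (u ≠ v ∧ ∃ x, height (q u) x = E x + ε * (1 + x ^ 2) ∧
        height (q v) x = E x + ε * (1 + x ^ 2)) := by
    have h1 : ∀ᶠ ε in nhdsWithin (0 : ℝ) (Set.Ioi 0), ∀ u v,
        (∃ x, E x < height (q u) x ∧ E x < height (q v) x) →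
        ∃ x, E x + ε * (1 + x ^ 2) < height (q u) x ∧
          E x + ε * (1 + x ^ 2) < height (q v) x := by
      refine Filter.eventually_all.2 fun u => Filter.eventually_all.2 fun v => ?_
      by_cases hx : ∃ x, E x < height (q u) x ∧ E x < height (q v) x
      · obtain ⟨x, hxu, hxv⟩ := hx
        have h2 : Filter.Tendsto (fun ε : ℝ => E x + ε * (1 + x ^ 2)) (nhdsWithin 0 (Set.Ioi 0))
            (nhds (E x + 0 * (1 + x ^ 2))) :=
          (Continuous.tendsto (by fun_prop) 0).mono_left nhdsWithin_le_nhds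
        rw [zero_mul, add_zero] at h2
        filter_upwards [h2.eventually_lt_const hxu, h2.eventually_lt_const hxv] with ε h3 h4 _
        exact ⟨x, h3, h4⟩
      · exact Filter.Eventually.of_forall fun ε h => absurd h hx
    have h2 : ∀ᶠ ε in nhdsWithin (0 : ℝ) (Set.Ioi 0), ∀ u v,
        ¬ (u ≠ v ∧ ∃ x, height (q u) x = E x + ε * (1 + x ^ 2) ∧
          height (q v) x = E x + ε * (1 + x ^ 2)) := by
      refine Filter.eventually_all.2 fun u => Filter.eventually_all.2 fun v => ?_
      by_cases hbad : ∃ ε₀ : ℝ, 0 < ε₀ ∧ u ≠ v ∧ ∃ x, height (q u) x = E x + ε₀ * (1 + x ^ 2) ∧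
          height (q v) x = E x + ε₀ * (1 + x ^ 2)
      · obtain ⟨ε₀, h0, hne, x₀, hu₀, hv₀⟩ := hbad
        filter_upwards [Ioo_mem_nhdsGT h0] with ε hε
        rintro ⟨-, x, hu, hv⟩
        have hx : x = x₀ := by
          have h3 : ((q u).1 - (q v).1) * (x - x₀) = 0 := by
            simp only [height] at *
            linarith
          rcases mul_eq_zero.1 h3 with h4 | h4
          · refine absurd (hq (Prod.ext (by linarith) ?_)) hne
            have h5 : (q u).1 = (q v).1 := by linarith
            simp only [height, h5] at *
            linarith
          · linarith
        subst hx
        have h6 : (ε₀ - ε) * (1 + x ^ 2) = 0 := by linarith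
        rcases mul_eq_zero.1 h6 with h7 | h7
        · linarith [hε.2]
        · nlinarith
      · filter_upwards [self_mem_nhdsWithin] with ε hε h3
        exact hbad ⟨ε, hε, h3⟩
    obtain ⟨ε, ⟨h3, h4⟩, h5⟩ := ((h1.and h2).and self_mem_nhdsWithin).exists
    exact ⟨ε, h5, h3, h4⟩
  obtain ⟨o, ho⟩ := hF
  have hsub : ∀ v x, E x + ε * (1 + x ^ 2) < height (q v) x →
      ε * (1 + x ^ 2) < ((q v).1 - o.1) * x + ((q v).2 - o.2) := by
    intro v x hx
    have : height o x ≤ E x := Finset.le_sup' (fun o => height o x) ho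
    simp only [height] at *
    linarith
  obtain ⟨κ, hκ⟩ := exists_decodeInter_iff_of_generic q (fun x => E x + ε * (1 + x ^ 2))
    (by fun_prop)
    (by
      intro v x y z hxy hyz hx hz
      have hlt : ∀ x, E x + ε * (1 + x ^ 2) < height (q v) x ↔
          ∀ o ∈ F, height o x < height (q v) x - ε * (1 + x ^ 2) := fun x => by
        rw [← hElt, lt_sub_iff_add_lt]
      simp only [hlt] at hx hz ⊢
      intro o ho
      have h1 := hx o ho
      have h2 := hz o ho
      rcases hxy.eq_or_lt with rfl | hxy
      · exact h1
      simp only [height] at *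
      have h3 := mul_nonneg (sub_nonneg.2 hyz)
        (sub_pos.2 h1).le
      have h4 := mul_pos (sub_pos.2 hxy) (sub_pos.2 h2)
      have h5 : 0 ≤ ε * ((z - x) * ((y - x) * (z - y))) :=
        mul_nonneg hε.le (mul_nonneg (by linarith) (mul_nonneg (by linarith) (by linarith)))
      by_contra! h6
      have h7 := mul_nonneg (by linarith : 0 ≤ z - x) (sub_nonneg.2 h6)
      nlinarith)
    (fun v => (bddAbove_parabola_lt ε ((q v).1 - o.1) ((q v).2 - o.2) hε).mono fun x hx => by
      simp only [Set.mem_ofPred_eq] at hx ⊢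
      exact hsub v x (by linarith))
    (fun v => (bddAbove_parabola_lt ε (-((q v).1 - o.1)) ((q v).2 - o.2) hε).mono fun x hx => by
      simp only [Set.mem_ofPred_eq] at hx ⊢
      have := hsub v (-x) (by linarith)
      linarith)
    (fun u v x hu hv => by_contra fun hne => hgen u v ⟨hne, x, hu, hv⟩)
  refine ⟨κ, fun u v => ?_⟩
  rw [hκ]
  have hpos : ∀ x : ℝ, 0 < ε * (1 + x ^ 2) := fun x => by positivity
  constructor
  · rintro ⟨x, hu, hv⟩
    exact ⟨x, fun o ho => ⟨(hElt x _).1 (by linarith [hpos x]) o ho,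
      (hElt x _).1 (by linarith [hpos x]) o ho⟩⟩
  · rintro ⟨x, hx⟩
    exact hwit u v ⟨x, (hElt x _).2 fun o ho => (hx o ho).1, (hElt x _).2 fun o ho => (hx o ho).2⟩

/-- The reflection of the plane in the first coordinate axis. -/
def reflect (p : ℝ × ℝ) : ℝ × ℝ := (p.1, -p.2)

theorem disjoint_segment_convexHull_of_lt {F : Finset (ℝ × ℝ)} {a b : ℝ} {p p' : ℝ × ℝ}
    (h : ∀ o ∈ F, a * o.1 + b * o.2 < a * p.1 + b * p.2 ∧ a * o.1 + b * o.2 < a * p'.1 + b * p'.2) :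
    Disjoint (segment ℝ p p') (convexHull ℝ (F : Set (ℝ × ℝ))) := by
  have hlin : IsLinearMap ℝ fun z : ℝ × ℝ => a * z.1 + b * z.2 :=
    ⟨fun x y => by simp only [Prod.fst_add, Prod.snd_add]; ring,
      fun c x => by simp only [Prod.smul_fst, Prod.smul_snd, smul_eq_mul]; ring⟩
  set m := min (a * p.1 + b * p.2) (a * p'.1 + b * p'.2) with hm
  have h1 : convexHull ℝ (F : Set (ℝ × ℝ)) ⊆ {z | a * z.1 + b * z.2 < m} :=
    convexHull_min (fun o ho => lt_min (h o ho).1 (h o ho).2) (convex_halfSpace_lt hlin m)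
  have h2 : segment ℝ p p' ⊆ {z | m ≤ a * z.1 + b * z.2} :=
    (convex_halfSpace_ge hlin m).segment_subset (min_le_left (a * p.1 + b * p.2) _)
      (min_le_right _ (a * p'.1 + b * p'.2))
  refine Set.disjoint_left.2 fun z hz hz' => ?_
  have h3 : a * z.1 + b * z.2 < m := h1 hz'
  have h4 : m ≤ a * z.1 + b * z.2 := h2 hz
  linarith

/-- A segment misses a convex polygon iff it lies strictly above or strictly below it with respect
to some direction; in the dual plane, both dual lines of the endpoints lie above the upper envelope
or below the lower envelope of the dual lines of the polygon at some abscissa. -/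
theorem disjoint_segment_convexHull_iff (F : Finset (ℝ × ℝ)) (p p' : ℝ × ℝ) :
    Disjoint (segment ℝ p p') (convexHull ℝ (F : Set (ℝ × ℝ))) ↔
      (∃ x, ∀ o ∈ F, height o x < height p x ∧ height o x < height p' x) ∨
      ∃ x, ∀ o ∈ F.image reflect, height o x < height (reflect p) x ∧
        height o x < height (reflect p') x := by
  simp only [Finset.forall_mem_image, height, reflect]
  constructor
  · intro h
    have hclosed : IsClosed (segment ℝ p p') := by
      rw [← convexHull_pair]
      exact (Set.toFinite {p, p'}).isClosed_convexHull ℝ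
    obtain ⟨f, s, t, hs, hst, ht⟩ := geometric_hahn_banach_compact_closed
      (convex_convexHull ℝ (F : Set (ℝ × ℝ))) (F.finite_toSet.isCompact_convexHull ℝ)
      (convex_segment p p') hclosed h.symm
    have hf : ∀ z, f z = f (1, 0) * z.1 + f (0, 1) * z.2 := fun z => by
      conv_lhs => rw [show z = z.1 • ((1 : ℝ), (0 : ℝ)) + z.2 • ((0 : ℝ), (1 : ℝ)) by ext <;> simp]
      rw [map_add, map_smul, map_smul, smul_eq_mul, smul_eq_mul]
      ring
    set a := f (1, 0)
    have hlt : ∀ o ∈ F, ∀ z ∈ ({p, p'} : Set (ℝ × ℝ)),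
        a * o.1 + f (0, 1) * o.2 < a * z.1 + f (0, 1) * z.2 := by
      intro o ho z hz
      have h1 := hs o (subset_convexHull ℝ _ ho)
      have h2 : t < f z := by
        rcases hz with rfl | rfl
        · exact ht _ (left_mem_segment ℝ _ _)
        · exact ht _ (right_mem_segment ℝ _ _)
      rw [hf] at h1 h2
      linarith
    have hev : ∀ᶠ b in nhdsWithin (f (0, 1)) {f (0, 1)}ᶜ, ∀ o ∈ F,
        a * o.1 + b * o.2 < a * p.1 + b * p.2 ∧ a * o.1 + b * o.2 < a * p'.1 + b * p'.2 := by
      refine Filter.Eventually.filter_mono nhdsWithin_le_nhds ?_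
      refine (Filter.eventually_all_finset F).2 fun o ho => ?_
      refine ((ContinuousAt.eventually_lt (by fun_prop) (by fun_prop) (hlt o ho p (by simp))).and
        (ContinuousAt.eventually_lt (by fun_prop) (by fun_prop) (hlt o ho p' (by simp))))
    have hne : ∀ᶠ b in nhdsWithin (f (0, 1)) {f (0, 1)}ᶜ, b ≠ 0 := by
      by_cases h0 : f (0, 1) = 0
      · rw [h0]
        exact eventually_mem_nhdsWithin
      · exact Filter.Eventually.filter_mono nhdsWithin_le_nhds (isOpen_ne.mem_nhds h0)
    obtain ⟨b, hb, hb0⟩ := (hev.and hne).exists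
    rcases lt_or_gt_of_ne hb0 with hneg | hpos
    · right
      refine ⟨a / -b, fun o ho => ?_⟩
      have key : ∀ z : ℝ × ℝ, z.1 * (a / -b) + -z.2 = (a * z.1 + b * z.2) / -b := by
        intro z
        field_simp
        ring
      rw [key, key, key]
      exact ⟨div_lt_div_of_pos_right (hb o ho).1 (by linarith),
        div_lt_div_of_pos_right (hb o ho).2 (by linarith)⟩
    · left
      refine ⟨a / b, fun o ho => ?_⟩
      have key : ∀ z : ℝ × ℝ, z.1 * (a / b) + z.2 = (a * z.1 + b * z.2) / b := by
        intro z
        field_simp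
      rw [key, key, key]
      exact ⟨div_lt_div_of_pos_right (hb o ho).1 hpos, div_lt_div_of_pos_right (hb o ho).2 hpos⟩
  · rintro (⟨x, hx⟩ | ⟨x, hx⟩)
    · refine disjoint_segment_convexHull_of_lt (a := x) (b := 1) fun o ho => ?_
      obtain ⟨h1, h2⟩ := hx o ho
      constructor <;> linarith
    · refine disjoint_segment_convexHull_of_lt (a := x) (b := -1) fun o ho => ?_
      obtain ⟨h1, h2⟩ := hx ho
      constructor <;> linarith

/-- The sign data of the dual line arrangement, together with a short word for each of the two
sides, determines which segments between the given points miss a given convex polygon. -/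
theorem exists_decodeInter_iff_disjoint [Fintype V] (q : V → ℝ × ℝ) (hq : Function.Injective q)
    (F : Finset (ℝ × ℝ)) (hF : F.Nonempty) :
    ∃ κ : IntervalCode V × IntervalCode V, ∀ u v,
      (decodeInter (signs q) κ.1 u v ∨ decodeInter (twist 1 (-1) (signs q)) κ.2 u v) ↔
        Disjoint (segment ℝ (q u) (q v)) (convexHull ℝ (F : Set (ℝ × ℝ))) := by
  obtain ⟨κ, hκ⟩ := exists_decodeInter_iff q hq F hF
  have hinj : Function.Injective reflect := fun p p' h => by
    simp only [reflect, Prod.mk.injEq] at h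
    ext <;> linarith
  obtain ⟨κ₂, hκ₂⟩ := exists_decodeInter_iff (fun v => reflect (q v)) (hinj.comp hq)
    (F.image reflect) (hF.image _)
  have htwist : signs (fun v => reflect (q v)) = twist 1 (-1) (signs q) := by
    have := signs_smul q 1 (-1)
    simpa only [reflect, sign_one, sign_neg neg_one_lt_zero, one_mul, neg_one_mul] using this
  rw [htwist] at hκ₂
  refine ⟨(κ, κ₂), fun u v => ?_⟩
  rw [disjoint_segment_convexHull_iff, hκ, hκ₂]

theorem card_intervalCode (V : Type*) [Fintype V] :
    Fintype.card (IntervalCode V) = 2 ^ (7 * Fintype.card V + 1) := by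
  simp only [IntervalCode, Fintype.card_prod, Fintype.card_finset, card_vector, Fintype.card_bool,
    Fintype.card_fin, ← pow_add]
  congr 1
  ring

open MvPolynomial in
/-- The number of possible sign data of arrangements of lines indexed by `V`. -/
theorem ncard_range_signs_le (V : Type*) [Fintype V] :
    (Set.range (signs : (V → ℝ × ℝ) → V × V × V × Fin 3 → SignType)).ncard ≤
      (2 * Fintype.card V * (12 * Fintype.card V ^ 3 + 2) + 1) ^ (2 * Fintype.card V) := by
  let f : V × V × V × Fin 3 → MvPolynomial (V × Bool) ℝ
    | (_, w, v, 0) => X (w, false) - X (v, false)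
    | (_, w, v, 1) => X (w, true) - X (v, true)
    | (c, w, v, 2) =>
      (X (w, true) - X (c, true)) * (X (c, false) - X (v, false)) -
        (X (v, true) - X (c, true)) * (X (c, false) - X (w, false))
  have hdeg : ∀ i j : V × Bool, (X i - X j : MvPolynomial (V × Bool) ℝ).totalDegree ≤ 1 :=
    fun i j => (totalDegree_sub _ _).trans (by simp)
  have hf : ∀ j, (f j).totalDegree ≤ 2 := by
    rintro ⟨c, w, v, i⟩
    fin_cases i
    · exact (hdeg _ _).trans one_le_two
    · exact (hdeg _ _).trans one_le_two
    · refine (totalDegree_sub _ _).trans (max_le ?_ ?_) <;>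
        exact (totalDegree_mul _ _).trans (add_le_add (hdeg _ _) (hdeg _ _))
  have hsub : Set.range (signs : (V → ℝ × ℝ) → V × V × V × Fin 3 → SignType) ⊆
      Set.range fun (x : V × Bool → ℝ) (j : V × V × V × Fin 3) =>
        SignType.sign (eval x (f j)) := by
    rintro _ ⟨q, rfl⟩
    refine ⟨fun y => if y.2 then (q y.1).2 else (q y.1).1, ?_⟩
    funext ⟨c, w, v, i⟩
    fin_cases i <;> simp [f, signs, quantity]
  refine (Set.ncard_le_ncard hsub (Set.toFinite _)).trans ((card_sign_patterns_le f 2 hf).trans ?_)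
  simp only [Fintype.card_prod, Fintype.card_fin, Fintype.card_bool]
  refine le_of_eq ?_
  rw [mul_comm (Fintype.card V) 2]
  congr 3
  ring

/-- The graph encoded by the sign data `P` of a point set and the codes of its first `k` convex
obstacles. -/
def decodeGraph [Fintype V] {h : ℕ} (P : V × V × V × Fin 3 → SignType) (k : Fin (h + 1))
    (κ : Fin h → IntervalCode V × IntervalCode V) : SimpleGraph V :=
  SimpleGraph.fromRel fun u v => ∀ i : Fin h, (i : ℕ) < k →
    decodeInter P (κ i).1 u v ∨ decodeInter (twist 1 (-1) P) (κ i).2 u v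

theorem exists_decodeGraph_eq [Fintype V] {G : SimpleGraph V} (R : ConvexObstacleRep G) {h : ℕ}
    (hR : R.numObs ≤ h) :
    ∃ (k : Fin (h + 1)) (κ : Fin h → IntervalCode V × IntervalCode V),
      decodeGraph (signs R.pos) k κ = G := by
  have hcode : ∀ i, ∃ κ : IntervalCode V × IntervalCode V, ∀ u v,
      (decodeInter (signs R.pos) κ.1 u v ∨ decodeInter (twist 1 (-1) (signs R.pos)) κ.2 u v) ↔
        Disjoint (segment ℝ (R.pos u) (R.pos v)) (R.obs i) := by
    intro i
    obtain ⟨F, hF, -, hobs⟩ := R.convexPoly i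
    rw [hobs]
    exact exists_decodeInter_iff_disjoint R.pos R.posInj F (Finset.card_pos.1 (by omega))
  choose κ hκ using hcode
  refine ⟨⟨R.numObs, by omega⟩, fun i => if hi : (i : ℕ) < R.numObs then κ ⟨i, hi⟩ else default, ?_⟩
  have hadj : ∀ u v, u ≠ v →
      (G.Adj u v ↔ ∀ i, Disjoint (segment ℝ (R.pos u) (R.pos v)) (R.obs i)) := by
    refine fun u v huv => ⟨R.edges_clear u v, fun hd => ?_⟩
    by_contra hG
    obtain ⟨i, hi⟩ := R.nonedges_blocked u v huv hG
    exact Set.not_disjoint_iff_nonempty_inter.2 hi (hd i)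
  have hrel : ∀ u v, (∀ i : Fin h, (i : ℕ) < R.numObs →
      decodeInter (signs R.pos)
        (if hi : (i : ℕ) < R.numObs then κ ⟨i, hi⟩ else default).1 u v ∨
      decodeInter (twist 1 (-1) (signs R.pos))
        (if hi : (i : ℕ) < R.numObs then κ ⟨i, hi⟩ else default).2 u v) ↔
      ∀ i, Disjoint (segment ℝ (R.pos u) (R.pos v)) (R.obs i) := by
    intro u v
    constructor
    · intro hd i
      have := hd ⟨i, i.2.trans_le hR⟩ i.2
      simp only [i.2, dif_pos] at this
      exact (hκ i u v).1 this
    · intro hd i hi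
      simp only [hi, dif_pos]
      exact (hκ ⟨i, hi⟩ u v).2 (hd _)
  ext u v
  simp only [decodeGraph, SimpleGraph.fromRel_adj, hrel]
  constructor
  · rintro ⟨huv, hd | hd⟩
    · exact (hadj u v huv).2 hd
    · exact ((hadj v u huv.symm).2 hd).symm
  · exact fun hG => ⟨hG.ne, Or.inl ((hadj u v hG.ne).1 hG)⟩

theorem card_convexObstacleGraphs_le (V : Type*) [Fintype V] [Nonempty V] (h : ℕ) :
    Nat.card {G : SimpleGraph V // ∃ R : ConvexObstacleRep G, R.numObs ≤ h} ≤
      (2 * Fintype.card V * (12 * Fintype.card V ^ 3 + 2) + 1) ^ (2 * Fintype.card V) *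
        ((h + 1) * (2 ^ (7 * Fintype.card V + 1) * 2 ^ (7 * Fintype.card V + 1)) ^ h) := by
  let D : Set.range (signs : (V → ℝ × ℝ) → V × V × V × Fin 3 → SignType) ×
      Fin (h + 1) × (Fin h → IntervalCode V × IntervalCode V) → SimpleGraph V :=
    fun x => decodeGraph x.1 x.2.1 x.2.2
  have hsub : {G : SimpleGraph V | ∃ R : ConvexObstacleRep G, R.numObs ≤ h} ⊆ Set.range D := by
    rintro G ⟨R, hR⟩
    obtain ⟨k, κ, hG⟩ := exists_decodeGraph_eq R hR
    exact ⟨(⟨signs R.pos, R.pos, rfl⟩, k, κ), hG⟩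
  calc Nat.card {G : SimpleGraph V // ∃ R : ConvexObstacleRep G, R.numObs ≤ h}
      ≤ Nat.card (Set.range D) := Nat.card_mono (Set.finite_range D) hsub
    _ ≤ Nat.card (Set.range (signs : (V → ℝ × ℝ) → V × V × V × Fin 3 → SignType) ×
          Fin (h + 1) × (Fin h → IntervalCode V × IntervalCode V)) := Finite.card_range_le D
    _ = (Set.range (signs : (V → ℝ × ℝ) → V × V × V × Fin 3 → SignType)).ncard *
          ((h + 1) * (2 ^ (7 * Fintype.card V + 1) * 2 ^ (7 * Fintype.card V + 1)) ^ h) := by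
      rw [Nat.card_prod, Nat.card_coe_set_eq, Nat.card_eq_fintype_card (α := Fin (h + 1) × _),
        Fintype.card_prod, Fintype.card_fun, Fintype.card_prod, card_intervalCode,
        Fintype.card_fin, Fintype.card_fin]
    _ ≤ _ := Nat.mul_le_mul_right _ (ncard_range_signs_le V)

end LineArrangement

theorem pow_natCast_le_two_rpow_log {n : ℕ} (hn : 2 ≤ n) (m : ℕ) :
    ((n : ℝ) ^ m) ≤ (2 : ℝ) ^ (2 * (m : ℝ) * Real.log n) := by
  have hn' : (0 : ℝ) < n := by positivity
  have hlog : 0 ≤ Real.log n := Real.log_natCast_nonneg n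
  rw [← Real.rpow_natCast, Real.rpow_def_of_pos hn', Real.rpow_def_of_pos two_pos,
    Real.exp_le_exp]
  have h2 : (1 : ℝ) ≤ 2 * Real.log 2 := by linarith [Real.log_two_gt_d9]
  calc Real.log n * m = 1 * (Real.log n * m) := (one_mul _).symm
    _ ≤ 2 * Real.log 2 * (Real.log n * m) := by gcongr
    _ = Real.log 2 * (2 * m * Real.log n) := by ring

/-- The number of labeled `n`-vertex graphs with convex obstacle number at most `h`
is at most `2^{c·n·(h + log n)}`. -/
theorem count_graphs_bounded_convex_obstacle_number :
    ∃ c : ℝ, 0 < c ∧ ∀ h n : ℕ, 1 ≤ h → 2 ≤ n →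
      (Nat.card {G : SimpleGraph (Fin n) // ∃ R : ConvexObstacleRep G, R.numObs ≤ h} : ℝ) ≤
        (2 : ℝ) ^ (c * (n : ℝ) * ((h : ℝ) + Real.log (n : ℝ))) := by
  refine ⟨36, by norm_num, fun h n _ hn => ?_⟩
  have : Nonempty (Fin n) := ⟨⟨0, by omega⟩⟩
  have hcard := LineArrangement.card_convexObstacleGraphs_le (Fin n) h
  rw [Fintype.card_fin] at hcard
  have hsigns : 2 * n * (12 * n ^ 3 + 2) + 1 ≤ n ^ 9 := by
    have h1 : 2 ^ 5 * n ^ 4 ≤ n ^ 5 * n ^ 4 := by gcongr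
    have h2 : 2 ^ 3 * n ≤ n ^ 3 * n := by gcongr
    nlinarith
  have hcodes : (h + 1) * (2 ^ (7 * n + 1) * 2 ^ (7 * n + 1)) ^ h ≤ 2 ^ (17 * n * h) := by
    calc (h + 1) * (2 ^ (7 * n + 1) * 2 ^ (7 * n + 1)) ^ h
        ≤ 2 ^ h * (2 ^ (7 * n + 1) * 2 ^ (7 * n + 1)) ^ h := by
          gcongr
          exact Nat.lt_two_pow_self
      _ = 2 ^ ((14 * n + 3) * h) := by
        rw [← pow_add, ← pow_mul, ← pow_add]
        congr 1
        ring
      _ ≤ 2 ^ (17 * n * h) := by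
        gcongr
        · norm_num
        · omega
  have hnat : Nat.card {G : SimpleGraph (Fin n) // ∃ R : ConvexObstacleRep G, R.numObs ≤ h} ≤
      n ^ (18 * n) * 2 ^ (17 * n * h) := by
    refine hcard.trans (Nat.mul_le_mul ?_ hcodes)
    calc (2 * n * (12 * n ^ 3 + 2) + 1) ^ (2 * n) ≤ (n ^ 9) ^ (2 * n) := by gcongr
      _ = n ^ (18 * n) := by rw [← pow_mul]; congr 1; ring
  calc (Nat.card {G : SimpleGraph (Fin n) // ∃ R : ConvexObstacleRep G, R.numObs ≤ h} : ℝ)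
      ≤ (n : ℝ) ^ (18 * n) * (2 : ℝ) ^ (17 * n * h) := by exact_mod_cast hnat
    _ ≤ (2 : ℝ) ^ (2 * ((18 * n : ℕ) : ℝ) * Real.log n) * (2 : ℝ) ^ (17 * n * h) := by
      gcongr
      exact pow_natCast_le_two_rpow_log hn _
    _ = (2 : ℝ) ^ (36 * n * Real.log n + 17 * n * h) := by
      rw [← Real.rpow_natCast 2 (17 * n * h), ← Real.rpow_add two_pos]
      push_cast
      ring_nf
    _ ≤ (2 : ℝ) ^ (36 * (n : ℝ) * ((h : ℝ) + Real.log n)) := by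
      refine Real.rpow_le_rpow_of_exponent_le one_le_two ?_
      have : (0 : ℝ) ≤ n * h := by positivity
      linarith
end
end

section
/- There is a constant δ > 0 such that for every integer n ≥ 2 there exist a simple graph G on n vertices and an injective placement of its vertices at points of ℝ² in general position (a straight-line drawing D of G) with the following property: every finite family 𝒪 of pairwise disjoint simple polygons such that (i) for every edge uv of G the closed segment between the placed points of u and v is disjoint from every member of 𝒪, and (ii) for every pair of distinct non-adjacent vertices u, v of G the closed segment between their placed points intersects at least one member of 𝒪, has at least δ·n² members. In other words, there are drawings D of n-vertex graphs with obs(D) ≥ δ·n². -/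
open scoped Classical

noncomputable section

open Set

/-! ### Connectedness of simple polygons -/

lemma SimplePolygon.isClosed_boundary (P : SimplePolygon) : IsClosed P.boundary := by
  have : NeZero P.k := ⟨by have := P.three_le; omega⟩
  refine isClosed_iUnion_of_finite fun i => ?_
  rw [← convexHull_pair]
  exact ((Set.toFinite _).isCompact_convexHull (𝕜 := ℝ)).isClosed

lemma SimplePolygon.boundary_nonempty (P : SimplePolygon) : P.boundary.Nonempty :=
  ⟨P.verts 0, mem_iUnion.2 ⟨0, left_mem_segment ℝ _ _⟩⟩

lemma SimplePolygon.isPreconnected_boundary (P : SimplePolygon) :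
    IsPreconnected P.boundary := by
  have : NeZero P.k := ⟨by have := P.three_le; omega⟩
  have hchain : IsPreconnected (⋃ n : ℕ, segment ℝ (P.verts (n : ZMod P.k))
      (P.verts ((n : ZMod P.k) + 1))) := by
    refine IsPreconnected.iUnion_of_chain (fun n => (convex_segment _ _).isPreconnected)
      fun n => ⟨P.verts ((n : ZMod P.k) + 1), right_mem_segment ℝ _ _, ?_⟩
    rw [Order.succ_eq_add_one, Nat.cast_add, Nat.cast_one]
    exact left_mem_segment ℝ _ _
  rwa [(ZMod.natCast_zmod_surjective (n := P.k)).iUnion_comp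
    (fun i => segment ℝ (P.verts i) (P.verts (i + 1)))] at hchain

/-- A bounded component of the complement of a closed set in the plane touches that set. -/
lemma closure_connectedComponentIn_compl_inter_nonempty {B : Set (ℝ × ℝ)} (hB : IsClosed B)
    {x : ℝ × ℝ} (hx : x ∉ B) (hbdd : Bornology.IsBounded (connectedComponentIn Bᶜ x)) :
    (closure (connectedComponentIn Bᶜ x) ∩ B).Nonempty := by
  set C := connectedComponentIn Bᶜ x with hC
  have hxC : x ∈ C := mem_connectedComponentIn hx
  have hopen : IsOpen C := hB.isOpen_compl.connectedComponentIn
  have hne : C ≠ univ := fun h => NormedSpace.unbounded_univ ℝ (ℝ × ℝ) (h ▸ hbdd)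
  obtain ⟨b, hb⟩ := nonempty_frontier_iff.2 ⟨⟨x, hxC⟩, hne⟩
  refine ⟨b, frontier_subset_closure hb, by_contra fun hbB => ?_⟩
  have hpre : IsPreconnected (insert b C) :=
    isPreconnected_connectedComponentIn.subset_closure (subset_insert b C)
      (insert_subset (frontier_subset_closure hb) subset_closure)
  have hsub : insert b C ⊆ C :=
    hpre.subset_connectedComponentIn (mem_insert_of_mem b hxC)
      (insert_subset hbB (connectedComponentIn_subset _ _))
  rw [hopen.frontier_eq] at hb
  exact hb.2 (hsub (mem_insert b C))

lemma SimplePolygon.isPreconnected_toSet (P : SimplePolygon) : IsPreconnected P.toSet := by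
  obtain ⟨b₀, hb₀⟩ := P.boundary_nonempty
  refine isPreconnected_of_forall b₀ fun x hx => ?_
  rcases hx with hx | ⟨hx, hbdd⟩
  · exact ⟨P.boundary, subset_union_left, hb₀, hx, P.isPreconnected_boundary⟩
  · obtain ⟨b, hbC, hbB⟩ :=
      closure_connectedComponentIn_compl_inter_nonempty P.isClosed_boundary hx hbdd
    set C := connectedComponentIn P.boundaryᶜ x with hC
    have hpre : IsPreconnected (insert b C) :=
      isPreconnected_connectedComponentIn.subset_closure (subset_insert b C)
        (insert_subset hbC subset_closure)
    refine ⟨P.boundary ∪ insert b C, union_subset subset_union_left (insert_subset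
      (Or.inl hbB) fun y hy => Or.inr ⟨connectedComponentIn_subset _ _ hy, ?_⟩), Or.inl hb₀,
      Or.inr (mem_insert_of_mem b (mem_connectedComponentIn hx)),
      P.isPreconnected_boundary.union b hbB (mem_insert b C) hpre⟩
    rwa [← connectedComponentIn_eq hy]

/-! ### Triangles inscribed in a hyperbola -/

/-- The point with abscissa `r` on the hyperbola `x * y = 1`. -/
def hyperbolaPoint (r : ℝ) : ℝ × ℝ := (r, r⁻¹)

lemma not_collinear_hyperbolaPoint {a b c : ℝ} (ha : a ≠ 0) (hb : b ≠ 0) (hc : c ≠ 0)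
    (hab : a ≠ b) (hac : a ≠ c) (hbc : b ≠ c) :
    ¬ Collinear ℝ ({hyperbolaPoint a, hyperbolaPoint b, hyperbolaPoint c} : Set (ℝ × ℝ)) := by
  intro h
  rw [collinear_iff_of_mem (p₀ := hyperbolaPoint a) (by simp)] at h
  obtain ⟨v, hv⟩ := h
  obtain ⟨s, hs⟩ := hv (hyperbolaPoint b) (by simp)
  obtain ⟨t, ht⟩ := hv (hyperbolaPoint c) (by simp)
  simp only [hyperbolaPoint, vadd_eq_add, Prod.ext_iff, Prod.fst_add, Prod.snd_add,
    Prod.smul_fst, Prod.smul_snd, smul_eq_mul] at hs ht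
  have key : (b - a) * (c⁻¹ - a⁻¹) = (c - a) * (b⁻¹ - a⁻¹) := by
    linear_combination (c⁻¹ - a⁻¹) * hs.1 + s * v.1 * ht.2 - (c - a) * hs.2 - s * v.2 * ht.1
  field_simp at key
  have hprod : (b - a) * ((c - a) * (b - c)) = 0 := by linear_combination -key
  simp only [mul_eq_zero, sub_eq_zero] at hprod
  tauto

/-- The affine function vanishing on the line through `hyperbolaPoint s` and
`hyperbolaPoint t`. -/
def chordForm (s t : ℝ) (z : ℝ × ℝ) : ℝ := z.1 + s * t * z.2 - s - t

lemma continuous_chordForm (s t : ℝ) : Continuous (chordForm s t) := by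
  unfold chordForm; fun_prop

lemma chordForm_comm (s t : ℝ) (z : ℝ × ℝ) : chordForm s t z = chordForm t s z := by
  unfold chordForm; ring

/-- The barycentric coordinate with respect to the vertex `hyperbolaPoint r` in the triangle
with vertices `hyperbolaPoint r`, `hyperbolaPoint s`, `hyperbolaPoint t`. -/
def hyperbolaCoord (r s t : ℝ) (z : ℝ × ℝ) : ℝ := chordForm s t z * (r / ((r - s) * (r - t)))

lemma continuous_hyperbolaCoord (r s t : ℝ) : Continuous (hyperbolaCoord r s t) :=
  (continuous_chordForm s t).mul continuous_const

lemma hyperbolaCoord_combo (r s t : ℝ) {α β : ℝ} (h : α + β = 1) (z w : ℝ × ℝ) :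
    hyperbolaCoord r s t (α • z + β • w) =
      α * hyperbolaCoord r s t z + β * hyperbolaCoord r s t w := by
  simp only [hyperbolaCoord, chordForm, Prod.fst_add, Prod.snd_add, Prod.smul_fst,
    Prod.smul_snd, smul_eq_mul]
  linear_combination ((s + t) * (r / ((r - s) * (r - t)))) * h

lemma hyperbolaCoord_hyperbolaPoint (r s t : ℝ) {m : ℝ} (hm : m ≠ 0) :
    hyperbolaCoord r s t (hyperbolaPoint m) =
      ((m - s) * (m - t) / m) * (r / ((r - s) * (r - t))) := by
  simp only [hyperbolaCoord, chordForm, hyperbolaPoint]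
  congr 1
  field_simp
  ring

lemma mem_segment_of_hyperbolaCoord {r s t : ℝ} (hr : r ≠ 0) (hs : s ≠ 0) (ht : t ≠ 0)
    (hrs : r ≠ s) (hrt : r ≠ t) (hst : s ≠ t) {z : ℝ × ℝ} (h₁ : hyperbolaCoord r s t z = 0)
    (h₂ : 0 ≤ hyperbolaCoord s r t z) (h₃ : 0 ≤ hyperbolaCoord t r s z) :
    z ∈ segment ℝ (hyperbolaPoint s) (hyperbolaPoint t) := by
  have e1 := sub_ne_zero.2 hrs
  have e2 := sub_ne_zero.2 hrt
  have e3 := sub_ne_zero.2 hst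
  have e1' := sub_ne_zero.2 hrs.symm
  have e2' := sub_ne_zero.2 hrt.symm
  have e3' := sub_ne_zero.2 hst.symm
  have hz : z.1 = s + t - s * t * z.2 := by
    have : chordForm s t z = 0 := by
      simpa [hyperbolaCoord, hr, e1, e2] using h₁
    unfold chordForm at this; linarith
  refine ⟨_, _, h₂, h₃, ?_, ?_⟩
  · simp only [hyperbolaCoord, chordForm, hz]
    field_simp
    ring
  · simp only [hyperbolaCoord, chordForm, hyperbolaPoint, hz]
    ext
    · simp only [Prod.fst_add, Prod.smul_fst, smul_eq_mul, hz]
      field_simp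
      ring
    · simp only [Prod.snd_add, Prod.smul_snd, smul_eq_mul]
      field_simp
      ring

/-- A connected set that avoids the sides of a triangle inscribed in a hyperbola, with one vertex
`r` on one branch and two vertices `s`, `t` on the other, and that meets the chord from `r` to a
point `m` of the arc between `s` and `t`, lies inside the triangle. -/
lemma hyperbolaCoord_pos_of_isPreconnected {O : Set (ℝ × ℝ)} (hO : IsPreconnected O)
    {r s m t : ℝ} (hrs : r * s < 0) (hrt : r * t < 0) (hsm : s < m) (hmt : m < t)
    (drs : Disjoint (segment ℝ (hyperbolaPoint r) (hyperbolaPoint s)) O)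
    (drt : Disjoint (segment ℝ (hyperbolaPoint r) (hyperbolaPoint t)) O)
    (dst : Disjoint (segment ℝ (hyperbolaPoint s) (hyperbolaPoint t)) O)
    (hne : (segment ℝ (hyperbolaPoint r) (hyperbolaPoint m) ∩ O).Nonempty)
    {z : ℝ × ℝ} (hz : z ∈ O) :
    0 < hyperbolaCoord r s t z ∧ 0 < hyperbolaCoord s r t z ∧ 0 < hyperbolaCoord t r s z := by
  have hr : r ≠ 0 := by rintro rfl; simp at hrs
  have hs : s ≠ 0 := by rintro rfl; simp at hrs
  have ht : t ≠ 0 := by rintro rfl; simp at hrt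
  have hrs' : r ≠ s := by rintro rfl; nlinarith
  have hrt' : r ≠ t := by rintro rfl; nlinarith
  have hst' : s ≠ t := (hsm.trans hmt).ne
  let u : Set (ℝ × ℝ) := {z | 0 < hyperbolaCoord r s t z} ∩
    ({z | 0 < hyperbolaCoord s r t z} ∩ {z | 0 < hyperbolaCoord t r s z})
  let v : Set (ℝ × ℝ) := {z | hyperbolaCoord r s t z < 0} ∪
    ({z | hyperbolaCoord s r t z < 0} ∪ {z | hyperbolaCoord t r s z < 0})
  have hu : IsOpen u :=
    (isOpen_lt continuous_const (continuous_hyperbolaCoord _ _ _)).inter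
      ((isOpen_lt continuous_const (continuous_hyperbolaCoord _ _ _)).inter
        (isOpen_lt continuous_const (continuous_hyperbolaCoord _ _ _)))
  have hv : IsOpen v :=
    (isOpen_lt (continuous_hyperbolaCoord _ _ _) continuous_const).union
      ((isOpen_lt (continuous_hyperbolaCoord _ _ _) continuous_const).union
        (isOpen_lt (continuous_hyperbolaCoord _ _ _) continuous_const))
  have huv : Disjoint u v := by
    rw [Set.disjoint_left]
    intro y hyu hyv
    simp only [u, v, mem_union, mem_inter_iff, mem_ofPred_eq] at hyu hyv
    rcases hyv with h | h | h <;> linarith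
  have hcomm : ∀ a b c y, hyperbolaCoord a b c y = hyperbolaCoord a c b y := fun a b c y => by
    simp only [hyperbolaCoord, chordForm_comm b c, mul_comm (a - b)]
  have hcover : O ⊆ u ∪ v := by
    intro y hy
    by_contra hcon
    simp only [u, v, mem_union, mem_inter_iff, mem_ofPred_eq, not_or, not_lt] at hcon
    obtain ⟨hnu, h1, h2, h3⟩ := hcon
    rcases h1.eq_or_lt with h1' | h1'
    · exact Set.disjoint_left.1 dst
        (mem_segment_of_hyperbolaCoord hr hs ht hrs' hrt' hst' h1'.symm h2 h3) hy
    rcases h2.eq_or_lt with h2' | h2'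
    · exact Set.disjoint_left.1 drt
        (mem_segment_of_hyperbolaCoord hs hr ht hrs'.symm hst' hrt' h2'.symm h1
          (by rwa [hcomm])) hy
    rcases h3.eq_or_lt with h3' | h3'
    · exact Set.disjoint_left.1 drs
        (mem_segment_of_hyperbolaCoord ht hr hs hrt'.symm hst'.symm hrs' h3'.symm
          (by rwa [hcomm]) (by rwa [hcomm])) hy
    exact hnu ⟨h1', h2', h3'⟩
  have hmeet : (O ∩ u).Nonempty := by
    obtain ⟨y, ⟨α, β, hα, hβ, hαβ, rfl⟩, hyO⟩ := hne
    have hβ' : 0 < β := by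
      refine hβ.lt_of_ne fun h => Set.disjoint_left.1 drs (left_mem_segment ℝ _ _) ?_
      have hα1 : α = 1 := by linarith
      simpa [← h, hα1] using hyO
    have hm : r * m < 0 := by
      rcases lt_or_gt_of_ne hr with h | h
      · nlinarith
      · nlinarith
    have hm0 : m ≠ 0 := by rintro rfl; simp at hm
    have hsplit : (r < 0 ∧ 0 < s) ∨ (0 < r ∧ t < 0) := by
      rcases lt_or_gt_of_ne hr with h | h
      · exact Or.inl ⟨h, by nlinarith⟩
      · exact Or.inr ⟨h, by nlinarith⟩
    have hzero : ∀ a b, hyperbolaCoord a r b (hyperbolaPoint r) = 0 := fun a b => by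
      rw [hyperbolaCoord_hyperbolaPoint _ _ _ hr]; simp
    have hone : 0 < hyperbolaCoord r s t (hyperbolaPoint r) := by
      rw [hyperbolaCoord_hyperbolaPoint _ _ _ hr]
      have e1 := sub_ne_zero.2 hrs'
      have e2 := sub_ne_zero.2 hrt'
      field_simp
      norm_num
    have hmr : 0 < hyperbolaCoord r s t (hyperbolaPoint m) ∧
        0 < hyperbolaCoord s r t (hyperbolaPoint m) ∧
        0 < hyperbolaCoord t r s (hyperbolaPoint m) := by
      simp only [hyperbolaCoord_hyperbolaPoint _ _ _ hm0]
      rcases hsplit with ⟨h, h'⟩ | ⟨h, h'⟩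
      · refine ⟨mul_pos_of_neg_of_neg (div_neg_of_neg_of_pos (mul_neg_of_pos_of_neg ?_ ?_) ?_)
          (div_neg_of_neg_of_pos ?_ (mul_pos_of_neg_of_neg ?_ ?_)),
          mul_pos_of_neg_of_neg (div_neg_of_neg_of_pos (mul_neg_of_pos_of_neg ?_ ?_) ?_)
          (div_neg_of_pos_of_neg ?_ (mul_neg_of_pos_of_neg ?_ ?_)),
          mul_pos (div_pos (mul_pos ?_ ?_) ?_) (div_pos ?_ (mul_pos ?_ ?_))⟩ <;> linarith
      · refine ⟨mul_pos (div_pos_of_neg_of_neg (mul_neg_of_pos_of_neg ?_ ?_) ?_)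
          (div_pos ?_ (mul_pos ?_ ?_)),
          mul_pos_of_neg_of_neg (div_neg_of_pos_of_neg (mul_pos_of_neg_of_neg ?_ ?_) ?_)
          (div_neg_of_neg_of_pos ?_ (mul_pos_of_neg_of_neg ?_ ?_)),
          mul_pos (div_pos_of_neg_of_neg (mul_neg_of_neg_of_pos ?_ ?_) ?_)
          (div_pos_of_neg_of_neg ?_ (mul_neg_of_neg_of_pos ?_ ?_))⟩ <;> linarith
    refine ⟨_, hyO, ?_, ?_, ?_⟩ <;>
      simp only [mem_ofPred_eq, hyperbolaCoord_combo _ _ _ hαβ, hzero]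
    · exact add_pos_of_nonneg_of_pos (mul_nonneg hα hone.le) (mul_pos hβ' hmr.1)
    · linarith [mul_pos hβ' hmr.2.1]
    · linarith [mul_pos hβ' hmr.2.2]
  exact hO.subset_left_of_subset_union hu hv huv hcover hmeet hz

/-- The inequalities confining a connected set that avoids all edges around the chord between the
abscissae `p` and `-q`. -/
def Trapped (p q : ℝ) (z : ℝ × ℝ) : Prop :=
  (0 < chordForm (-(2 * q)) (-(q / 2)) z ∧ chordForm p (-(q / 2)) z < 0 ∧
    0 < chordForm p (-(2 * q)) z) ∧
  (chordForm (-q) (2 * p) z < 0 ∧ 0 < chordForm (-q) (p / 2) z)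

lemma trapped_of_isPreconnected {O : Set (ℝ × ℝ)} (hO : IsPreconnected O) {p q : ℝ} (hp : 0 < p)
    (hq : 0 < q)
    (d₁ : Disjoint (segment ℝ (hyperbolaPoint p) (hyperbolaPoint (-(2 * q)))) O)
    (d₂ : Disjoint (segment ℝ (hyperbolaPoint p) (hyperbolaPoint (-(q / 2)))) O)
    (d₃ : Disjoint (segment ℝ (hyperbolaPoint (-(2 * q))) (hyperbolaPoint (-(q / 2)))) O)
    (d₄ : Disjoint (segment ℝ (hyperbolaPoint (-q)) (hyperbolaPoint (p / 2))) O)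
    (d₅ : Disjoint (segment ℝ (hyperbolaPoint (-q)) (hyperbolaPoint (2 * p))) O)
    (d₆ : Disjoint (segment ℝ (hyperbolaPoint (p / 2)) (hyperbolaPoint (2 * p))) O)
    (hne : (segment ℝ (hyperbolaPoint (-q)) (hyperbolaPoint p) ∩ O).Nonempty)
    {z : ℝ × ℝ} (hz : z ∈ O) : Trapped p q z := by
  have hpq := mul_pos hp hq
  constructor
  · obtain ⟨h1, h2, h3⟩ := hyperbolaCoord_pos_of_isPreconnected hO (m := -q) (by nlinarith)
      (by nlinarith) (by linarith) (by linarith) d₁ d₂ d₃ (by rwa [segment_symm]) hz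
    refine ⟨pos_of_mul_pos_left h1 (div_pos hp (mul_pos ?_ ?_)).le,
      neg_of_mul_pos_left h2 (div_neg_of_neg_of_pos ?_ (mul_pos_of_neg_of_neg ?_ ?_)).le,
      pos_of_mul_pos_left h3 (div_pos_of_neg_of_neg ?_ (mul_neg_of_neg_of_pos ?_ ?_)).le⟩ <;>
      linarith
  · obtain ⟨-, h2, h3⟩ := hyperbolaCoord_pos_of_isPreconnected hO (m := p) (by nlinarith)
      (by nlinarith) (by linarith) (by linarith) d₄ d₅ d₆ hne hz
    refine ⟨neg_of_mul_pos_left h2 (div_neg_of_pos_of_neg ?_ (mul_neg_of_pos_of_neg ?_ ?_)).le,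
      pos_of_mul_pos_left h3 (div_pos ?_ (mul_pos ?_ ?_)).le⟩ <;> linarith

/-- Chords from the same point `p` to separated points do not trap a common point. -/
lemma not_trapped_of_same_left {p q₁ q₂ : ℝ} (hq₁ : 0 < q₁) (hq : 8 * q₁ ≤ q₂)
    {z : ℝ × ℝ} (h₁ : Trapped p q₁ z) (h₂ : Trapped p q₂ z) : False := by
  obtain ⟨⟨-, a1, a2⟩, -⟩ := h₁
  obtain ⟨⟨-, b1, b2⟩, -⟩ := h₂
  unfold chordForm at a1 a2 b1 b2
  have hpos : 0 < 1 - p * z.2 := by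
    by_contra! h
    nlinarith
  nlinarith

/-- Chords from the same point `-q` to separated points do not trap a common point. -/
lemma not_trapped_of_same_right {p₁ p₂ q : ℝ} (hp₁ : 0 < p₁) (hp : 8 * p₁ ≤ p₂)
    {z : ℝ × ℝ} (h₁ : Trapped p₁ q z) (h₂ : Trapped p₂ q z) : False := by
  obtain ⟨-, a1, a2⟩ := h₁
  obtain ⟨-, b1, b2⟩ := h₂
  unfold chordForm at a1 a2 b1 b2
  have hpos : 0 < 1 + q * z.2 := by
    by_contra! h
    nlinarith
  nlinarith

lemma not_trapped_three {p₁ p₂ p₃ q₁ q₂ q₃ : ℝ} (hp₁ : 0 < p₁) (hp₃ : 0 < p₃) (hq₁ : 0 < q₁)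
    (hq₂ : 0 < q₂)
    (hp : 8 * p₁ ≤ p₂) (hq : 8 * q₂ ≤ q₃) (hpq : q₂ ≤ p₁) {z : ℝ × ℝ}
    (h₁ : Trapped p₁ q₁ z) (h₂ : Trapped p₂ q₂ z) (h₃ : Trapped p₃ q₃ z) : False := by
  obtain ⟨⟨-, a1, a2⟩, -⟩ := h₁
  obtain ⟨⟨-, -, b2⟩, -⟩ := h₂
  obtain ⟨⟨c0, c1, -⟩, -⟩ := h₃
  unfold chordForm at a1 a2 b2 c0 c1
  have hpos : 0 < 1 - p₁ * z.2 := by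
    by_contra! h
    nlinarith
  have hx : z.1 < p₁ := by nlinarith
  have hy : -z.2 * q₃ < 2 := by
    have : 0 < (p₃ + 2 * q₃) * (1 + q₃ / 2 * z.2) := by nlinarith
    have := pos_of_mul_pos_right this (by linarith)
    linarith
  have hlow : p₂ - p₁ - 2 * q₂ < 2 * p₂ * (q₂ * -z.2) := by nlinarith
  have hup : 8 * (q₂ * -z.2) < 2 := by
    rcases le_or_gt 0 z.2 with h | h
    · nlinarith
    · nlinarith
  nlinarith

/-! ### The point set -/

/-- The abscissa of vertex `v`: the first `3 * N` vertices lie on the negative branch. -/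
def abscissa (N v : ℕ) : ℝ := if v < 3 * N then -2 ^ v else 2 ^ v

lemma abscissa_of_lt {N v : ℕ} (h : v < 3 * N) : abscissa N v = -2 ^ v := if_pos h

lemma abscissa_of_le {N v : ℕ} (h : 3 * N ≤ v) : abscissa N v = 2 ^ v := if_neg h.not_gt

lemma abs_abscissa (N v : ℕ) : |abscissa N v| = 2 ^ v := by
  unfold abscissa; split_ifs <;> simp

lemma abscissa_ne_zero (N v : ℕ) : abscissa N v ≠ 0 := by
  rw [← abs_pos, abs_abscissa]; positivity

lemma abscissa_injective (N : ℕ) : Function.Injective (abscissa N) := fun u v h =>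
  pow_right_injective₀ (a := (2 : ℝ)) (by norm_num) (by norm_num)
    (by simpa only [abs_abscissa] using congrArg abs h)

/-- The pairs of vertices that are declared non-adjacent: midpoints of triples of consecutive
vertices on opposite branches. -/
def MiddlePair (N u v : ℕ) : Prop :=
  u % 3 = 1 ∧ v % 3 = 1 ∧ u < 3 * N ∧ 3 * N ≤ v ∧ v < 6 * N

/-- The complete graph without the middle pairs. -/
def middleGraph (N n : ℕ) : SimpleGraph (Fin n) :=
  (SimpleGraph.fromRel fun u v : Fin n => MiddlePair N u v)ᶜ

lemma middleGraph_adj {N n : ℕ} {u v : Fin n} :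
    (middleGraph N n).Adj u v ↔ u ≠ v ∧ ¬ MiddlePair N u v ∧ ¬ MiddlePair N v u := by
  simp only [middleGraph, SimpleGraph.compl_adj, SimpleGraph.fromRel_adj]
  tauto

lemma eight_mul_two_pow_le {a b : ℕ} (h : a + 3 ≤ b) : (8 : ℝ) * 2 ^ a ≤ 2 ^ b := by
  calc (8 : ℝ) * 2 ^ a = 2 ^ (a + 3) := by ring
    _ ≤ 2 ^ b := pow_le_pow_right₀ (by norm_num) h

/-- A single point is trapped by at most two of the middle pairs. -/
lemma card_le_two_of_trapped {N : ℕ} (S : Finset (Fin N × Fin N)) (z : ℝ × ℝ)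
    (hS : ∀ e ∈ S, Trapped (2 ^ (3 * (N + e.2.val) + 1)) (2 ^ (3 * e.1.val + 1)) z) :
    S.card ≤ 2 := by
  have hleft : ∀ e ∈ S, ∀ f ∈ S, e.2 = f.2 → ¬ e.1 < f.1 := by
    intro e he f hf h hlt
    rw [Fin.lt_def] at hlt
    exact not_trapped_of_same_left (by positivity) (eight_mul_two_pow_le (by omega))
      (h ▸ hS e he) (hS f hf)
  have hright : ∀ e ∈ S, ∀ f ∈ S, e.1 = f.1 → ¬ e.2 < f.2 := by
    intro e he f hf h hlt
    rw [Fin.lt_def] at hlt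
    exact not_trapped_of_same_right (by positivity) (eight_mul_two_pow_le (by omega))
      (h ▸ hS e he) (hS f hf)
  have hthree : ∀ e ∈ S, ∀ f ∈ S, ∀ g ∈ S, e.2 < f.2 → ¬ f.1 < g.1 := by
    intro e he f hf g hg hlt hlt'
    rw [Fin.lt_def] at hlt hlt'
    exact not_trapped_three (by positivity) (by positivity) (by positivity) (by positivity)
      (eight_mul_two_pow_le (by omega)) (eight_mul_two_pow_le (by omega))
      (pow_le_pow_right₀ (by norm_num) (by omega)) (hS e he) (hS f hf) (hS g hg)
  by_contra! hcard
  obtain ⟨a, b, c, ha, hb, hc, hab, hac, hbc⟩ := Finset.two_lt_card.1 hcard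
  have hne : ∀ e ∈ S, ∀ f ∈ S, e ≠ f → e.1 ≠ f.1 ∧ e.2 ≠ f.2 := by
    intro e he f hf hef
    refine ⟨fun h => hef (Prod.ext h ?_), fun h => hef (Prod.ext ?_ h)⟩
    · exact le_antisymm (not_lt.1 (hright f hf e he h.symm)) (not_lt.1 (hright e he f hf h))
    · exact le_antisymm (not_lt.1 (hleft f hf e he h.symm)) (not_lt.1 (hleft e he f hf h))
  grind

/-- An obstacle blocking a middle pair traps all of its points. -/
lemma trapped_of_blocked {N n : ℕ} (hn : 6 * N ≤ n) (P : SimplePolygon)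
    (hedge : ∀ u v : Fin n, (middleGraph N n).Adj u v →
      Disjoint (segment ℝ (hyperbolaPoint (abscissa N u)) (hyperbolaPoint (abscissa N v))) P.toSet)
    (j i : Fin N)
    (hne : (segment ℝ (hyperbolaPoint (abscissa N (3 * j + 1)))
      (hyperbolaPoint (abscissa N (3 * (N + i) + 1))) ∩ P.toSet).Nonempty)
    {z : ℝ × ℝ} (hz : z ∈ P.toSet) :
    Trapped (2 ^ (3 * (N + i.val) + 1)) (2 ^ (3 * j.val + 1)) z := by
  have hj := j.isLt
  have hi := i.isLt
  have hdisj : ∀ u v : ℕ, u < n → v < n → u ≠ v → ¬ MiddlePair N u v → ¬ MiddlePair N v u →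
      Disjoint (segment ℝ (hyperbolaPoint (abscissa N u)) (hyperbolaPoint (abscissa N v)))
        P.toSet := fun u v hu hv huv h1 h2 =>
    hedge ⟨u, hu⟩ ⟨v, hv⟩ (middleGraph_adj.2 ⟨by simpa [Fin.ext_iff] using huv, h1, h2⟩)
  have hq : abscissa N (3 * j + 1) = -2 ^ (3 * j.val + 1) := abscissa_of_lt (by omega)
  have hqs : abscissa N (3 * j) = -(2 ^ (3 * j.val + 1) / 2) := by
    rw [abscissa_of_lt (by omega)]; ring
  have hqt : abscissa N (3 * j + 2) = -(2 * 2 ^ (3 * j.val + 1)) := by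
    rw [abscissa_of_lt (by omega)]; ring
  have hp : abscissa N (3 * (N + i) + 1) = 2 ^ (3 * (N + i.val) + 1) := abscissa_of_le (by omega)
  have hps : abscissa N (3 * (N + i)) = 2 ^ (3 * (N + i.val) + 1) / 2 := by
    rw [abscissa_of_le (by omega)]; ring
  have hpt : abscissa N (3 * (N + i) + 2) = 2 * 2 ^ (3 * (N + i.val) + 1) := by
    rw [abscissa_of_le (by omega)]; ring
  refine trapped_of_isPreconnected P.isPreconnected_toSet (by positivity) (by positivity)
    ?_ ?_ ?_ ?_ ?_ ?_ (by rwa [← hq, ← hp]) hz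
  · rw [← hp, ← hqt]
    apply hdisj <;> (try simp only [MiddlePair]) <;> omega
  · rw [← hp, ← hqs]
    apply hdisj <;> (try simp only [MiddlePair]) <;> omega
  · rw [← hqt, ← hqs]
    apply hdisj <;> (try simp only [MiddlePair]) <;> omega
  · rw [← hq, ← hps]
    apply hdisj <;> (try simp only [MiddlePair]) <;> omega
  · rw [← hq, ← hpt]
    apply hdisj <;> (try simp only [MiddlePair]) <;> omega
  · rw [← hps, ← hpt]
    apply hdisj <;> (try simp only [MiddlePair]) <;> omega

lemma sq_le_two_mul_card_obstacles {N n m : ℕ} (hn : 6 * N ≤ n) (obs : Fin m → SimplePolygon)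
    (hedge : ∀ u v : Fin n, (middleGraph N n).Adj u v → ∀ i,
      Disjoint (segment ℝ (hyperbolaPoint (abscissa N u)) (hyperbolaPoint (abscissa N v)))
        (obs i).toSet)
    (hnon : ∀ u v : Fin n, u ≠ v → ¬ (middleGraph N n).Adj u v →
      ∃ i, (segment ℝ (hyperbolaPoint (abscissa N u)) (hyperbolaPoint (abscissa N v)) ∩
        (obs i).toSet).Nonempty) :
    N ^ 2 ≤ 2 * m := by
  have hblock : ∀ e : Fin N × Fin N, ∃ k,
      (segment ℝ (hyperbolaPoint (abscissa N (3 * e.1 + 1)))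
        (hyperbolaPoint (abscissa N (3 * (N + e.2) + 1))) ∩ (obs k).toSet).Nonempty := by
    rintro ⟨j, i⟩
    have hj := j.isLt
    have hi := i.isLt
    refine hnon ⟨3 * j + 1, by omega⟩ ⟨3 * (N + i) + 1, by omega⟩
      (by rw [Ne, Fin.mk.injEq]; omega) fun h => (middleGraph_adj.1 h).2.1 ?_
    simp only [MiddlePair]
    omega
  choose f hf using hblock
  have hcard := Finset.card_le_mul_card_image (f := f) Finset.univ 2 fun k _ => by
    obtain ⟨z, hz⟩ := (obs k).boundary_nonempty
    refine card_le_two_of_trapped _ z fun e he => ?_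
    obtain rfl := (Finset.mem_filter.1 he).2
    exact trapped_of_blocked hn _ (fun u v h => hedge u v h _) e.1 e.2 (hf e) (Or.inl hz)
  calc N ^ 2 = (Finset.univ : Finset (Fin N × Fin N)).card := by simp [sq]
    _ ≤ 2 * (Finset.univ.image f).card := hcard
    _ ≤ 2 * m := by
      gcongr
      simpa using Finset.card_le_univ (Finset.univ.image f)

/-- There is a constant `δ > 0` such that for every `n ≥ 2` there are an `n`-vertex
graph `G` and a straight-line drawing `D` of `G` (an injective placement in general
position) such that every family of pairwise disjoint simple polygons turning `D`
into an obstacle representation of `G` has at least `δ·n²` members. -/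
theorem obstacle_number_of_drawings_lower_bound :
    ∃ δ : ℝ, 0 < δ ∧ ∀ n : ℕ, 2 ≤ n →
      ∃ (G : SimpleGraph (Fin n)) (pos : Fin n → ℝ × ℝ),
        Function.Injective pos ∧
        (∀ u v w : Fin n, u ≠ v → u ≠ w → v ≠ w →
          ¬ Collinear ℝ ({pos u, pos v, pos w} : Set (ℝ × ℝ))) ∧
        ∀ (m : ℕ) (obs : Fin m → SimplePolygon),
          (∀ i j : Fin m, i ≠ j → Disjoint (obs i).toSet (obs j).toSet) →
          (∀ u v : Fin n, G.Adj u v → ∀ i,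
            Disjoint (segment ℝ (pos u) (pos v)) (obs i).toSet) →
          (∀ u v : Fin n, u ≠ v → ¬ G.Adj u v →
            ∃ i, (segment ℝ (pos u) (pos v) ∩ (obs i).toSet).Nonempty) →
          δ * (n : ℝ) ^ 2 ≤ (m : ℝ) := by
  refine ⟨1 / 242, by norm_num, fun n hn => ?_⟩
  refine ⟨if n < 6 then ⊥ else middleGraph (n / 6) n,
    fun v => hyperbolaPoint (abscissa (n / 6) v), ?_, ?_, ?_⟩
  · intro u v h
    exact Fin.ext (abscissa_injective _ (congrArg Prod.fst h))
  · intro u v w huv huw hvw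
    have hinj := (abscissa_injective (n / 6)).comp (Fin.val_injective (n := n))
    exact not_collinear_hyperbolaPoint (abscissa_ne_zero _ _) (abscissa_ne_zero _ _)
      (abscissa_ne_zero _ _) (hinj.ne huv) (hinj.ne huw) (hinj.ne hvw)
  · intro m obs _ hedge hnon
    split_ifs at hedge hnon with h6
    · obtain ⟨i, -⟩ := hnon ⟨0, by omega⟩ ⟨1, by omega⟩ (by simp) (by simp)
      have hm : (1 : ℝ) ≤ m := by exact_mod_cast i.pos
      have hn5 : (n : ℝ) ≤ 5 := by exact_mod_cast Nat.le_of_lt_succ h6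
      nlinarith [(Nat.cast_nonneg n : (0 : ℝ) ≤ n)]
    · have hsq := sq_le_two_mul_card_obstacles (Nat.mul_div_le n 6) obs hedge hnon
      have hsq' : ((n / 6 : ℕ) : ℝ) ^ 2 ≤ 2 * m := by exact_mod_cast hsq
      have hN : (n : ℝ) ≤ 11 * (n / 6 : ℕ) := by
        exact_mod_cast (by omega : n ≤ 11 * (n / 6))
      have := pow_le_pow_left₀ (Nat.cast_nonneg n) hN 2
      nlinarith
end
end
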